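/- For all ε₁>0, every function ε₂:ℕ→(0,1], and all integers ℓ₀,t₀≥1, there exist positive integers T₀=T₀(ε₁,ε₂,t₀,ℓ₀) and L₀=L₀(ε₁,ε₂,t₀,ℓ₀) such that every sufficiently large 3-graph H=(V,E) admits an equitable, dev_{2,3}(ε₁,ε₂(ℓ))-regular (t,ℓ,ε₁,ε₂(ℓ))-decomposition 𝒫 with t₀≤t≤T₀ and ℓ₀≤ℓ≤L₀. -/

import Mathlib

open scoped Classical
open Finset

set_option maxHeartbeats 1000000

/-- A 3-uniform hypergraph on a finite vertex set of naturals. -/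
structure ThreeGraph where
  verts : Finset ℕ
  edges : Finset (Finset ℕ)
  edges_sub : ∀ e ∈ edges, e ⊆ verts ∧ e.card = 3

/-- The set `Ē` of ordered triples corresponding to edges. -/
def ThreeGraph.obar (H : ThreeGraph) : Finset (ℕ × ℕ × ℕ) :=
  (H.verts ×ˢ H.verts ×ˢ H.verts).filter fun p => ({p.1, p.2.1, p.2.2} : Finset ℕ) ∈ H.edges

/-- A bigraph `(U,V;E)`. -/
structure Bigraph where
  left : Finset ℕ
  right : Finset ℕ
  edges : Finset (ℕ × ℕ)
  edges_sub : edges ⊆ left ×ˢ right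

noncomputable def Bigraph.density (B : Bigraph) : ℝ :=
  (B.edges.card : ℝ) / ((B.left.card : ℝ) * (B.right.card : ℝ))

noncomputable def Bigraph.gfun (B : Bigraph) (u w : ℕ) : ℝ :=
  if (u, w) ∈ B.edges then 1 - B.density else -B.density

noncomputable def Bigraph.devSum (B : Bigraph) : ℝ :=
  ∑ u₀ ∈ B.left, ∑ u₁ ∈ B.left, ∑ w₀ ∈ B.right, ∑ w₁ ∈ B.right,
    B.gfun u₀ w₀ * B.gfun u₀ w₁ * B.gfun u₁ w₀ * B.gfun u₁ w₁

/-- `B` has `dev₂(ε,d)`. -/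
def Bigraph.dev2 (B : Bigraph) (ε d : ℝ) : Prop :=
  |B.density - d| ≤ ε ∧ B.devSum ≤ ε * (B.left.card : ℝ) ^ 2 * (B.right.card : ℝ) ^ 2

/-- `B` has `dev₂(ε)`, i.e. `dev₂(ε, d_B)`. -/
def Bigraph.dev2self (B : Bigraph) (ε : ℝ) : Prop := B.dev2 ε B.density

noncomputable def Bigraph.dBetween (B : Bigraph) (X Y : Finset ℕ) : ℝ :=
  ((B.edges ∩ X ×ˢ Y).card : ℝ) / ((X.card : ℝ) * (Y.card : ℝ))

/-- `ε`-regularity for a bigraph. -/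
def Bigraph.EpsRegular (B : Bigraph) (ε : ℝ) : Prop :=
  ∀ X ⊆ B.left, ∀ Y ⊆ B.right,
    ε * (B.left.card : ℝ) ≤ (X.card : ℝ) → ε * (B.right.card : ℝ) ≤ (Y.card : ℝ) →
      |B.density - B.dBetween X Y| ≤ ε

/-- Irreducibility: distinct vertices have distinct neighborhoods, on both sides. -/
def Bigraph.Irreducible (B : Bigraph) : Prop :=
  (∀ u ∈ B.left, ∀ u' ∈ B.left, (∀ v : ℕ, (u, v) ∈ B.edges ↔ (u', v) ∈ B.edges) → u = u') ∧
  (∀ v ∈ B.right, ∀ v' ∈ B.right, (∀ u : ℕ, (u, v) ∈ B.edges ↔ (u, v') ∈ B.edges) → v = v')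

def Bigraph.leftNbhd (B : Bigraph) (v : ℕ) : Finset ℕ :=
  B.left.filter fun u => (u, v) ∈ B.edges

/-- `B` contains an induced copy of the abstract bigraph on `Fin k × Fin k` given by `F`. -/
def Bigraph.HasInducedPattern (B : Bigraph) (k : ℕ) (F : Fin k → Fin k → Prop) : Prop :=
  ∃ u v : Fin k → ℕ, (∀ a, u a ∈ B.left) ∧ (∀ b, v b ∈ B.right) ∧
    ∀ a b, ((u a, v b) ∈ B.edges ↔ F a b)

/-- A triad `(X,Y,Z; E_XY, E_YZ, E_XZ)`. -/
structure Triad where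
  X : Finset ℕ
  Y : Finset ℕ
  Z : Finset ℕ
  EXY : Finset (ℕ × ℕ)
  EYZ : Finset (ℕ × ℕ)
  EXZ : Finset (ℕ × ℕ)
  hXY : EXY ⊆ X ×ˢ Y
  hYZ : EYZ ⊆ Y ×ˢ Z
  hXZ : EXZ ⊆ X ×ˢ Z

def Triad.K3 (G : Triad) : Finset (ℕ × ℕ × ℕ) :=
  (G.X ×ˢ G.Y ×ˢ G.Z).filter fun p =>
    (p.1, p.2.1) ∈ G.EXY ∧ (p.2.1, p.2.2) ∈ G.EYZ ∧ (p.1, p.2.2) ∈ G.EXZ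

def Triad.bXY (G : Triad) : Bigraph := ⟨G.X, G.Y, G.EXY, G.hXY⟩
def Triad.bYZ (G : Triad) : Bigraph := ⟨G.Y, G.Z, G.EYZ, G.hYZ⟩
def Triad.bXZ (G : Triad) : Bigraph := ⟨G.X, G.Z, G.EXZ, G.hXZ⟩

/-- `d_H(G)` where the (tri)graph is given by its set `R` of ordered triples. -/
noncomputable def relDensity (R : Finset (ℕ × ℕ × ℕ)) (G : Triad) : ℝ :=
  ((R ∩ G.K3).card : ℝ) / (G.K3.card : ℝ)

noncomputable def hFun (R : Finset (ℕ × ℕ × ℕ)) (G : Triad) (x y z : ℕ) : ℝ :=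
  if (x, y, z) ∈ G.K3 then
    (if (x, y, z) ∈ R then 1 - relDensity R G else -(relDensity R G))
  else 0

noncomputable def devSum3 (R : Finset (ℕ × ℕ × ℕ)) (G : Triad) : ℝ :=
  ∑ u₀ ∈ G.X, ∑ u₁ ∈ G.X, ∑ w₀ ∈ G.Y, ∑ w₁ ∈ G.Y, ∑ z₀ ∈ G.Z, ∑ z₁ ∈ G.Z,
    hFun R G u₀ w₀ z₀ * hFun R G u₀ w₀ z₁ * hFun R G u₀ w₁ z₀ * hFun R G u₀ w₁ z₁ *
      hFun R G u₁ w₀ z₀ * hFun R G u₁ w₀ z₁ * hFun R G u₁ w₁ z₀ * hFun R G u₁ w₁ z₁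

/-- `(H,G)` has `dev_{2,3}(ε₁,ε₂)`, where the trigraph/3-graph is given by triples `R`. -/
def dev23 (R : Finset (ℕ × ℕ × ℕ)) (G : Triad) (ε₁ ε₂ : ℝ) : Prop :=
  ∃ dXY dYZ dXZ : ℝ, 0 < dXY ∧ 0 < dYZ ∧ 0 < dXZ ∧
    G.bXY.dev2 ε₂ dXY ∧ G.bXZ.dev2 ε₂ dXZ ∧ G.bYZ.dev2 ε₂ dYZ ∧
    devSum3 R G ≤ ε₁ * dXY ^ 4 * dYZ ^ 4 * dXZ ^ 4 *
      (G.X.card : ℝ) ^ 2 * (G.Y.card : ℝ) ^ 2 * (G.Z.card : ℝ) ^ 2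

/-- `G` is `μ`-homogeneous with respect to the triples `R`: `d_H(G) ∈ [0,μ) ∪ (1-μ,1]`. -/
def homTriad (R : Finset (ℕ × ℕ × ℕ)) (G : Triad) (μ : ℝ) : Prop :=
  relDensity R G < μ ∨ 1 - μ < relDensity R G

/-- A `(t,ℓ)`-decomposition of `V`, with part-indices `ι` and pair-indices `κ`. -/
structure Decomp (V : Finset ℕ) (ι κ : Type) where
  part : ι → Finset ℕ
  part_sub : ∀ i, part i ⊆ V
  part_disj : ∀ i j, i ≠ j → Disjoint (part i) (part j)
  part_cover : ∀ x ∈ V, ∃ i, x ∈ part i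
  pairs : ι → ι → κ → Finset (ℕ × ℕ)
  pairs_sub : ∀ i j α, pairs i j α ⊆ part i ×ˢ part j
  pairs_disj : ∀ i j α β, α ≠ β → Disjoint (pairs i j α) (pairs i j β)
  pairs_cover : ∀ i j, ∀ p ∈ part i ×ˢ part j, ∃ α, p ∈ pairs i j α

def Decomp.pairBG {V : Finset ℕ} {ι κ : Type} (P : Decomp V ι κ) (i j : ι) (α : κ) : Bigraph :=
  ⟨P.part i, P.part j, P.pairs i j α, P.pairs_sub i j α⟩

/-- The triad `G^{ijk}_{α,β,γ} = (V_i,V_j,V_k; P^α_{ij}, P^β_{ik}, P^γ_{jk})`. -/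
def Decomp.triadOf {V : Finset ℕ} {ι κ : Type} (P : Decomp V ι κ) (i j k : ι) (α β γ : κ) :
    Triad :=
  ⟨P.part i, P.part j, P.part k, P.pairs i j α, P.pairs j k γ, P.pairs i k β,
    P.pairs_sub i j α, P.pairs_sub j k γ, P.pairs_sub i k β⟩

/-- `P` is a `(t,ℓ,ε₁,ε₂)`-decomposition. -/
def Decomp.isReg {V : Finset ℕ} {ι κ : Type} (P : Decomp V ι κ) (ε₁ ε₂ : ℝ) : Prop :=
  (1 - ε₁) * (V.card : ℝ) ^ 2 ≤
    (((V ×ˢ V).filter fun p =>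
      ∃ i j α, p ∈ P.pairs i j α ∧ (P.pairBG i j α).dev2self ε₂).card : ℝ)

/-- `P` is equitable. -/
def Decomp.isEquitable {V : Finset ℕ} {ι κ : Type} [Fintype κ]
    (P : Decomp V ι κ) (ε₁ ε₂ : ℝ) : Prop :=
  (∀ i j, (P.part i).card ≤ (P.part j).card + 1) ∧
  (1 - ε₁) * (V.card : ℝ) ^ 2 ≤
    (((V ×ˢ V).filter fun p =>
      ∃ i j α, p ∈ P.pairs i j α ∧
        (P.pairBG i j α).dev2 ε₂ (1 / (Fintype.card κ : ℝ))).card : ℝ)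

/-- `P` is `dev_{2,3}(ε₁,ε₂)`-regular with respect to the triples `R`. -/
def Decomp.regWrt {V : Finset ℕ} {ι κ : Type} (P : Decomp V ι κ)
    (R : Finset (ℕ × ℕ × ℕ)) (ε₁ ε₂ : ℝ) : Prop :=
  (1 - ε₁) * (V.card : ℝ) ^ 3 ≤
    (((V ×ˢ V ×ˢ V).filter fun p =>
      ∃ i j k α β γ, p ∈ (P.triadOf i j k α β γ).K3 ∧
        dev23 R (P.triadOf i j k α β γ) ε₁ ε₂).card : ℝ)

/-- The triad `G^{ijk}_{α,β,γ}` of `P` is `μ`-non-trivial. -/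
def Decomp.nonTrivTriad {V : Finset ℕ} {t ℓ : ℕ} (P : Decomp V (Fin t) (Fin ℓ)) (μ : ℝ)
    (i j k : Fin t) (α β γ : Fin ℓ) : Prop :=
  μ * (V.card : ℝ) / (t : ℝ) ≤ ((P.part i).card : ℝ) ∧
  μ * (V.card : ℝ) / (t : ℝ) ≤ ((P.part j).card : ℝ) ∧
  μ * (V.card : ℝ) / (t : ℝ) ≤ ((P.part k).card : ℝ) ∧
  μ * ((P.part i).card : ℝ) * ((P.part j).card : ℝ) / (ℓ : ℝ) ≤ ((P.pairs i j α).card : ℝ) ∧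
  μ * ((P.part i).card : ℝ) * ((P.part k).card : ℝ) / (ℓ : ℝ) ≤ ((P.pairs i k β).card : ℝ) ∧
  μ * ((P.part j).card : ℝ) * ((P.part k).card : ℝ) / (ℓ : ℝ) ≤ ((P.pairs j k γ).card : ℝ)

/-- `H` has a `dev_{2,3}(ε₁,ε₂)`-regular `(t,ℓ,ε₁,ε₂)`-decomposition. -/
def GoodDecomp (H : ThreeGraph) (t ℓ : ℕ) (ε₁ ε₂ : ℝ) : Prop :=
  ∃ P : Decomp H.verts (Fin t) (Fin ℓ), P.isReg ε₁ ε₂ ∧ P.regWrt H.obar ε₁ ε₂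

def ThreeGraph.Iso (H₁ H₂ : ThreeGraph) : Prop :=
  ∃ f : ℕ → ℕ, Set.BijOn f ↑H₁.verts ↑H₂.verts ∧
    ∀ x ∈ H₁.verts, ∀ y ∈ H₁.verts, ∀ z ∈ H₁.verts,
      (({x, y, z} : Finset ℕ) ∈ H₁.edges ↔ ({f x, f y, f z} : Finset ℕ) ∈ H₂.edges)

def ThreeGraph.induce (H : ThreeGraph) (W : Finset ℕ) : ThreeGraph where
  verts := H.verts ∩ W
  edges := H.edges.filter fun e => e ⊆ W
  edges_sub := by
    intro e he
    rw [Finset.mem_filter] at he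
    obtain ⟨hsub, hcard⟩ := H.edges_sub e he.1
    exact ⟨fun x hx => Finset.mem_inter.mpr ⟨hsub hx, he.2 hx⟩, hcard⟩

/-- A hereditary property of 3-graphs. -/
def Hereditary (ℋ : Set ThreeGraph) : Prop :=
  (∀ H₁ H₂ : ThreeGraph, ThreeGraph.Iso H₁ H₂ → H₁ ∈ ℋ → H₂ ∈ ℋ) ∧
  (∀ H ∈ ℋ, ∀ W : Finset ℕ, H.induce W ∈ ℋ)

/-- The statement `ψ(ε₁,ε₂,T,L,ℋ)`. -/
def psi (ε₁ : ℝ) (ε₂ : ℕ → ℝ) (T L : ℕ) (ℋ : Set ThreeGraph) : Prop :=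
  ∃ n₀ : ℕ, ∀ H ∈ ℋ, n₀ ≤ H.verts.card →
    ∃ t ℓ : ℕ, 1 ≤ t ∧ t ≤ T ∧ 1 ≤ ℓ ∧ ℓ ≤ L ∧ GoodDecomp H t ℓ ε₁ (ε₂ ℓ)

/-- `L_ℋ(ε₁,ε₂)`: minimal `L` such that `ψ(ε₁,ε₂,T,L,ℋ)` holds for some `T ≥ 1`. -/
noncomputable def Lfun (ℋ : Set ThreeGraph) (ε₁ : ℝ) (ε₂ : ℕ → ℝ) : ℕ :=
  sInf {L : ℕ | ∃ T : ℕ, 1 ≤ T ∧ psi ε₁ ε₂ T L ℋ}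

def InZeroOne (f : ℕ → ℝ) : Prop := ∀ x, 0 < f x ∧ f x ≤ 1

/-- "For all sufficiently small `ε₁ > 0` and all `ε₂` tending to `0` sufficiently fast, `Φ`". -/
def SmallEps (Φ : ℝ → (ℕ → ℝ) → Prop) : Prop :=
  ∃ e₁ : ℝ, 0 < e₁ ∧ ∀ ε₁ : ℝ, 0 < ε₁ → ε₁ < e₁ →
    ∃ δ : ℕ → ℝ, InZeroOne δ ∧
      ∀ ε₂ : ℕ → ℝ, InZeroOne ε₂ → (∀ x, ε₂ x ≤ δ x) → Φ ε₁ ε₂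

/-- The `VC₂`-dimension of `H` is at least `k`. -/
def ThreeGraph.VC2AtLeast (H : ThreeGraph) (k : ℕ) : Prop :=
  ∃ a b : Fin k → ℕ, ∃ c : Finset (Fin k × Fin k) → ℕ,
    (∀ i, a i ∈ H.verts) ∧ (∀ i, b i ∈ H.verts) ∧ (∀ S, c S ∈ H.verts) ∧
    ∀ (i j : Fin k) (S : Finset (Fin k × Fin k)),
      (({a i, b j, c S} : Finset ℕ) ∈ H.edges ↔ (i, j) ∈ S)

/-- `K₃[A,B,C]`: the triples meeting each of `A`, `B`, `C`. -/
def K3Parts (A B C : Finset ℕ) : Finset (Finset ℕ) :=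
  (A ×ˢ B ×ˢ C).image fun p => ({p.1, p.2.1, p.2.2} : Finset ℕ)

/-- Neighborhood of `u` in the pair-set `W`, inside ambient set `V`. -/
def Nbhd (V : Finset ℕ) (W : Finset (ℕ × ℕ)) (u : ℕ) : Finset ℕ :=
  V.filter fun v => (u, v) ∈ W

/-- An edge-colored bigraph `(U,V;E₀,E₁,E₂)`. -/
structure ECBigraph where
  left : Finset ℕ
  right : Finset ℕ
  E0 : Finset (ℕ × ℕ)
  E1 : Finset (ℕ × ℕ)
  E2 : Finset (ℕ × ℕ)
  disj01 : Disjoint E0 E1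
  disj02 : Disjoint E0 E2
  disj12 : Disjoint E1 E2
  cover : E0 ∪ E1 ∪ E2 = left ×ˢ right

/-- `G` contains an `E₀/E₁`-copy of `U_bg(k)`. -/
def ECBigraph.CopyUbg (G : ECBigraph) (k : ℕ) : Prop :=
  ∃ u : Finset (Fin k) → ℕ, ∃ v : Fin k → ℕ,
    (∀ S, u S ∈ G.left) ∧ (∀ i, v i ∈ G.right) ∧
    ∀ (S : Finset (Fin k)) (i : Fin k),
      (i ∈ S → (u S, v i) ∈ G.E1) ∧ (i ∉ S → (u S, v i) ∈ G.E0)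

/-- `G` contains an `E₀/E₁`-copy of the bigraph `R`. -/
def ECBigraph.Copy01 (G : ECBigraph) (R : Bigraph) : Prop :=
  ∃ u v : ℕ → ℕ,
    (∀ a ∈ R.left, u a ∈ G.left) ∧ (∀ b ∈ R.right, v b ∈ G.right) ∧
    ∀ a ∈ R.left, ∀ b ∈ R.right,
      ((a, b) ∈ R.edges → (u a, v b) ∈ G.E1) ∧ ((a, b) ∉ R.edges → (u a, v b) ∈ G.E0)

/-- `K₂[A,B]`: the crossing (unordered) pairs. -/
def pairsAB (A B : Finset ℕ) : Finset (Finset ℕ) :=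
  (A ×ˢ B).image fun p => ({p.1, p.2} : Finset ℕ)

/-- A bipartite `U`-colored graph `Γ = (A ∪ B, (P_u)_{u ∈ U})`. -/
structure BipColored (U : Finset ℕ) where
  A : Finset ℕ
  B : Finset ℕ
  disjAB : Disjoint A B
  P : ℕ → Finset (Finset ℕ)
  P_disj : ∀ u ∈ U, ∀ u' ∈ U, u ≠ u' → Disjoint (P u) (P u')
  P_cover : U.biUnion P = pairsAB A B

/-- The bipartite graph `(A ∪ B, P_u)` of a color, as a bigraph (ordered pairs `P̄_u`). -/
def BipColored.colorBG {U : Finset ℕ} (Γ : BipColored U) (u : ℕ) : Bigraph where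
  left := Γ.A
  right := Γ.B
  edges := (Γ.A ×ˢ Γ.B).filter fun p => ({p.1, p.2} : Finset ℕ) ∈ Γ.P u
  edges_sub := Finset.filter_subset _ _

/-- `H` is an `(n,Γ)`-blowup of `G` with the explicit family `Cfam` of new vertex classes. -/
def IsBlowupWith (G : Bigraph) (n : ℕ) (Γ : BipColored G.left) (Cfam : ℕ → Finset ℕ)
    (H : ThreeGraph) : Prop :=
  (∀ v ∈ G.right, (Cfam v).card = n) ∧
  (∀ v ∈ G.right, ∀ v' ∈ G.right, v ≠ v' → Disjoint (Cfam v) (Cfam v')) ∧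
  (∀ v ∈ G.right, Disjoint (Cfam v) (Γ.A ∪ Γ.B)) ∧
  H.verts = Γ.A ∪ Γ.B ∪ G.right.biUnion Cfam ∧
  ∀ u ∈ G.left, ∀ v ∈ G.right, ∀ e ∈ Γ.P u, ∀ z ∈ Cfam v,
    (((u, v) ∈ G.edges → insert z e ∈ H.edges) ∧ ((u, v) ∉ G.edges → insert z e ∉ H.edges))

def IsBlowup (G : Bigraph) (n : ℕ) (Γ : BipColored G.left) (H : ThreeGraph) : Prop :=
  ∃ Cfam : ℕ → Finset ℕ, IsBlowupWith G n Γ Cfam H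

def ThreeGraph.ContainsInduced (H H' : ThreeGraph) : Prop :=
  ∃ W : Finset ℕ, ThreeGraph.Iso (H.induce W) H'

/-- The `G`-dimension of `H` is at least `n`. -/
def GDimAtLeast (G : Bigraph) (H : ThreeGraph) (n : ℕ) : Prop :=
  ∀ Γ : BipColored G.left, Γ.A.card = n → Γ.B.card = n →
    ∃ H' : ThreeGraph, IsBlowup G n Γ H' ∧ H.ContainsInduced H'

/-- `G ∈ B_ℋ`: `G` is irreducible and `ℋ` has infinite `G`-dimension. -/
def InBH (ℋ : Set ThreeGraph) (G : Bigraph) : Prop :=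
  G.Irreducible ∧ ∀ m : ℕ, ∃ H ∈ ℋ, GDimAtLeast G H m

/-- An encoding of the bigraph `R` in `(H,P)`, where `Rtrip = Ē(H)`. -/
def Encoding {V : Finset ℕ} {t ℓ : ℕ} (R : Bigraph) (Rtrip : Finset (ℕ × ℕ × ℕ))
    (P : Decomp V (Fin t) (Fin ℓ)) (ε₂ : ℝ) : Prop :=
  ∃ j₀ k₀ : Fin t, j₀ ≠ k₀ ∧
    ∃ f : ℕ → Fin ℓ, ∃ g : ℕ → Fin t × Fin ℓ × Fin ℓ,
      (∀ u ∈ R.left, (P.pairBG j₀ k₀ (f u)).dev2 ε₂ (1 / (ℓ : ℝ))) ∧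
      (∀ v ∈ R.right,
        (P.pairBG (g v).1 j₀ (g v).2.1).dev2 ε₂ (1 / (ℓ : ℝ)) ∧
        (P.pairBG (g v).1 k₀ (g v).2.2).dev2 ε₂ (1 / (ℓ : ℝ))) ∧
      ∀ u ∈ R.left, ∀ v ∈ R.right,
        (((u, v) ∈ R.edges →
          ((P.triadOf (g v).1 j₀ k₀ (g v).2.1 (g v).2.2 (f u)).K3.card : ℝ) / 2 ≤
            ((Rtrip ∩ (P.triadOf (g v).1 j₀ k₀ (g v).2.1 (g v).2.2 (f u)).K3).card : ℝ)) ∧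
         ((u, v) ∉ R.edges →
          ((Rtrip ∩ (P.triadOf (g v).1 j₀ k₀ (g v).2.1 (g v).2.2 (f u)).K3).card : ℝ) <
            ((P.triadOf (g v).1 j₀ k₀ (g v).2.1 (g v).2.2 (f u)).K3.card : ℝ) / 2))

def encodeSet (S : Finset ℕ) : ℕ := ∑ i ∈ S, 2 ^ i

/-- The bigraph `U_bg(k)` realized on `ℕ`, with subsets of `[k]` encoded in binary. -/
def Ubg (k : ℕ) : Bigraph where
  left := ((Finset.range k).powerset).image encodeSet
  right := Finset.range k
  edges := ((Finset.range k).powerset).biUnion fun S => S.image fun i => (encodeSet S, i)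
  edges_sub := by
    intro p hp
    simp only [Finset.mem_biUnion, Finset.mem_image, Finset.mem_powerset] at hp
    obtain ⟨S, hS, i, hi, rfl⟩ := hp
    refine Finset.mem_product.mpr ⟨?_, ?_⟩
    · exact Finset.mem_image.mpr ⟨S, Finset.mem_powerset.mpr hS, rfl⟩
    · exact hS hi

/-! ### Averages over the cells of a partition -/

/-- The average of `F` over the cell of `w` in the partition of `Ω` into fibres of `Φ`. -/
noncomputable def cellAvg {β κ : Type*} (Ω : Finset β) (Φ : β → κ) (F : β → ℝ) (w : β) : ℝ :=
  (∑ v ∈ Ω with Φ v = Φ w, F v) / (#{v ∈ Ω | Φ v = Φ w} : ℝ)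

/-- On `Ω`, the fibre partition of `Φ'` refines that of `Φ`. -/
def Refines {β κ κ' : Type*} (Ω : Finset β) (Φ' : β → κ') (Φ : β → κ) : Prop :=
  ∀ v ∈ Ω, ∀ w ∈ Ω, Φ' v = Φ' w → Φ v = Φ w

section CellAvg

variable {β κ κ' : Type*} {Ω : Finset β} {Φ : β → κ} {Φ' : β → κ'} {F : β → ℝ}

lemma Refines.refl : Refines Ω Φ Φ := fun _ _ _ _ h => h

lemma Refines.trans {κ'' : Type*} {Φ'' : β → κ''} (h : Refines Ω Φ'' Φ') (h' : Refines Ω Φ' Φ) :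
    Refines Ω Φ'' Φ := fun v hv w hw e => h' v hv w hw (h v hv w hw e)

lemma cellAvg_congr {v w : β} (h : Φ v = Φ w) : cellAvg Ω Φ F v = cellAvg Ω Φ F w := by
  simp only [cellAvg, h]

lemma cellAvg_nonneg (hF : ∀ w, 0 ≤ F w) (w : β) : 0 ≤ cellAvg Ω Φ F w :=
  div_nonneg (sum_nonneg fun v _ => hF v) (Nat.cast_nonneg _)

lemma cellAvg_le_one (hF : ∀ w, F w ≤ 1) (w : β) : cellAvg Ω Φ F w ≤ 1 := by
  refine div_le_one_of_le₀ ?_ (Nat.cast_nonneg _)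
  calc _ ≤ ∑ v ∈ Ω with Φ v = Φ w, (1 : ℝ) := sum_le_sum fun v _ => hF v
    _ = _ := by simp

/-- Averaging over cells does not change correlations with functions that are constant on cells. -/
lemma sum_cellAvg_mul {u : β → ℝ} (hu : Refines Ω Φ u) :
    ∑ w ∈ Ω, cellAvg Ω Φ F w * u w = ∑ w ∈ Ω, F w * u w := by
  have h1 : ∀ w ∈ Ω, cellAvg Ω Φ F w * u w =
      ∑ v ∈ Ω, if Φ v = Φ w then F v * u v / (#{x ∈ Ω | Φ x = Φ v} : ℝ) else 0 := by
    intro w hw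
    rw [cellAvg, ← sum_filter, sum_div, sum_mul]
    refine sum_congr rfl fun v hv => ?_
    rw [mem_filter] at hv
    rw [hv.2, hu v hv.1 w hw hv.2]
    ring
  rw [sum_congr rfl h1, sum_comm]
  refine sum_congr rfl fun v hv => ?_
  rw [← sum_filter, sum_const, nsmul_eq_mul]
  have h2 : (#{x ∈ Ω | Φ x = Φ v} : ℝ) ≠ 0 :=
    Nat.cast_ne_zero.2 (card_ne_zero_of_mem (mem_filter.2 ⟨hv, rfl⟩))
  have h3 : #{x ∈ Ω | Φ v = Φ x} = #{x ∈ Ω | Φ x = Φ v} := by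
    congr 1; ext x; simp [eq_comm]
  rw [h3]
  field_simp

/-- The energy of a partition: the squared `L²` norm of the cell averages. -/
noncomputable def energy (Ω : Finset β) (Φ : β → κ) (F : β → ℝ) : ℝ :=
  ∑ w ∈ Ω, cellAvg Ω Φ F w ^ 2

lemma energy_nonneg : 0 ≤ energy Ω Φ F := sum_nonneg fun _ _ => sq_nonneg _

lemma energy_le (h0 : ∀ w, 0 ≤ F w) (h1 : ∀ w, F w ≤ 1) : energy Ω Φ F ≤ #Ω := by
  calc _ ≤ ∑ w ∈ Ω, (1 : ℝ) :=
        sum_le_sum fun w _ => pow_le_one₀ (cellAvg_nonneg h0 w) (cellAvg_le_one h1 w)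
    _ = _ := by simp

lemma sum_sq_cellAvg_sub (h : Refines Ω Φ' Φ) :
    ∑ w ∈ Ω, (cellAvg Ω Φ' F w - cellAvg Ω Φ F w) ^ 2 = energy Ω Φ' F - energy Ω Φ F := by
  have h1 : ∑ w ∈ Ω, cellAvg Ω Φ' F w * cellAvg Ω Φ F w = ∑ w ∈ Ω, F w * cellAvg Ω Φ F w :=
    sum_cellAvg_mul fun v hv w hw e => cellAvg_congr (h v hv w hw e)
  have h2 : ∑ w ∈ Ω, cellAvg Ω Φ F w * cellAvg Ω Φ F w = ∑ w ∈ Ω, F w * cellAvg Ω Φ F w :=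
    sum_cellAvg_mul fun v _ w _ e => cellAvg_congr e
  have h3 : ∑ w ∈ Ω, (cellAvg Ω Φ' F w - cellAvg Ω Φ F w) ^ 2 = energy Ω Φ' F + energy Ω Φ F
      - 2 * ∑ w ∈ Ω, cellAvg Ω Φ' F w * cellAvg Ω Φ F w := by
    rw [energy, energy, mul_sum, ← sum_add_distrib, ← sum_sub_distrib]
    exact sum_congr rfl fun w _ => by ring
  have h4 : energy Ω Φ F = ∑ w ∈ Ω, cellAvg Ω Φ F w * cellAvg Ω Φ F w :=
    sum_congr rfl fun w _ => by ring
  linarith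

/-- A test function constant on the cells of a refinement forces an energy increment. -/
lemma energy_increment (h : Refines Ω Φ' Φ) {u : β → ℝ} (hu1 : ∀ w ∈ Ω, |u w| ≤ 1)
    (hu : Refines Ω Φ' u) {δ : ℝ} (hδ : 0 ≤ δ)
    (hcor : δ * #Ω < ∑ w ∈ Ω, (F w - cellAvg Ω Φ F w) * u w) :
    energy Ω Φ F + δ ^ 2 * #Ω ≤ energy Ω Φ' F := by
  have h1 : ∑ w ∈ Ω, (F w - cellAvg Ω Φ F w) * u w
      = ∑ w ∈ Ω, (cellAvg Ω Φ' F w - cellAvg Ω Φ F w) * u w := by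
    simp only [sub_mul, sum_sub_distrib, sum_cellAvg_mul hu]
  rw [h1] at hcor
  have h2 := sum_mul_sq_le_sq_mul_sq Ω (fun w => cellAvg Ω Φ' F w - cellAvg Ω Φ F w) u
  have h3 : ∑ w ∈ Ω, u w ^ 2 ≤ #Ω := by
    calc _ ≤ ∑ w ∈ Ω, (1 : ℝ) := sum_le_sum fun w hw => by
            rw [← sq_abs]; exact pow_le_one₀ (abs_nonneg _) (hu1 w hw)
      _ = _ := by simp
  rw [sum_sq_cellAvg_sub h] at h2
  have h5 : 0 ≤ energy Ω Φ' F - energy Ω Φ F := by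
    rw [← sum_sq_cellAvg_sub h]; exact sum_nonneg fun _ _ => sq_nonneg _
  have h4 : (δ * #Ω) ^ 2 ≤ (energy Ω Φ' F - energy Ω Φ F) * #Ω :=
    (pow_le_pow_left₀ (by positivity) hcor.le 2).trans
      (h2.trans (mul_le_mul_of_nonneg_left h3 h5))
  rcases Nat.eq_zero_or_pos #Ω with h0 | h0
  · rw [h0]; simp only [CharP.cast_eq_zero, mul_zero, add_zero]; linarith
  · have h6 : (0 : ℝ) < #Ω := by exact_mod_cast h0
    have : δ ^ 2 * #Ω ≤ energy Ω Φ' F - energy Ω Φ F := by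
      refine le_of_mul_le_mul_right ?_ h6
      calc _ = (δ * #Ω) ^ 2 := by ring
        _ ≤ _ := h4
    linarith

/-- Energy increment iteration: if every partition of complexity `m` that is not `δ`-good can be
refined, within complexity `grow m`, to one detecting a correlation, then it has a good
refinement of bounded complexity. -/
theorem exists_good_refinement {C : Type*} (Φ : C → β → κ) (size : C → ℕ → Prop)
    (grow : ℕ → ℕ) (good : C → Prop) (hmono : ∀ c m m', m ≤ m' → size c m → size c m')
    (hgrow : ∀ m, m ≤ grow m) (h0 : ∀ w, 0 ≤ F w) (h1 : ∀ w, F w ≤ 1) {δ : ℝ} (hδ : 0 < δ)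
    (hstep : ∀ c m, size c m → ¬ good c → ∃ c', size c' (grow m) ∧ Refines Ω (Φ c') (Φ c) ∧
      ∃ u : β → ℝ, (∀ w ∈ Ω, |u w| ≤ 1) ∧ Refines Ω (Φ c') u ∧
        δ * #Ω < ∑ w ∈ Ω, (F w - cellAvg Ω (Φ c) F w) * u w)
    (c : C) (m : ℕ) (hc : size c m) :
    ∃ c', size c' (grow^[⌊(δ ^ 2)⁻¹⌋₊ + 1] m) ∧ Refines Ω (Φ c') (Φ c) ∧ good c' := by
  have hgi : ∀ k, grow^[k] m ≤ grow^[k + 1] m := fun k => by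
    rw [Function.iterate_succ_apply']; exact hgrow _
  have key : ∀ k : ℕ, (∃ c', size c' (grow^[k] m) ∧ Refines Ω (Φ c') (Φ c) ∧ good c') ∨
      ∃ c', size c' (grow^[k] m) ∧ Refines Ω (Φ c') (Φ c) ∧
        k * (δ ^ 2 * #Ω) ≤ energy Ω (Φ c') F ∧ (k ≠ 0 → Ω.Nonempty) := by
    intro k
    induction k with
    | zero => exact Or.inr ⟨c, hc, Refines.refl, by simpa using energy_nonneg, by simp⟩
    | succ k ih =>
      rcases ih with ⟨c', hs, hr, hg⟩ | ⟨c', hs, hr, he, -⟩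
      · exact Or.inl ⟨c', hmono _ _ _ (hgi k) hs, hr, hg⟩
      · by_cases hg : good c'
        · exact Or.inl ⟨c', hmono _ _ _ (hgi k) hs, hr, hg⟩
        · obtain ⟨c'', hs', hr', u, hu1, hu, hcor⟩ := hstep c' _ hs hg
          refine Or.inr ⟨c'', ?_, hr'.trans hr, ?_, fun _ => ?_⟩
          · rw [Function.iterate_succ_apply']; exact hs'
          · have := energy_increment hr' hu1 hu hδ.le hcor
            push_cast
            linarith
          · by_contra hne
            rw [not_nonempty_iff_eq_empty] at hne
            simp [hne] at hcor
  rcases key (⌊(δ ^ 2)⁻¹⌋₊ + 1) with h | ⟨c', -, -, he, hne⟩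
  · exact h
  · exfalso
    have hpos : (0 : ℝ) < #Ω := by exact_mod_cast (hne (by simp)).card_pos
    have h2 := he.trans (energy_le h0 h1)
    have h3 := Nat.lt_floor_add_one ((δ ^ 2)⁻¹)
    have h4 : (1 : ℝ) < ((⌊(δ ^ 2)⁻¹⌋₊ + 1 : ℕ) : ℝ) * δ ^ 2 := by
      push_cast
      calc (1 : ℝ) = (δ ^ 2)⁻¹ * δ ^ 2 := by field_simp
        _ < _ := mul_lt_mul_of_pos_right h3 (by positivity)
    nlinarith

/-- The complexities appearing in the strong form of the energy increment iteration. -/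
noncomputable def chainSize (grow : ℕ → ℕ) (δ : ℕ → ℝ) (m₀ : ℕ) : ℕ → ℕ
  | 0 => m₀
  | s + 1 => grow^[⌊(δ (chainSize grow δ m₀ s) ^ 2)⁻¹⌋₊ + 1] (chainSize grow δ m₀ s)

/-- Strong form of the iteration: a partition of bounded complexity together with a refinement that
is good with respect to an arbitrary function of this complexity and has almost the same energy. -/
theorem exists_good_refinement_pair {C : Type*} (Φ : C → β → κ) (size : C → ℕ → Prop)
    (grow : ℕ → ℕ) (good : C → ℝ → Prop) (hmono : ∀ c m m', m ≤ m' → size c m → size c m')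
    (hgrow : ∀ m, m ≤ grow m) (h0 : ∀ w, 0 ≤ F w) (h1 : ∀ w, F w ≤ 1)
    (hstep : ∀ c m δ, 0 < δ → size c m → ¬ good c δ →
      ∃ c', size c' (grow m) ∧ Refines Ω (Φ c') (Φ c) ∧
      ∃ u : β → ℝ, (∀ w ∈ Ω, |u w| ≤ 1) ∧ Refines Ω (Φ c') u ∧
        δ * #Ω < ∑ w ∈ Ω, (F w - cellAvg Ω (Φ c) F w) * u w)
    {η : ℝ} (hη : 0 < η) {δ : ℕ → ℝ} (hδ : ∀ m, 0 < δ m)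
    (c₀ : C) (m₀ : ℕ) (hc₀ : size c₀ m₀) :
    ∃ s ≤ ⌊η⁻¹⌋₊, ∃ c c', size c (chainSize grow δ m₀ s) ∧
      Refines Ω (Φ c') (Φ c) ∧ good c' (δ (chainSize grow δ m₀ s)) ∧
      ∑ w ∈ Ω, (cellAvg Ω (Φ c') F w - cellAvg Ω (Φ c) F w) ^ 2 ≤ η * #Ω := by
  by_contra! hcon
  have key : ∀ s ≤ ⌊η⁻¹⌋₊ + 1, ∃ c, size c (chainSize grow δ m₀ s) ∧
      s * (η * #Ω) ≤ energy Ω (Φ c) F ∧ (s ≠ 0 → s * (η * #Ω) < energy Ω (Φ c) F) := by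
    intro s
    induction s with
    | zero => exact fun _ => ⟨c₀, hc₀, by simpa using energy_nonneg, by simp⟩
    | succ s ih =>
      intro hs
      obtain ⟨c, hc, he, -⟩ := ih (by omega)
      obtain ⟨c', hc', hr, hg⟩ := exists_good_refinement Φ size grow
        (fun c' => good c' (δ (chainSize grow δ m₀ s))) hmono hgrow h0 h1 (hδ _)
        (fun c m => hstep c m _ (hδ _)) c _ hc
      have h2 := hcon s (by omega) c c' hc hr hg
      rw [sum_sq_cellAvg_sub hr] at h2
      refine ⟨c', hc', ?_, fun _ => ?_⟩ <;> push_cast <;> linarith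
  obtain ⟨c, -, -, he⟩ := key _ le_rfl
  have h2 := (he (by simp)).trans_le (energy_le h0 h1)
  have h3 := Nat.lt_floor_add_one (η⁻¹)
  have h4 : (1 : ℝ) < ((⌊η⁻¹⌋₊ + 1 : ℕ) : ℝ) * η := by
    push_cast
    calc (1 : ℝ) = η⁻¹ * η := by field_simp
      _ < _ := mul_lt_mul_of_pos_right h3 hη
  have h5 : (0 : ℝ) ≤ #Ω := Nat.cast_nonneg _
  nlinarith

end CellAvg

/-! ### Cut norms -/

/-- The cut norm of `g` on `X × Y` (not normalised) is at most `B`. -/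
def CutBound (X Y : Finset ℕ) (g : ℕ → ℕ → ℝ) (B : ℝ) : Prop :=
  ∀ a b : ℕ → ℝ, (∀ x, |a x| ≤ 1) → (∀ y, |b y| ≤ 1) →
    |∑ x ∈ X, ∑ y ∈ Y, g x y * a x * b y| ≤ B

/-- The trilinear cut norm of `g` on `X × Y × Z`, tested against functions of pairs, is at most
`B`. -/
def BoxBound (X Y Z : Finset ℕ) (g : ℕ → ℕ → ℕ → ℝ) (B : ℝ) : Prop :=
  ∀ a b c : ℕ → ℕ → ℝ, (∀ x y, |a x y| ≤ 1) → (∀ x z, |b x z| ≤ 1) → (∀ y z, |c y z| ≤ 1) →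
    |∑ x ∈ X, ∑ y ∈ Y, ∑ z ∈ Z, g x y z * a x y * b x z * c y z| ≤ B

lemma mul_le_sign_mul {a w : ℝ} (ha : |a| ≤ 1) : a * w ≤ (if 0 ≤ w then 1 else -1) * w := by
  have h : a * w ≤ |w| := by
    calc a * w ≤ |a * w| := le_abs_self _
      _ = |a| * |w| := abs_mul _ _
      _ ≤ 1 * |w| := mul_le_mul_of_nonneg_right ha (abs_nonneg _)
      _ = |w| := one_mul _
  split_ifs with h0
  · rwa [abs_of_nonneg h0, ← one_mul w, ← mul_assoc, mul_one] at h
  · rwa [abs_of_neg (not_le.1 h0), neg_eq_neg_one_mul] at h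

lemma ite_sign (p : Prop) [Decidable p] :
    (if p then (1 : ℝ) else -1) = 1 ∨ (if p then (1 : ℝ) else -1) = -1 := by
  split_ifs <;> simp

lemma abs_sign_le {a : ℝ} (h : a = 1 ∨ a = -1) : |a| ≤ 1 := by
  rcases h with h | h <;> simp [h]

section CutBound

variable {X Y Z X' Y' Z' : Finset ℕ} {g g' : ℕ → ℕ → ℝ} {B B' : ℝ}

lemma CutBound.mono (h : CutBound X Y g B) (hB : B ≤ B') : CutBound X Y g B' :=
  fun a b ha hb => (h a b ha hb).trans hB

lemma CutBound.congr (h : CutBound X Y g B) (hg : ∀ x ∈ X, ∀ y ∈ Y, g x y = g' x y) :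
    CutBound X Y g' B := by
  intro a b ha hb
  convert h a b ha hb using 2
  exact sum_congr rfl fun x hx => sum_congr rfl fun y hy => by rw [hg x hx y hy]

lemma CutBound.add (h : CutBound X Y g B) (h' : CutBound X Y g' B') :
    CutBound X Y (fun x y => g x y + g' x y) (B + B') := by
  intro a b ha hb
  simp only [add_mul, sum_add_distrib]
  exact (abs_add_le _ _).trans (add_le_add (h a b ha hb) (h' a b ha hb))

lemma CutBound.const_mul (h : CutBound X Y g B) (r : ℝ) :
    CutBound X Y (fun x y => r * g x y) (|r| * B) := by
  intro a b ha hb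
  simp only [mul_assoc, ← mul_sum, abs_mul r]
  refine mul_le_mul_of_nonneg_left ?_ (abs_nonneg r)
  simpa only [mul_assoc] using h a b ha hb

lemma CutBound.sum {ι : Type*} {s : Finset ι} {G : ι → ℕ → ℕ → ℝ}
    (h : ∀ i ∈ s, CutBound X Y (G i) B) :
    CutBound X Y (fun x y => ∑ i ∈ s, G i x y) (#s * B) := by
  induction s using Finset.induction_on with
  | empty => intro a b _ _; simp
  | insert i s hi ih =>
    have h1 := (h i (mem_insert_self _ _)).add (ih fun j hj => h j (mem_insert_of_mem hj))
    rw [card_insert_of_notMem hi]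
    push_cast
    refine (h1.mono (le_of_eq (by ring))).congr fun x _ y _ => ?_
    rw [sum_insert hi]

lemma abs_ite_mul_le {p : Prop} [Decidable p] {r : ℝ} (hr : |r| ≤ 1) :
    |if p then r else 0| ≤ 1 := by
  split_ifs
  · exact hr
  · simp

lemma CutBound.subset (h : CutBound X Y g B) (hX : X' ⊆ X) (hY : Y' ⊆ Y) :
    CutBound X' Y' g B := by
  intro a b ha hb
  convert h (fun x => if x ∈ X' then a x else 0) (fun y => if y ∈ Y' then b y else 0)
    (fun x => abs_ite_mul_le (ha x)) (fun y => abs_ite_mul_le (hb y)) using 2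
  rw [← sum_subset hX]
  · refine sum_congr rfl fun x hx => ?_
    rw [← sum_subset hY]
    · exact sum_congr rfl fun y hy => by simp [hx, hy]
    · intro y _ hy; simp [hy]
  · intro x _ hx; simp [hx]

lemma cutBound_of_sum_abs_le (h : ∑ x ∈ X, ∑ y ∈ Y, |g x y| ≤ B) : CutBound X Y g B := by
  intro a b ha hb
  refine (abs_sum_le_sum_abs _ _).trans ((sum_le_sum fun x _ => ?_).trans h)
  refine (abs_sum_le_sum_abs _ _).trans (sum_le_sum fun y _ => ?_)
  rw [abs_mul, abs_mul, mul_assoc]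
  exact mul_le_of_le_one_right (abs_nonneg _) (mul_le_one₀ (ha x) (abs_nonneg _) (hb y))

lemma cutBound_const (r : ℝ) : CutBound X Y (fun _ _ => r) (|r| * (#X * #Y)) :=
  cutBound_of_sum_abs_le (by simp only [sum_const, nsmul_eq_mul]; exact le_of_eq (by ring))

lemma CutBound.abs_sum_le (h : CutBound X Y g B) : |∑ x ∈ X, ∑ y ∈ Y, g x y| ≤ B := by
  simpa using h (fun _ => 1) (fun _ => 1) (by simp) (by simp)

lemma cutBound_of_signs
    (h : ∀ a b : ℕ → ℝ, (∀ x, a x = 1 ∨ a x = -1) → (∀ y, b y = 1 ∨ b y = -1) →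
      ∑ x ∈ X, ∑ y ∈ Y, g x y * a x * b y ≤ B) : CutBound X Y g B := by
  have key : ∀ a b : ℕ → ℝ, (∀ x, |a x| ≤ 1) → (∀ y, |b y| ≤ 1) →
      ∑ x ∈ X, ∑ y ∈ Y, g x y * a x * b y ≤ B := by
    intro a b ha hb
    set a' : ℕ → ℝ := fun x => if 0 ≤ ∑ y ∈ Y, g x y * b y then 1 else -1 with ha'
    set b' : ℕ → ℝ := fun y => if 0 ≤ ∑ x ∈ X, g x y * a' x then 1 else -1 with hb'
    calc ∑ x ∈ X, ∑ y ∈ Y, g x y * a x * b y = ∑ x ∈ X, a x * ∑ y ∈ Y, g x y * b y := by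
          simp only [mul_sum]
          exact sum_congr rfl fun x _ => sum_congr rfl fun y _ => by ring
      _ ≤ ∑ x ∈ X, a' x * ∑ y ∈ Y, g x y * b y := sum_le_sum fun x _ => mul_le_sign_mul (ha x)
      _ = ∑ y ∈ Y, b y * ∑ x ∈ X, g x y * a' x := by
          simp only [mul_sum]
          rw [sum_comm]
          exact sum_congr rfl fun x _ => sum_congr rfl fun y _ => by ring
      _ ≤ ∑ y ∈ Y, b' y * ∑ x ∈ X, g x y * a' x := sum_le_sum fun x _ => mul_le_sign_mul (hb x)
      _ = ∑ x ∈ X, ∑ y ∈ Y, g x y * a' x * b' y := by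
          simp only [mul_sum]
          rw [sum_comm]
          exact sum_congr rfl fun x _ => sum_congr rfl fun y _ => by ring
      _ ≤ B := h a' b' (fun x => ite_sign _) (fun x => ite_sign _)
  intro a b ha hb
  refine abs_le'.2 ⟨key a b ha hb, ?_⟩
  refine le_trans (le_of_eq ?_) (key (fun x => - a x) b (by simpa using ha) hb)
  simp

end CutBound

section BoxBound

variable {X Y Z X' Y' Z' : Finset ℕ} {g : ℕ → ℕ → ℕ → ℝ} {B B' : ℝ}

lemma BoxBound.subset (h : BoxBound X Y Z g B) (hX : X' ⊆ X) (hY : Y' ⊆ Y) (hZ : Z' ⊆ Z) :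
    BoxBound X' Y' Z' g B := by
  intro a b c ha hb hc
  convert h (fun x y => if x ∈ X' ∧ y ∈ Y' then a x y else 0)
    (fun x z => if z ∈ Z' then b x z else 0) c
    (fun x y => abs_ite_mul_le (ha x y)) (fun x z => abs_ite_mul_le (hb x z)) hc using 2
  rw [← sum_subset hX]
  · refine sum_congr rfl fun x hx => ?_
    rw [← sum_subset hY]
    · refine sum_congr rfl fun y hy => ?_
      rw [← sum_subset hZ]
      · exact sum_congr rfl fun z hz => by simp [hx, hy, hz]
      · intro z _ hz; simp [hz]
    · intro y _ hy; simp [hy]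
  · intro x _ hx; simp [hx]

lemma boxBound_of_signs
    (h : ∀ a b c : ℕ → ℕ → ℝ, (∀ x y, a x y = 1 ∨ a x y = -1) → (∀ x z, b x z = 1 ∨ b x z = -1) →
      (∀ y z, c y z = 1 ∨ c y z = -1) →
      ∑ x ∈ X, ∑ y ∈ Y, ∑ z ∈ Z, g x y z * a x y * b x z * c y z ≤ B) :
    BoxBound X Y Z g B := by
  have key : ∀ a b c : ℕ → ℕ → ℝ, (∀ x y, |a x y| ≤ 1) → (∀ x z, |b x z| ≤ 1) →
      (∀ y z, |c y z| ≤ 1) →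
      ∑ x ∈ X, ∑ y ∈ Y, ∑ z ∈ Z, g x y z * a x y * b x z * c y z ≤ B := by
    intro a b c ha hb hc
    have e1 : ∀ a b c : ℕ → ℕ → ℝ,
        ∑ x ∈ X, ∑ y ∈ Y, ∑ z ∈ Z, g x y z * a x y * b x z * c y z =
        ∑ x ∈ X, ∑ y ∈ Y, a x y * ∑ z ∈ Z, g x y z * b x z * c y z := by
      intro a b c
      simp only [mul_sum]
      exact sum_congr rfl fun x _ => sum_congr rfl fun y _ => sum_congr rfl fun z _ => by ring
    have e2 : ∀ a b c : ℕ → ℕ → ℝ,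
        ∑ x ∈ X, ∑ y ∈ Y, ∑ z ∈ Z, g x y z * a x y * b x z * c y z =
        ∑ x ∈ X, ∑ z ∈ Z, b x z * ∑ y ∈ Y, g x y z * a x y * c y z := by
      intro a b c
      simp only [mul_sum]
      refine sum_congr rfl fun x _ => ?_
      rw [sum_comm]
      exact sum_congr rfl fun y _ => sum_congr rfl fun z _ => by ring
    have e3 : ∀ a b c : ℕ → ℕ → ℝ,
        ∑ x ∈ X, ∑ y ∈ Y, ∑ z ∈ Z, g x y z * a x y * b x z * c y z =
        ∑ y ∈ Y, ∑ z ∈ Z, c y z * ∑ x ∈ X, g x y z * a x y * b x z := by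
      intro a b c
      simp only [mul_sum]
      rw [sum_comm]
      refine sum_congr rfl fun y _ => ?_
      rw [sum_comm]
      exact sum_congr rfl fun y _ => sum_congr rfl fun z _ => by ring
    set a' : ℕ → ℕ → ℝ :=
      fun x y => if 0 ≤ ∑ z ∈ Z, g x y z * b x z * c y z then 1 else -1 with ha'
    set b' : ℕ → ℕ → ℝ :=
      fun x z => if 0 ≤ ∑ y ∈ Y, g x y z * a' x y * c y z then 1 else -1 with hb'
    set c' : ℕ → ℕ → ℝ :=
      fun y z => if 0 ≤ ∑ x ∈ X, g x y z * a' x y * b' x z then 1 else -1 with hc'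
    calc _ ≤ ∑ x ∈ X, ∑ y ∈ Y, ∑ z ∈ Z, g x y z * a' x y * b x z * c y z := by
          rw [e1, e1]
          exact sum_le_sum fun x _ => sum_le_sum fun y _ => mul_le_sign_mul (ha x y)
      _ ≤ ∑ x ∈ X, ∑ y ∈ Y, ∑ z ∈ Z, g x y z * a' x y * b' x z * c y z := by
          rw [e2, e2]
          exact sum_le_sum fun x _ => sum_le_sum fun y _ => mul_le_sign_mul (hb x y)
      _ ≤ ∑ x ∈ X, ∑ y ∈ Y, ∑ z ∈ Z, g x y z * a' x y * b' x z * c' y z := by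
          rw [e3, e3]
          exact sum_le_sum fun x _ => sum_le_sum fun y _ => mul_le_sign_mul (hc x y)
      _ ≤ B := h a' b' c' (fun _ _ => ite_sign _) (fun _ _ => ite_sign _) (fun _ _ => ite_sign _)
  intro a b c ha hb hc
  refine abs_le'.2 ⟨key a b c ha hb hc, ?_⟩
  refine le_trans (le_of_eq ?_) (key (fun x y => - a x y) b c (by simpa using ha) hb hc)
  simp

end BoxBound

/-! ### Weak regularity for ternary relations and for edge colourings -/

/-- The colours seen by a triple under a colouring of pairs. -/
def tripleColor (f : ℕ → ℕ → ℕ) (p : ℕ × ℕ × ℕ) : ℕ × ℕ × ℕ :=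
  (f p.1 p.2.1, f p.1 p.2.2, f p.2.1 p.2.2)

/-- The indicator function of a set of triples. -/
noncomputable def tripleInd (R : Finset (ℕ × ℕ × ℕ)) (p : ℕ × ℕ × ℕ) : ℝ := if p ∈ R then 1 else 0

/-- The colours seen by a pair, together with a marker, under a colouring of vertices. -/
def pairColor (c : ℕ → ℕ) (p : ℕ × ℕ × ℕ) : ℕ × ℕ × ℕ := (c p.1, c p.2.1, p.2.2)

/-- The indicator functions of the classes of an edge colouring, as a single function. -/
noncomputable def classInd (f : ℕ → ℕ → ℕ) (p : ℕ × ℕ × ℕ) : ℝ :=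
  if f p.1 p.2.1 = p.2.2 then 1 else 0

lemma eq_of_bits {p q : Prop} [Decidable p] [Decidable q] {a b : ℕ}
    (h : 2 * a + (if p then 1 else 0) = 2 * b + (if q then 1 else 0)) : a = b ∧ (p ↔ q) := by
  by_cases hp : p <;> by_cases hq : q <;> simp only [hp, hq, if_true, if_false, true_iff] at h ⊢ <;>
    first | omega | (refine ⟨?_, trivial⟩; omega)

lemma sign_eq_of_iff {a b : ℝ} (ha : a = 1 ∨ a = -1) (hb : b = 1 ∨ b = -1)
    (h : a = 1 ↔ b = 1) : a = b := by
  rcases ha with ha | ha <;> rcases hb with hb | hb <;> simp_all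

theorem exists_tripleColor_pair (η : ℝ) (hη : 0 < η) (δ : ℕ → ℝ) (hδ : ∀ m, 0 < δ m)
    (V : Finset ℕ) (R : Finset (ℕ × ℕ × ℕ)) :
    ∃ s ≤ ⌊η⁻¹⌋₊, ∃ f f' : ℕ → ℕ → ℕ, (∀ x y, f x y < chainSize (8 * ·) δ 1 s) ∧
      BoxBound V V V (fun x y z => tripleInd R (x, y, z) -
        cellAvg (V ×ˢ V ×ˢ V) (tripleColor f') (tripleInd R) (x, y, z))
        (δ (chainSize (8 * ·) δ 1 s) * (#V : ℝ) ^ 3) ∧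
      ∑ w ∈ V ×ˢ V ×ˢ V, (cellAvg (V ×ˢ V ×ˢ V) (tripleColor f') (tripleInd R) w -
        cellAvg (V ×ˢ V ×ˢ V) (tripleColor f) (tripleInd R) w) ^ 2 ≤ η * (#V : ℝ) ^ 3 := by
  have hcard : (#(V ×ˢ V ×ˢ V) : ℝ) = (#V : ℝ) ^ 3 := by
    rw [card_product, card_product]; push_cast; ring
  have := exists_good_refinement_pair (Ω := V ×ˢ V ×ˢ V) (F := tripleInd R) tripleColor
    (fun f m => ∀ x y, f x y < m) (8 * ·)
    (fun f δ => BoxBound V V V (fun x y z => tripleInd R (x, y, z) -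
        cellAvg (V ×ˢ V ×ˢ V) (tripleColor f) (tripleInd R) (x, y, z)) (δ * (#V : ℝ) ^ 3))
    (fun c m m' h hc x y => (hc x y).trans_le h) (fun m => by omega)
    (fun w => by unfold tripleInd; split_ifs <;> simp)
    (fun w => by unfold tripleInd; split_ifs <;> simp)
    (by
      intro f m δ hδ hf hbad
      have h1 := mt boxBound_of_signs hbad
      push Not at h1
      obtain ⟨a, b, c, ha, hb, hc, hlt⟩ := h1
      set f' : ℕ → ℕ → ℕ := fun x y => 2 * (2 * (2 * f x y + if a x y = 1 then 1 else 0) +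
        if b x y = 1 then 1 else 0) + if c x y = 1 then 1 else 0 with hf'
      have hdec : ∀ x y x' y', f' x y = f' x' y' →
          f x y = f x' y' ∧ a x y = a x' y' ∧ b x y = b x' y' ∧ c x y = c x' y' := by
        intro x y x' y' h
        obtain ⟨h, h3⟩ := eq_of_bits h
        obtain ⟨h, h2⟩ := eq_of_bits h
        obtain ⟨h, h1⟩ := eq_of_bits h
        exact ⟨h, sign_eq_of_iff (ha _ _) (ha _ _) h1, sign_eq_of_iff (hb _ _) (hb _ _) h2,
          sign_eq_of_iff (hc _ _) (hc _ _) h3⟩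
      refine ⟨f', ?_, ?_, fun p => a p.1 p.2.1 * b p.1 p.2.2 * c p.2.1 p.2.2, ?_, ?_, ?_⟩
      · intro x y
        have := hf x y
        simp only [hf']
        split_ifs <;> omega
      · intro v _ w _ h
        simp only [tripleColor, Prod.mk.injEq] at h ⊢
        exact ⟨(hdec _ _ _ _ h.1).1, (hdec _ _ _ _ h.2.1).1, (hdec _ _ _ _ h.2.2).1⟩
      · intro w _
        rw [abs_mul, abs_mul]
        exact mul_le_one₀ (mul_le_one₀ (abs_sign_le (ha _ _)) (abs_nonneg _)
          (abs_sign_le (hb _ _))) (abs_nonneg _) (abs_sign_le (hc _ _))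
      · intro v _ w _ h
        simp only [tripleColor, Prod.mk.injEq] at h ⊢
        rw [(hdec _ _ _ _ h.1).2.1, (hdec _ _ _ _ h.2.1).2.2.1, (hdec _ _ _ _ h.2.2).2.2.2]
      · rw [hcard]
        refine hlt.trans_eq ?_
        rw [sum_product]
        refine sum_congr rfl fun x _ => ?_
        rw [sum_product]
        exact sum_congr rfl fun y _ => sum_congr rfl fun z _ => by ring)
    hη hδ (fun _ _ => 0) 1 (by simp)
  rw [hcard] at this
  obtain ⟨s, hs, f, f', h1, -, h2, h3⟩ := this
  exact ⟨s, hs, f, f', h1, h2, h3⟩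

theorem exists_pairColor_pair (m : ℕ) (η : ℝ) (hη : 0 < η) (δ : ℕ → ℝ) (hδ : ∀ m, 0 < δ m)
    (V : Finset ℕ) (f : ℕ → ℕ → ℕ) :
    ∃ s ≤ ⌊η⁻¹⌋₊, ∃ c c' : ℕ → ℕ, (∀ x, c x < chainSize (4 * ·) δ 1 s) ∧
      (∀ α < m, CutBound V V (fun x y => classInd f (x, y, α) -
        cellAvg (V ×ˢ V ×ˢ range m) (pairColor c') (classInd f) (x, y, α))
        (δ (chainSize (4 * ·) δ 1 s) * ((#V : ℝ) ^ 2 * m))) ∧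
      ∑ w ∈ V ×ˢ V ×ˢ range m, (cellAvg (V ×ˢ V ×ˢ range m) (pairColor c') (classInd f) w -
        cellAvg (V ×ˢ V ×ˢ range m) (pairColor c) (classInd f) w) ^ 2
          ≤ η * ((#V : ℝ) ^ 2 * m) := by
  have hcard : (#(V ×ˢ V ×ˢ range m) : ℝ) = (#V : ℝ) ^ 2 * m := by
    rw [card_product, card_product, card_range]; push_cast; ring
  have := exists_good_refinement_pair (Ω := V ×ˢ V ×ˢ range m) (F := classInd f) pairColor
    (fun c k => ∀ x, c x < k) (4 * ·)
    (fun c δ => ∀ α < m, CutBound V V (fun x y => classInd f (x, y, α) -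
        cellAvg (V ×ˢ V ×ˢ range m) (pairColor c) (classInd f) (x, y, α))
          (δ * ((#V : ℝ) ^ 2 * m)))
    (fun c m m' h hc x => (hc x).trans_le h) (fun m => by omega)
    (fun w => by unfold classInd; split_ifs <;> simp)
    (fun w => by unfold classInd; split_ifs <;> simp)
    (by
      intro c k δ hδ hc hbad
      push Not at hbad
      obtain ⟨α, hα, hbad⟩ := hbad
      have h1 := mt cutBound_of_signs hbad
      push Not at h1
      obtain ⟨a, b, ha, hb, hlt⟩ := h1
      set c' : ℕ → ℕ := fun x => 2 * (2 * c x + if a x = 1 then 1 else 0) +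
        if b x = 1 then 1 else 0 with hc'
      have hdec : ∀ x x', c' x = c' x' → c x = c x' ∧ a x = a x' ∧ b x = b x' := by
        intro x x' h
        obtain ⟨h, h2⟩ := eq_of_bits h
        obtain ⟨h, h1⟩ := eq_of_bits h
        exact ⟨h, sign_eq_of_iff (ha _) (ha _) h1, sign_eq_of_iff (hb _) (hb _) h2⟩
      refine ⟨c', ?_, ?_, fun p => if p.2.2 = α then a p.1 * b p.2.1 else 0, ?_, ?_, ?_⟩
      · intro x
        have := hc x
        simp only [hc']
        split_ifs <;> omega
      · intro v _ w _ h
        simp only [pairColor, Prod.mk.injEq] at h ⊢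
        exact ⟨(hdec _ _ h.1).1, (hdec _ _ h.2.1).1, h.2.2⟩
      · intro w _
        refine abs_ite_mul_le ?_
        rw [abs_mul]
        exact mul_le_one₀ (abs_sign_le (ha _)) (abs_nonneg _) (abs_sign_le (hb _))
      · intro v _ w _ h
        simp only [pairColor, Prod.mk.injEq] at h ⊢
        rw [(hdec _ _ h.1).2.1, (hdec _ _ h.2.1).2.2, h.2.2]
      · rw [hcard]
        refine hlt.trans_eq ?_
        rw [sum_product]
        refine sum_congr rfl fun x _ => ?_
        rw [sum_product]
        refine sum_congr rfl fun y _ => ?_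
        simp only [mul_ite, mul_zero]
        rw [sum_ite_eq' (range m) α, if_pos (mem_range.2 hα), mul_assoc])
    hη hδ (fun _ => 0) 1 (by simp)
  rw [hcard] at this
  obtain ⟨s, hs, f, f', h1, -, h2, h3⟩ := this
  exact ⟨s, hs, f, f', h1, h2, h3⟩

/-! ### Random splittings of an edge colouring -/

lemma cutBound_of_box {X Y : Finset ℕ} {g : ℕ → ℕ → ℝ} {B : ℝ} (hB : 0 ≤ B)
    (h : (#X : ℝ) ^ 2 * #Y ^ 2 * ∑ y ∈ Y, ∑ y' ∈ Y, (∑ x ∈ X, g x y * g x y') ^ 2 ≤ B ^ 4) :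
    CutBound X Y g B := by
  refine cutBound_of_signs fun a b ha hb => ?_
  have ha2 : ∀ x, a x ^ 2 = 1 := fun x => by rcases ha x with h | h <;> simp [h]
  have hb2 : ∀ x, b x ^ 2 = 1 := fun x => by rcases hb x with h | h <;> simp [h]
  set S := ∑ x ∈ X, ∑ y ∈ Y, g x y * a x * b y
  set T := ∑ x ∈ X, (∑ y ∈ Y, g x y * b y) ^ 2 with hT
  have h1 : S ^ 2 ≤ #X * T := by
    have : S = ∑ x ∈ X, a x * ∑ y ∈ Y, g x y * b y :=
      sum_congr rfl fun x _ => by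
        rw [mul_sum]; exact sum_congr rfl fun y _ => by ring
    rw [this]
    refine (sum_mul_sq_le_sq_mul_sq _ _ _).trans (le_of_eq ?_)
    simp only [ha2, sum_const, nsmul_eq_mul, mul_one, hT]
  have hT' : T = ∑ p ∈ Y ×ˢ Y, (b p.1 * b p.2) * ∑ x ∈ X, g x p.1 * g x p.2 := by
    rw [sum_product]
    simp only [hT, sq, sum_mul_sum]
    simp only [mul_sum]
    rw [sum_comm]
    refine sum_congr rfl fun y _ => ?_
    rw [sum_comm]
    exact sum_congr rfl fun y' _ => sum_congr rfl fun x _ => by ring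
  have h2 : T ^ 2 ≤ #Y ^ 2 * ∑ y ∈ Y, ∑ y' ∈ Y, (∑ x ∈ X, g x y * g x y') ^ 2 := by
    rw [hT']
    refine (sum_mul_sq_le_sq_mul_sq _ _ _).trans (le_of_eq ?_)
    rw [sum_product (f := fun p => (∑ x ∈ X, g x p.1 * g x p.2) ^ 2)]
    simp only [mul_pow, hb2, mul_one, sum_const, card_product, nsmul_eq_mul, Nat.cast_mul]
    rw [sq]
  have hT0 : 0 ≤ T := sum_nonneg fun _ _ => sq_nonneg _
  refine le_of_pow_le_pow_left₀ (n := 4) (by norm_num) hB (le_trans ?_ h)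
  calc S ^ 4 = (S ^ 2) ^ 2 := by ring
    _ ≤ (#X * T) ^ 2 := by gcongr
    _ = #X ^ 2 * T ^ 2 := by ring
    _ ≤ _ := by rw [mul_assoc]; gcongr

/-- The centred indicator of the value `c` among `q` values. -/
noncomputable def centred {q : ℕ} (c d : Fin q) : ℝ := (if d = c then 1 else 0) - 1 / q

lemma sum_centred {q : ℕ} (hq : q ≠ 0) (c : Fin q) : ∑ d, centred c d = 0 := by
  simp [centred, hq]

lemma abs_centred_le {q : ℕ} (c d : Fin q) : |centred c d| ≤ 1 := by
  have hq : (1 : ℝ) ≤ q := by exact_mod_cast Fin.pos c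
  have h1 : 1 / (q : ℝ) ≤ 1 := (div_le_one (by linarith)).2 hq
  have h0 : 0 ≤ 1 / (q : ℝ) := by positivity
  unfold centred
  split_ifs <;> rw [abs_le] <;> constructor <;> linarith

lemma sum_prod_centred {E : Type*} [Fintype E] [DecidableEq E] {q : ℕ} (hq : q ≠ 0) (c : Fin q)
    (S : Finset E)
    (hS : S.Nonempty) : ∑ ω : E → Fin q, ∏ e ∈ S, centred c (ω e) = 0 := by
  obtain ⟨e₀, he₀⟩ := hS
  have := (Finset.prod_univ_sum (fun _ : E => (univ : Finset (Fin q)))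
    (fun e d => if e ∈ S then centred c d else 1)).symm
  rw [Fintype.piFinset_univ] at this
  rw [prod_eq_zero (mem_univ e₀) (by simp [he₀, sum_centred hq])] at this
  rw [← this]
  refine sum_congr rfl fun ω _ => ?_
  rw [prod_ite_mem, univ_inter]

lemma sum_quadruple_le {U : Type*} [Fintype U] {q : ℕ} (hq : q ≠ 0) (c : Fin q)
    (A : U → U → ℝ) (hA : ∀ x y, |A x y| ≤ 1) (x x' y y' : U) :
    ∑ ω : U × U → Fin q, (A x y * centred c (ω (x, y))) * (A x y' * centred c (ω (x, y'))) *
      ((A x' y * centred c (ω (x', y))) * (A x' y' * centred c (ω (x', y')))) ≤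
    Fintype.card (U × U → Fin q) * ((if x = x' then 1 else 0) + if y = y' then 1 else 0) := by
  by_cases h : x = x' ∨ y = y'
  · have hle : ∀ ω : U × U → Fin q, (A x y * centred c (ω (x, y))) *
        (A x y' * centred c (ω (x, y'))) *
        ((A x' y * centred c (ω (x', y))) * (A x' y' * centred c (ω (x', y')))) ≤ 1 := by
      intro ω
      have key : ∀ x y, |A x y * centred c (ω (x, y))| ≤ 1 := fun x y => by
        rw [abs_mul]; exact mul_le_one₀ (hA x y) (abs_nonneg _) (abs_centred_le _ _)
      have key2 : ∀ r s : ℝ, |r| ≤ 1 → |s| ≤ 1 → |r * s| ≤ 1 := fun r s hr hs => by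
        rw [abs_mul]; exact mul_le_one₀ hr (abs_nonneg _) hs
      exact (le_abs_self _).trans (key2 _ _ (key2 _ _ (key _ _) (key _ _))
        (key2 _ _ (key _ _) (key _ _)))
    refine (sum_le_sum fun ω _ => hle ω).trans ?_
    rw [sum_const, nsmul_eq_mul, mul_one, card_univ]
    refine le_mul_of_one_le_right (by positivity) ?_
    rcases h with h | h
    · rw [if_pos h]; split_ifs <;> norm_num
    · rw [if_pos h]; split_ifs <;> norm_num
  · push Not at h
    obtain ⟨hx, hy⟩ := h
    rw [if_neg hx, if_neg hy, add_zero, mul_zero]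
    have := sum_prod_centred hq c ({(x, y), (x, y'), (x', y), (x', y')} : Finset (U × U))
      ⟨(x, y), by simp⟩
    refine le_of_eq ?_
    rw [← mul_zero (A x y * A x y' * A x' y * A x' y'), ← this, mul_sum]
    refine sum_congr rfl fun ω _ => ?_
    rw [prod_insert (by simp [hx, hy]), prod_insert (by simp [hx]),
      prod_insert (by simp [hy]), prod_singleton]
    ring

lemma exists_splitting {U ι : Type*} [Fintype U] [Fintype ι] {q : ℕ} (hq : q ≠ 0)
    (A : ι → U → U → ℝ) (hA : ∀ i x y, |A i x y| ≤ 1) :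
    ∃ ω : U × U → Fin q, ∑ i, ∑ c, ∑ y, ∑ y', (∑ x, (A i x y * centred c (ω (x, y))) *
      (A i x y' * centred c (ω (x, y')))) ^ 2 ≤
      Fintype.card ι * q * (2 * (Fintype.card U : ℝ) ^ 3) := by
  have : Nonempty (U × U → Fin q) := ⟨fun _ => ⟨0, Nat.pos_of_ne_zero hq⟩⟩
  obtain ⟨ω, -, hω⟩ := exists_le_of_sum_le (s := (univ : Finset (U × U → Fin q))) univ_nonempty
    (f := fun ω => ∑ i, ∑ c, ∑ y, ∑ y', (∑ x, (A i x y * centred c (ω (x, y))) *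
      (A i x y' * centred c (ω (x, y')))) ^ 2)
    (g := fun _ => Fintype.card ι * q * (2 * (Fintype.card U : ℝ) ^ 3)) (by
      simp only [sq, sum_mul_sum]
      rw [sum_comm]
      have step : ∀ i, ∑ ω : U × U → Fin q, ∑ c, ∑ y, ∑ y', ∑ x, ∑ x',
          (A i x y * centred c (ω (x, y))) * (A i x y' * centred c (ω (x, y'))) *
          ((A i x' y * centred c (ω (x', y))) * (A i x' y' * centred c (ω (x', y')))) ≤
          q * (Fintype.card (U × U → Fin q) * (2 * (Fintype.card U : ℝ) ^ 3)) := by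
        intro i
        rw [sum_comm]
        have h2 : ∀ c : Fin q, ∑ ω : U × U → Fin q, ∑ y, ∑ y', ∑ x, ∑ x',
          (A i x y * centred c (ω (x, y))) * (A i x y' * centred c (ω (x, y'))) *
          ((A i x' y * centred c (ω (x', y))) * (A i x' y' * centred c (ω (x', y')))) ≤
          Fintype.card (U × U → Fin q) * (2 * (Fintype.card U : ℝ) ^ 3) := by
          intro c
          calc _ = ∑ y, ∑ y', ∑ x, ∑ x', ∑ ω : U × U → Fin q,
                (A i x y * centred c (ω (x, y))) * (A i x y' * centred c (ω (x, y'))) *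
                ((A i x' y * centred c (ω (x', y))) * (A i x' y' * centred c (ω (x', y')))) := by
                rw [sum_comm]; refine sum_congr rfl fun y _ => ?_
                rw [sum_comm]; refine sum_congr rfl fun y' _ => ?_
                rw [sum_comm]; refine sum_congr rfl fun x _ => ?_
                rw [sum_comm]
            _ ≤ ∑ y : U, ∑ y' : U, ∑ x : U, ∑ x' : U, (Fintype.card (U × U → Fin q) : ℝ) *
                ((if x = x' then 1 else 0) + if y = y' then 1 else 0) :=
                sum_le_sum fun y _ => sum_le_sum fun y' _ => sum_le_sum fun x _ =>
                  sum_le_sum fun x' _ => sum_quadruple_le hq c (A i) (hA i) x x' y y'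
            _ = _ := by
                simp only [← mul_sum, sum_add_distrib, sum_ite_eq, mem_univ, if_true, sum_const,
                  card_univ, nsmul_eq_mul]
                ring
        refine (sum_le_sum fun c _ => h2 c).trans ?_
        simp
      refine (sum_le_sum fun i _ => step i).trans (le_of_eq ?_)
      simp only [sum_const, card_univ, nsmul_eq_mul]
      ring)
  exact ⟨ω, hω⟩

/-- Every edge colouring can be split evenly and quasirandomly. -/
theorem exists_quasirandom_splitting (m q : ℕ) (hq : q ≠ 0) (δ : ℝ) (hδ : 0 < δ) (V : Finset ℕ)
    (hV : 2 * m * q / δ ^ 4 ≤ #V) (f : ℕ → ℕ → ℕ) :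
    ∃ ρ : ℕ → ℕ → ℕ, (∀ x y, ρ x y < q) ∧ ∀ α < m, ∀ c < q,
      CutBound V V (fun x y => (if f x y = α then 1 else 0) *
        ((if ρ x y = c then 1 else 0) - 1 / (q : ℝ))) (δ * #V ^ 2) := by
  obtain ⟨ω, hω⟩ := exists_splitting (U := V) (ι := Fin m) hq
    (fun i x y => if f x y = i then 1 else 0) (fun i x y => by split_ifs <;> simp)
  refine ⟨fun x y => if h : x ∈ V ∧ y ∈ V then ω (⟨x, h.1⟩, ⟨y, h.2⟩) else 0, ?_, ?_⟩
  · intro x y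
    dsimp only
    split_ifs
    · exact Fin.is_lt _
    · exact Nat.pos_of_ne_zero hq
  intro α hα c hc
  refine cutBound_of_box (by positivity) ?_
  have hbox : ∑ y ∈ V, ∑ y' ∈ V, (∑ x ∈ V, (if f x y = α then 1 else 0) *
        ((if (if h : x ∈ V ∧ y ∈ V then (ω (⟨x, h.1⟩, ⟨y, h.2⟩) : ℕ) else 0) = c then 1 else 0)
          - 1 / (q : ℝ)) * ((if f x y' = α then 1 else 0) *
        ((if (if h : x ∈ V ∧ y' ∈ V then (ω (⟨x, h.1⟩, ⟨y', h.2⟩) : ℕ) else 0) = c then 1 else 0)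
          - 1 / (q : ℝ)))) ^ 2 ≤ m * q * (2 * (#V : ℝ) ^ 3) := by
    simp only [Fintype.card_fin, Fintype.card_coe] at hω
    refine le_trans ?_ hω
    refine le_trans ?_ (single_le_sum (f := fun i : Fin m => ∑ c, ∑ y : V, ∑ y' : V,
      (∑ x : V, ((if f x y = i then 1 else 0) * centred c (ω (x, y))) *
      ((if f x y' = i then 1 else 0) * centred c (ω (x, y')))) ^ 2)
      (fun i _ => by positivity) (mem_univ ⟨α, hα⟩))
    refine le_trans ?_ (single_le_sum (f := fun c => ∑ y : V, ∑ y' : V,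
      (∑ x : V, ((if f x y = α then 1 else 0) * centred c (ω (x, y))) *
      ((if f x y' = α then 1 else 0) * centred c (ω (x, y')))) ^ 2)
      (fun i _ => by positivity) (mem_univ ⟨c, hc⟩))
    refine le_of_eq ?_
    rw [← sum_coe_sort]
    refine sum_congr rfl fun y _ => ?_
    rw [← sum_coe_sort]
    refine sum_congr rfl fun y' _ => ?_
    rw [← sum_coe_sort]
    congr 1
    refine sum_congr rfl fun x _ => ?_
    simp [centred, Fin.ext_iff]
  refine (mul_le_mul_of_nonneg_left hbox (by positivity)).trans ?_
  rw [div_le_iff₀ (by positivity)] at hV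
  calc (#V : ℝ) ^ 2 * #V ^ 2 * (m * q * (2 * (#V : ℝ) ^ 3)) = (2 * m * q) * #V ^ 7 := by ring
    _ ≤ (#V * δ ^ 4) * #V ^ 7 := by gcongr
    _ = (δ * #V ^ 2) ^ 4 := by ring

/-! ### Equitable partitions -/

lemma exists_equitable_refinement (V : Finset ℕ) (c : ℕ → ℕ) (k : ℕ) (hc : ∀ x, c x < k)
    (t : ℕ) (ht : 0 < t) (htV : t ≤ #V) :
    ∃ c' : ℕ → Fin t, ∃ B : Finset ℕ,
      (∀ i j, #{x ∈ V | c' x = i} ≤ #{x ∈ V | c' x = j} + 1) ∧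
      (∀ i, #V / t ≤ #{x ∈ V | c' x = i}) ∧ #B ≤ k * (#V / t) ∧
      ∀ x ∈ V, x ∉ B → ∀ y ∈ V, c' y = c' x → c y = c x := by
  let P : Finpartition V := Finpartition.ofSetSetoid (Setoid.ker c) V
  have hPk : #P.parts ≤ k := by
    have : P.parts = (V.image c).image fun i => {b ∈ V | i = c b} := by
      rw [image_image]
      exact image_congr fun a _ => filter_congr fun b _ => Iff.rfl
    rw [this]
    refine card_image_le.trans ?_
    have := card_le_card (s := V.image c) (t := range k) (by
      intro i hi
      obtain ⟨x, -, rfl⟩ := mem_image.1 hi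
      exact mem_range.2 (hc x))
    simpa using this
  have hPc : ∀ u ∈ P.parts, ∀ x ∈ u, ∀ y ∈ u, c y = c x := by
    intro u hu x hx y hy
    obtain ⟨a, -, rfl⟩ := mem_image.1 hu
    exact (mem_filter.1 hy).2.symm.trans (mem_filter.1 hx).2
  have hab : (t - #V % t) * (#V / t) + #V % t * (#V / t + 1) = #V := by
    have h1 := Nat.mod_lt #V ht
    have h2 := Nat.mod_add_div #V t
    zify [h1.le] at h2 ⊢
    linarith
  have hm : #V / t ≠ 0 := (Nat.div_pos htV ht).ne'
  set Q := P.equitabilise hab with hQ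
  have hQt : #Q.parts = t := by
    rw [hQ, P.card_parts_equitabilise hab hm]
    have h1 := Nat.mod_lt #V ht
    omega
  have hQs : ∀ u ∈ Q.parts, #u = #V / t ∨ #u = #V / t + 1 :=
    fun u hu => P.card_eq_of_mem_parts_equitabilise hu
  let e : Q.parts ≃ Fin t := Q.parts.equivFinOfCardEq hQt
  let c' : ℕ → Fin t := fun x => if h : x ∈ V then e ⟨Q.part x, Q.part_mem.2 h⟩ else ⟨0, ht⟩
  have hc' : ∀ x ∈ V, ∀ u (hu : u ∈ Q.parts), c' x = e ⟨u, hu⟩ ↔ x ∈ u := by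
    intro x hx u hu
    simp only [c', dif_pos hx, EmbeddingLike.apply_eq_iff_eq, Subtype.mk.injEq]
    exact Q.part_eq_iff_mem hu
  have hpart : ∀ i, ∃ u ∈ Q.parts, {x ∈ V | c' x = i} = u := by
    intro i
    refine ⟨(e.symm i).1, (e.symm i).2, ?_⟩
    ext x
    rw [mem_filter]
    constructor
    · rintro ⟨hx, h⟩
      rw [← hc' x hx _ (e.symm i).2]
      simpa using h
    · intro h
      have hx := Q.le (e.symm i).2 h
      refine ⟨hx, ?_⟩
      have := (hc' x hx _ (e.symm i).2).2 h
      simpa using this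
  refine ⟨c', P.parts.biUnion fun u => u \ {v ∈ Q.parts | v ⊆ u}.biUnion id, ?_, ?_, ?_, ?_⟩
  · intro i j
    obtain ⟨u, hu, h⟩ := hpart i
    obtain ⟨v, hv, h'⟩ := hpart j
    rw [h, h']
    have := hQs u hu
    have := hQs v hv
    omega
  · intro i
    obtain ⟨u, hu, h⟩ := hpart i
    rw [h]
    have := hQs u hu
    omega
  · refine card_biUnion_le.trans ?_
    refine (sum_le_sum fun u hu => P.card_parts_equitabilise_subset_le hab hu).trans ?_
    rw [sum_const, smul_eq_mul]
    exact Nat.mul_le_mul_right _ hPk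
  · intro x hx hxB y hy hxy
    obtain ⟨u, hu, hxu⟩ := P.exists_mem hx
    have : x ∈ {v ∈ Q.parts | v ⊆ u}.biUnion id := by
      by_contra h
      exact hxB (mem_biUnion.2 ⟨u, hu, mem_sdiff.2 ⟨hxu, h⟩⟩)
    obtain ⟨v, hv, hxv⟩ := mem_biUnion.1 this
    rw [mem_filter] at hv
    have h1 := (hc' x hx v hv.1).2 hxv
    exact hPc u hu x hxu y (hv.2 ((hc' y hy v hv.1).1 (hxy.trans h1)))

/-! ### Markov's inequality for cell averages -/

lemma cellAvg_eq_of_mem_iff {β κ : Type*} {Ω s : Finset β} {Φ : β → κ} {F : β → ℝ} {w : β}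
    (hs : ∀ v, v ∈ s ↔ v ∈ Ω ∧ Φ v = Φ w) : cellAvg Ω Φ F w = (∑ v ∈ s, F v) / #s := by
  obtain rfl : s = {v ∈ Ω | Φ v = Φ w} := by ext v; rw [hs, mem_filter]
  rfl

lemma sum_cellAvg {β κ : Type*} {Ω : Finset β} {Φ : β → κ} (F : β → ℝ) :
    ∑ w ∈ Ω, cellAvg Ω Φ F w = ∑ w ∈ Ω, F w := by
  simpa using sum_cellAvg_mul (Ω := Ω) (Φ := Φ) (F := F) (u := fun _ => 1) fun _ _ _ _ _ => rfl

lemma card_lt_cellAvg_le {β κ : Type*} {Ω : Finset β} {Φ : β → κ} {F : β → ℝ}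
    (hF : ∀ w, 0 ≤ F w) (θ : ℝ) :
    θ * #{w ∈ Ω | θ < cellAvg Ω Φ F w} ≤ ∑ w ∈ Ω, F w := by
  rw [← sum_cellAvg (Φ := Φ) F]
  calc θ * #{w ∈ Ω | θ < cellAvg Ω Φ F w} = ∑ w ∈ Ω with θ < cellAvg Ω Φ F w, θ := by
        rw [sum_const, nsmul_eq_mul, mul_comm]
    _ ≤ ∑ w ∈ Ω with θ < cellAvg Ω Φ F w, cellAvg Ω Φ F w :=
        sum_le_sum fun w hw => (mem_filter.1 hw).2.le
    _ ≤ _ := sum_le_sum_of_subset_of_nonneg (filter_subset _ _)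
        fun w _ _ => cellAvg_nonneg hF w

lemma sum_abs_le_of_sum_sq_le {β : Type*} {Ω : Finset β} {F : β → ℝ} {κ N : ℝ} (hκ : 0 ≤ κ)
    (hN : #Ω = N) (h : ∑ w ∈ Ω, F w ^ 2 ≤ κ ^ 2 * N) : ∑ w ∈ Ω, |F w| ≤ κ * N := by
  have hN0 : 0 ≤ N := hN ▸ Nat.cast_nonneg _
  refine abs_le_of_sq_le_sq' ?_ (by positivity) |>.2
  refine sq_sum_le_card_mul_sum_sq.trans ?_
  simp only [sq_abs, hN]
  calc N * ∑ w ∈ Ω, F w ^ 2 ≤ N * (κ ^ 2 * N) := by gcongr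
    _ = _ := by ring

/-! ### Regular pairs -/

/-- The density of the colour `α` between `X` and `Y`. -/
noncomputable def colorDens (f : ℕ → ℕ → ℕ) (α : ℕ) (X Y : Finset ℕ) : ℝ :=
  (∑ x ∈ X, ∑ y ∈ Y, if f x y = α then 1 else 0) / (#X * #Y)

/-- Each of the first `m` colours is quasirandom between `X` and `Y`. -/
def RegPair (f : ℕ → ℕ → ℕ) (m : ℕ) (τ : ℝ) (X Y : Finset ℕ) : Prop :=
  ∀ α < m, CutBound X Y (fun x y => (if f x y = α then 1 else 0) - colorDens f α X Y)
    (τ * (#X * #Y))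

lemma CutBound.nonneg {X Y : Finset ℕ} {g : ℕ → ℕ → ℝ} {B : ℝ} (h : CutBound X Y g B) : 0 ≤ B :=
  (abs_nonneg _).trans (h (fun _ => 1) (fun _ => 1) (by simp) (by simp))

lemma cutBound_sub_average {X Y : Finset ℕ} {F g₂ g₃ : ℕ → ℕ → ℝ} {p A B : ℝ}
    (h : ∀ x ∈ X, ∀ y ∈ Y, F x y = p + g₂ x y + g₃ x y)
    (h₂ : ∑ x ∈ X, ∑ y ∈ Y, |g₂ x y| ≤ A) (h₃ : CutBound X Y g₃ B) :
    CutBound X Y (fun x y => F x y - (∑ x ∈ X, ∑ y ∈ Y, F x y) / (#X * #Y)) (2 * A + 2 * B) := by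
  set D := (∑ x ∈ X, ∑ y ∈ Y, F x y) / (#X * #Y) with hD
  have hA := cutBound_of_sum_abs_le h₂
  have hp : |p - D| * (#X * #Y) ≤ A + B := by
    rcases eq_or_ne ((#X : ℝ) * #Y) 0 with h0 | h0
    · rw [h0, mul_zero]
      exact add_nonneg hA.nonneg h₃.nonneg
    have h1 : D * (#X * #Y) = p * (#X * #Y) + ∑ x ∈ X, ∑ y ∈ Y, (g₂ x y + g₃ x y) := by
      rw [hD, div_mul_cancel₀ _ h0, sum_congr rfl fun x hx => sum_congr rfl fun y hy => h x hx y hy]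
      simp only [sum_add_distrib, sum_const, nsmul_eq_mul]
      ring
    have h2 : |p - D| * (#X * #Y) = |∑ x ∈ X, ∑ y ∈ Y, (g₂ x y + g₃ x y)| := by
      rw [← abs_of_nonneg (show (0 : ℝ) ≤ #X * #Y by positivity), ← abs_mul, sub_mul,
        h1, abs_sub_comm]
      congr 1
      ring
    rw [h2]
    exact (hA.add h₃).abs_sum_le
  refine (((cutBound_const (p - D)).mono hp).add (hA.add h₃)).mono (by linarith) |>.congr
    fun x hx y hy => ?_
  rw [h x hx y hy]
  ring

/-- A regularity lemma for edge colourings: almost all pairs of parts are regular in all colours. -/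
theorem exists_regular_partition (m t₀ : ℕ) (hm : 0 < m) (ht₀ : 0 < t₀) (τ : ℝ) (hτ : 0 < τ) :
    ∃ T : ℕ, ∀ V : Finset ℕ, T ≤ #V → ∀ f : ℕ → ℕ → ℕ,
      ∃ t, t₀ ≤ t ∧ t ≤ T ∧ ∃ c : ℕ → Fin t,
        (∀ i j, #{x ∈ V | c x = i} ≤ #{x ∈ V | c x = j} + 1) ∧
        (∀ i, #V ≤ 2 * t * #{x ∈ V | c x = i}) ∧
        #{p ∈ V ×ˢ V | ¬ RegPair f m τ {x ∈ V | c x = c p.1} {x ∈ V | c x = c p.2}}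
          ≤ τ * #V ^ 2 := by
  set M : ℕ := t₀ * (⌈4 / τ⌉₊ + 1) with hM
  have hM0 : 0 < M := by positivity
  have hMτ : 4 / τ ≤ M := by
    refine (Nat.le_ceil _).trans ?_
    have : ⌈4 / τ⌉₊ ≤ M := (Nat.le_succ _).trans (Nat.le_mul_of_pos_left _ ht₀)
    exact_mod_cast this
  set κ : ℝ := τ ^ 2 / (16 * m) with hκ
  have hκ0 : 0 < κ := by positivity
  set δ : ℕ → ℝ := fun k => τ / (16 * m * ((k * M : ℕ) + 1) ^ 2) with hδ
  have hδ0 : ∀ k, 0 < δ k := fun k => by positivity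
  set K := chainSize (4 * ·) δ 1 with hK
  refine ⟨(∑ s ∈ range (⌊(κ ^ 2)⁻¹⌋₊ + 1), K s * M) + 1, fun V hV f => ?_⟩
  obtain ⟨s, hs, c₀, c₁, hc₀, hcut, hL2⟩ :=
    exists_pairColor_pair m (κ ^ 2) (by positivity) δ hδ0 V f
  rw [← hK] at hc₀ hcut
  set k := K s
  have hk : 0 < k := (Nat.zero_le _).trans_lt (hc₀ 0)
  have htT : k * M ≤ ∑ s ∈ range (⌊(κ ^ 2)⁻¹⌋₊ + 1), K s * M :=
    single_le_sum (f := fun s => K s * M) (fun _ _ => Nat.zero_le _)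
      (mem_range.2 (Nat.lt_succ_of_le hs))
  set t := k * M with ht
  have ht0 : 0 < t := Nat.mul_pos hk hM0
  have htV : t ≤ #V := by omega
  obtain ⟨c, B, hc1, hc2, hB, hhom⟩ := exists_equitable_refinement V c₀ k hc₀ t ht0 htV
  have hsize : ∀ i, #V ≤ 2 * t * #{x ∈ V | c x = i} := by
    intro i
    have h1 := hc2 i
    have h2 := Nat.div_add_mod #V t
    have h3 := Nat.mod_lt #V ht0
    have h4 : 1 ≤ #V / t := Nat.div_pos htV ht0
    have h5 : t * (#V / t) ≤ t * #{x ∈ V | c x = i} := Nat.mul_le_mul_left _ h1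
    have h6 : t * 1 ≤ t * (#V / t) := Nat.mul_le_mul_left _ h4
    rw [mul_assoc]
    omega
  refine ⟨t, ?_, by omega, c, hc1, hsize, ?_⟩
  · calc t₀ ≤ M := Nat.le_mul_of_pos_right _ (Nat.succ_pos _)
      _ ≤ t := Nat.le_mul_of_pos_left _ hk
  have hVpos : 0 < #V := by omega
  have hV0 : (0 : ℝ) < #V := by exact_mod_cast hVpos
  set Ω := V ×ˢ V ×ˢ range m with hΩ
  have hΩcard : (#Ω : ℝ) = (#V : ℝ) ^ 2 * m := by
    rw [hΩ, card_product, card_product, card_range]; push_cast; ring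
  set F : ℕ × ℕ × ℕ → ℝ := fun w => cellAvg Ω (pairColor c₁) (classInd f) w -
    cellAvg Ω (pairColor c₀) (classInd f) w with hF
  have hL1 := sum_abs_le_of_sum_sq_le hκ0.le hΩcard hL2
  set G : ℕ × ℕ → ℝ := fun p => ∑ α ∈ range m, |F (p.1, p.2, α)| with hG
  have hG0 : ∀ p, 0 ≤ G p := fun p => sum_nonneg fun _ _ => abs_nonneg _
  have hGsum : ∑ p ∈ V ×ˢ V, G p ≤ κ * ((#V : ℝ) ^ 2 * m) := by
    refine le_trans (le_of_eq ?_) hL1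
    rw [hΩ, sum_product, sum_product]
    refine sum_congr rfl fun x _ => ?_
    rw [sum_product]
  have hmarkov := card_lt_cellAvg_le (Ω := V ×ˢ V) (Φ := fun p => (c p.1, c p.2)) hG0 (τ / 4)
  have hgood : ∀ p ∈ V ×ˢ V, p.1 ∉ B → p.2 ∉ B →
      ¬ τ / 4 < cellAvg (V ×ˢ V) (fun p => (c p.1, c p.2)) G p →
      RegPair f m τ {x ∈ V | c x = c p.1} {x ∈ V | c x = c p.2} := by
    intro p hp h1 h2 h3 α hα
    rw [mem_product] at hp
    have hX := hsize (c p.1)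
    have hY := hsize (c p.2)
    rw [not_lt, cellAvg_eq_of_mem_iff (s := {x ∈ V | c x = c p.1} ×ˢ {x ∈ V | c x = c p.2})
      (fun q => by simp only [mem_filter, mem_product, Prod.mk.injEq]; tauto)] at h3
    set X : Finset ℕ := {x ∈ V | c x = c p.1} with hXdef
    set Y : Finset ℕ := {x ∈ V | c x = c p.2} with hYdef
    clear_value X Y
    have hX' : (#V : ℝ) ≤ 2 * t * #X := by exact_mod_cast hX
    have hY' : (#V : ℝ) ≤ 2 * t * #Y := by exact_mod_cast hY
    have hX0 : (0 : ℝ) < #X := by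
      by_contra h
      have : (#X : ℝ) = 0 := le_antisymm (not_lt.1 h) (Nat.cast_nonneg _)
      rw [this, mul_zero] at hX'
      linarith
    have hY0 : (0 : ℝ) < #Y := by
      by_contra h
      have : (#Y : ℝ) = 0 := le_antisymm (not_lt.1 h) (Nat.cast_nonneg _)
      rw [this, mul_zero] at hY'
      linarith
    rw [card_product, Nat.cast_mul, div_le_iff₀ (mul_pos hX0 hY0)] at h3
    refine (cutBound_sub_average (F := fun x y => if f x y = α then 1 else 0)
      (p := cellAvg Ω (pairColor c₀) (classInd f) (p.1, p.2, α))
      (g₂ := fun x y => F (x, y, α)) (A := τ / 4 * (#X * #Y))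
      (g₃ := fun x y => classInd f (x, y, α) - cellAvg Ω (pairColor c₁) (classInd f) (x, y, α))
      (B := δ k * ((#V : ℝ) ^ 2 * m)) ?_ ?_ ?_).mono ?_
    · intro x hx y hy
      rw [hXdef, mem_filter] at hx
      rw [hYdef, mem_filter] at hy
      have e : cellAvg Ω (pairColor c₀) (classInd f) (x, y, α) =
          cellAvg Ω (pairColor c₀) (classInd f) (p.1, p.2, α) := by
        apply cellAvg_congr
        simp only [pairColor, hhom p.1 hp.1 h1 x hx.1 hx.2, hhom p.2 hp.2 h2 y hy.1 hy.2]
      simp only [hF, e, classInd]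
      ring
    · refine le_trans ?_ h3
      rw [sum_product]
      refine sum_le_sum fun x _ => sum_le_sum fun y _ => ?_
      exact single_le_sum (f := fun α => |F (x, y, α)|) (fun _ _ => abs_nonneg _)
        (mem_range.2 hα)
    · exact (hcut α hα).subset (hXdef ▸ filter_subset _ _) (hYdef ▸ filter_subset _ _)
    · have h4 : (#V : ℝ) ^ 2 ≤ 4 * (t + 1) ^ 2 * (#X * #Y) := by
        calc (#V : ℝ) ^ 2 = #V * #V := sq _
          _ ≤ (2 * t * #X) * (2 * t * #Y) := by gcongr
          _ = 4 * t ^ 2 * (#X * #Y) := by ring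
          _ ≤ _ := by gcongr; linarith
      have h5 : δ k * ((#V : ℝ) ^ 2 * m) ≤ τ / 4 * (#X * #Y) := by
        calc δ k * ((#V : ℝ) ^ 2 * m) ≤ δ k * ((4 * (t + 1) ^ 2 * (#X * #Y)) * m) := by
              have := (hδ0 k).le
              gcongr
          _ = τ / 4 * (#X * #Y) := by
              have hm' : (m : ℝ) ≠ 0 := by positivity
              have ht' : (t : ℝ) + 1 ≠ 0 := by positivity
              have hδk : δ k = τ / (16 * m * ((t : ℝ) + 1) ^ 2) := rfl
              rw [hδk]
              generalize (t : ℝ) + 1 = u at ht'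
              generalize (#X : ℝ) * #Y = N
              field_simp
              norm_num
      linarith
  have hsub : {p ∈ V ×ˢ V | ¬ RegPair f m τ {x ∈ V | c x = c p.1} {x ∈ V | c x = c p.2}} ⊆
      (B ×ˢ V ∪ V ×ˢ B) ∪
        {p ∈ V ×ˢ V | τ / 4 < cellAvg (V ×ˢ V) (fun p => (c p.1, c p.2)) G p} := by
    intro p hp
    rw [mem_filter] at hp
    by_contra h
    simp only [mem_union, mem_filter, mem_product, hp.1, true_and, not_or] at h
    have hp1 := mem_product.1 hp.1
    exact hp.2 (hgood p hp.1 (fun hh => h.1.1 ⟨hh, hp1.2⟩) (fun hh => h.1.2 ⟨hp1.1, hh⟩) h.2)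
  have hBcard : (#B : ℝ) ≤ τ / 4 * #V := by
    have h1 : (#B : ℝ) * M ≤ #V := by
      have : #B * M ≤ #V := calc
        #B * M ≤ k * (#V / t) * M := Nat.mul_le_mul_right _ hB
        _ = t * (#V / t) := by rw [ht]; ring
        _ ≤ #V := Nat.mul_div_le _ _
      exact_mod_cast this
    have h2 : 4 ≤ M * τ := by rwa [div_le_iff₀ hτ] at hMτ
    nlinarith [Nat.cast_nonneg (α := ℝ) #B]
  have hcard := (card_le_card hsub).trans ((card_union_le _ _).trans
    (Nat.add_le_add_right (card_union_le _ _) _))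
  rw [card_product, card_product] at hcard
  have hcard' : (#{p ∈ V ×ˢ V | ¬ RegPair f m τ {x ∈ V | c x = c p.1} {x ∈ V | c x = c p.2}} : ℝ) ≤
      #B * #V + #V * #B +
        #{p ∈ V ×ˢ V | τ / 4 < cellAvg (V ×ˢ V) (fun p => (c p.1, c p.2)) G p} := by
    exact_mod_cast hcard
  have hlast : (#{p ∈ V ×ˢ V | τ / 4 < cellAvg (V ×ˢ V) (fun p => (c p.1, c p.2)) G p} : ℝ) ≤
      τ / 4 * #V ^ 2 := by
    have h1 : κ * ((#V : ℝ) ^ 2 * m) = τ / 4 * (τ / 4 * #V ^ 2) := by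
      have hm' : (m : ℝ) ≠ 0 := by positivity
      rw [hκ]; field_simp; ring
    exact le_of_mul_le_mul_left ((hmarkov.trans hGsum).trans (le_of_eq h1)) (by positivity)
  nlinarith

/-! ### Counting -/

section Counting

variable {ι : Type*} [Fintype ι] [DecidableEq ι] {Xs : ι → Finset ℕ}

lemma sum_piFinset_update (i : ι) (G : (ι → ℕ) → ℝ) :
    ∑ v ∈ Fintype.piFinset Xs, ∑ a ∈ Xs i, G (Function.update v i a) =
      #(Xs i) * ∑ v ∈ Fintype.piFinset Xs, G v := by
  have h1 : (#(Xs i) : ℝ) * ∑ v ∈ Fintype.piFinset Xs, G v =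
      ∑ v ∈ Fintype.piFinset Xs, ∑ a ∈ Xs i, G v := by
    simp [mul_sum]
  rw [h1, ← sum_product', ← sum_product']
  have hmem : ∀ p ∈ Fintype.piFinset Xs ×ˢ Xs i,
      (Function.update p.1 i p.2, p.1 i) ∈ Fintype.piFinset Xs ×ˢ Xs i := by
    rintro ⟨v, a⟩ hp
    rw [mem_product, Fintype.mem_piFinset] at hp ⊢
    refine ⟨fun j => ?_, hp.1 i⟩
    rcases eq_or_ne j i with rfl | hj
    · simpa using hp.2
    · simpa [Function.update_of_ne hj] using hp.1 j
  refine sum_nbij' (fun p => (Function.update p.1 i p.2, p.1 i))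
    (fun p => (Function.update p.1 i p.2, p.1 i)) hmem hmem ?_ ?_ ?_ <;> intro p _ <;> simp

lemma abs_sum_piFinset_le {i j : ι} (hij : i ≠ j) {g : ℕ → ℕ → ℝ} {τ : ℝ}
    (hg : CutBound (Xs i) (Xs j) g (τ * (#(Xs i) * #(Xs j)))) {P Q : (ι → ℕ) → ℝ}
    (hP : ∀ v, |P v| ≤ 1) (hQ : ∀ v, |Q v| ≤ 1)
    (hPj : ∀ v b, P (Function.update v j b) = P v) (hQi : ∀ v a, Q (Function.update v i a) = Q v) :
    |∑ v ∈ Fintype.piFinset Xs, P v * Q v * g (v i) (v j)| ≤ τ * #(Fintype.piFinset Xs) := by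
  rcases eq_or_ne ((#(Xs i) : ℝ) * #(Xs j)) 0 with h0 | h0
  · have : Fintype.piFinset Xs = ∅ := by
      rw [Fintype.piFinset_eq_empty]
      rcases mul_eq_zero.1 h0 with h | h
      · exact ⟨i, by simpa using h⟩
      · exact ⟨j, by simpa using h⟩
    simp [this]
  have hpos : (0 : ℝ) < #(Xs i) * #(Xs j) := lt_of_le_of_ne (by positivity) h0.symm
  refine le_of_mul_le_mul_left ?_ hpos
  rw [← abs_of_pos hpos, ← abs_mul, abs_of_pos hpos, mul_assoc,
    ← sum_piFinset_update j, ← sum_piFinset_update i]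
  refine (abs_sum_le_sum_abs _ _).trans ?_
  calc _ ≤ ∑ v ∈ Fintype.piFinset Xs, τ * (#(Xs i) * #(Xs j)) := by
        refine sum_le_sum fun v _ => ?_
        refine le_trans (le_of_eq ?_) (hg (fun a => P (Function.update v i a))
          (fun b => Q (Function.update v j b)) (fun _ => hP _) (fun _ => hQ _))
        congr 1
        refine sum_congr rfl fun a _ => sum_congr rfl fun b _ => ?_
        rw [hPj, Function.update_comm hij, hQi, Function.update_self,
          Function.update_of_ne hij.symm, Function.update_self]
        ring
    _ = _ := by rw [sum_const, nsmul_eq_mul]; ring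

/-- Counting lemma: in an average, quasirandom kernels may be replaced by their densities. -/
theorem abs_sum_prod_sub_le (k : ι × ι → ℕ → ℕ → ℝ) (d τ : ℝ) (hd0 : 0 ≤ d) (hd1 : d ≤ 1)
    (hk : ∀ e x y, |k e x y| ≤ 1) (P : (ι → ℕ) → ℝ) (hP : ∀ v, |P v| ≤ 1) (E : Finset (ι × ι))
    (hE : ∀ e ∈ E, e.1 ≠ e.2) (hE' : ∀ e ∈ E, (e.2, e.1) ∉ E)
    (hcut : ∀ e ∈ E, CutBound (Xs e.1) (Xs e.2) (fun x y => k e x y - d)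
      (τ * (#(Xs e.1) * #(Xs e.2))))
    (hPE : ∀ e ∈ E, (∀ v a, P (Function.update v e.1 a) = P v) ∨
      ∀ v a, P (Function.update v e.2 a) = P v) :
    |∑ v ∈ Fintype.piFinset Xs, P v * ∏ e ∈ E, k e (v e.1) (v e.2) -
      d ^ #E * ∑ v ∈ Fintype.piFinset Xs, P v| ≤ #E * (τ * #(Fintype.piFinset Xs)) := by
  induction E using Finset.induction_on with
  | empty => simp
  | insert e E he ih =>
    have ih' := ih (fun e' h => hE e' (mem_insert_of_mem h))
      (fun e' h h' => hE' e' (mem_insert_of_mem h) (mem_insert_of_mem h'))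
      (fun e' h => hcut e' (mem_insert_of_mem h)) (fun e' h => hPE e' (mem_insert_of_mem h))
    have hprod : ∀ (S : Finset (ι × ι)) (v : ι → ℕ), |∏ e ∈ S, k e (v e.1) (v e.2)| ≤ 1 :=
      fun S v => by
        rw [abs_prod]
        exact prod_le_one (fun _ _ => abs_nonneg _) fun e _ => hk _ _ _
    have hPprod : ∀ (S : Finset (ι × ι)) (v : ι → ℕ), |P v * ∏ e ∈ S, k e (v e.1) (v e.2)| ≤ 1 :=
      fun S v => by
        rw [abs_mul]; exact mul_le_one₀ (hP v) (abs_nonneg _) (hprod S v)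
    have hupd : ∀ (S : Finset (ι × ι)) i, (∀ e ∈ S, e.1 ≠ i ∧ e.2 ≠ i) → ∀ (v : ι → ℕ) a,
        ∏ e ∈ S, k e (Function.update v i a e.1) (Function.update v i a e.2) =
        ∏ e ∈ S, k e (v e.1) (v e.2) := fun S i h v a => prod_congr rfl fun e he => by
      rw [Function.update_of_ne (h e he).1, Function.update_of_ne (h e he).2]
    have hsplit : ∀ (i : ι) (v : ι → ℕ), ∏ e ∈ E, k e (v e.1) (v e.2) =
        (∏ e ∈ E with ¬ (e.1 ≠ i ∧ e.2 ≠ i), k e (v e.1) (v e.2)) *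
        ∏ e ∈ E with e.1 ≠ i ∧ e.2 ≠ i, k e (v e.1) (v e.2) := fun i v => by
      rw [mul_comm, prod_filter_mul_prod_filter_not]
    have hother1 : ∀ e' ∈ E.filter (fun e' => ¬ (e'.1 ≠ e.1 ∧ e'.2 ≠ e.1)),
        e'.1 ≠ e.2 ∧ e'.2 ≠ e.2 := by
      intro e' h'
      rw [mem_filter] at h'
      have h1 := hE e' (mem_insert_of_mem h'.1)
      have h2 := hE' e (mem_insert_self _ _)
      have h3 : e' ≠ e := fun h => he (h ▸ h'.1)
      have h4 : e' ≠ (e.2, e.1) := fun h => h2 (h ▸ mem_insert_of_mem h'.1)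
      rw [Ne, Prod.ext_iff] at h3 h4
      have h5 := hE e (mem_insert_self _ _)
      constructor <;> intro h <;> simp_all
    have hother2 : ∀ e' ∈ E.filter (fun e' => ¬ (e'.1 ≠ e.2 ∧ e'.2 ≠ e.2)),
        e'.1 ≠ e.1 ∧ e'.2 ≠ e.1 := by
      intro e' h'
      rw [mem_filter] at h'
      have h1 := hE e' (mem_insert_of_mem h'.1)
      have h2 := hE' e (mem_insert_self _ _)
      have h3 : e' ≠ e := fun h => he (h ▸ h'.1)
      have h4 : e' ≠ (e.2, e.1) := fun h => h2 (h ▸ mem_insert_of_mem h'.1)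
      rw [Ne, Prod.ext_iff] at h3 h4
      have h5 := hE e (mem_insert_self _ _)
      constructor <;> intro h <;> simp_all
    have hstep : |∑ v ∈ Fintype.piFinset Xs, P v * (∏ e ∈ E, k e (v e.1) (v e.2)) *
        (k e (v e.1) (v e.2) - d)| ≤ τ * #(Fintype.piFinset Xs) := by
      rcases hPE e (mem_insert_self _ _) with h | h
      · refine le_trans (le_of_eq ?_) (abs_sum_piFinset_le (hE e (mem_insert_self _ _))
          (hcut e (mem_insert_self _ _))
          (P := fun v => ∏ e' ∈ E with ¬ (e'.1 ≠ e.1 ∧ e'.2 ≠ e.1), k e' (v e'.1) (v e'.2))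
          (Q := fun v => P v * ∏ e' ∈ E with e'.1 ≠ e.1 ∧ e'.2 ≠ e.1, k e' (v e'.1) (v e'.2))
          (fun v => hprod _ v) (fun v => hPprod _ v) (fun v b => hupd _ _ hother1 v b)
          fun v a => ?_)
        · congr 1
          refine sum_congr rfl fun v _ => ?_
          rw [hsplit e.1 v]
          ring
        · rw [h, hupd _ _ (fun e' he' => (mem_filter.1 he').2)]
      · refine le_trans (le_of_eq ?_) (abs_sum_piFinset_le (hE e (mem_insert_self _ _))
          (hcut e (mem_insert_self _ _))
          (P := fun v => P v * ∏ e' ∈ E with e'.1 ≠ e.2 ∧ e'.2 ≠ e.2, k e' (v e'.1) (v e'.2))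
          (Q := fun v => ∏ e' ∈ E with ¬ (e'.1 ≠ e.2 ∧ e'.2 ≠ e.2), k e' (v e'.1) (v e'.2))
          (fun v => hPprod _ v) (fun v => hprod _ v) (fun v b => ?_)
          fun v b => hupd _ _ hother2 v b)
        · congr 1
          refine sum_congr rfl fun v _ => ?_
          rw [hsplit e.2 v]
          ring
        · rw [h, hupd _ _ (fun e' he' => (mem_filter.1 he').2)]
    have heq : ∑ v ∈ Fintype.piFinset Xs, P v * ∏ e ∈ insert e E, k e (v e.1) (v e.2) -
        d ^ #(insert e E) * ∑ v ∈ Fintype.piFinset Xs, P v =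
        ∑ v ∈ Fintype.piFinset Xs, P v * (∏ e ∈ E, k e (v e.1) (v e.2)) *
          (k e (v e.1) (v e.2) - d) +
        d * (∑ v ∈ Fintype.piFinset Xs, P v * ∏ e ∈ E, k e (v e.1) (v e.2) -
          d ^ #E * ∑ v ∈ Fintype.piFinset Xs, P v) := by
      have h1 : ∑ v ∈ Fintype.piFinset Xs, P v * ∏ e ∈ insert e E, k e (v e.1) (v e.2) =
          ∑ v ∈ Fintype.piFinset Xs, P v * (∏ e ∈ E, k e (v e.1) (v e.2)) *
            (k e (v e.1) (v e.2) - d) +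
          d * ∑ v ∈ Fintype.piFinset Xs, P v * ∏ e ∈ E, k e (v e.1) (v e.2) := by
        rw [Finset.mul_sum, ← sum_add_distrib]
        refine sum_congr rfl fun v _ => ?_
        rw [prod_insert he]
        ring
      rw [h1, card_insert_of_notMem he]
      ring
    rw [heq, card_insert_of_notMem he]
    refine (abs_add_le _ _).trans ?_
    rw [abs_mul, abs_of_nonneg hd0]
    have := mul_le_of_le_one_left (abs_nonneg (∑ v ∈ Fintype.piFinset Xs,
      P v * ∏ e ∈ E, k e (v e.1) (v e.2) - d ^ #E * ∑ v ∈ Fintype.piFinset Xs, P v)) hd1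
    push_cast
    linarith

end Counting

/-! ### Octahedra over a quasirandom triad -/

section Octahedra

variable {X Y Z : Finset ℕ} {kXY kXZ kYZ : ℕ → ℕ → ℝ} {d τ : ℝ}

lemma sum_piFinset_three (F : (Fin 3 → ℕ) → ℝ) :
    ∑ v ∈ Fintype.piFinset ![X, Y, Z], F v = ∑ x ∈ X, ∑ y ∈ Y, ∑ z ∈ Z, F ![x, y, z] := by
  simp only [← sum_product']
  refine sum_nbij' (fun v => (v 0, v 1, v 2)) (fun p => ![p.1, p.2.1, p.2.2]) ?_ ?_ ?_ ?_ ?_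
  · intro v hv
    rw [Fintype.mem_piFinset] at hv
    simpa [Fin.forall_fin_succ, and_assoc] using hv
  · rintro ⟨x, y, z⟩ hp
    rw [Fintype.mem_piFinset]
    simpa [Fin.forall_fin_succ, and_assoc] using hp
  · intro v _
    ext i; fin_cases i <;> rfl
  · rintro ⟨x, y, z⟩ _; rfl
  · intro v _
    congr 1
    ext i; fin_cases i <;> rfl

lemma sum_piFinset_six (F : (Fin 6 → ℕ) → ℝ) :
    ∑ v ∈ Fintype.piFinset ![X, X, Y, Y, Z, Z], F v =
      ∑ u₀ ∈ X, ∑ u₁ ∈ X, ∑ w₀ ∈ Y, ∑ w₁ ∈ Y, ∑ z₀ ∈ Z, ∑ z₁ ∈ Z,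
        F ![u₀, u₁, w₀, w₁, z₀, z₁] := by
  simp only [← sum_product']
  refine sum_nbij' (fun v => (v 0, v 1, v 2, v 3, v 4, v 5))
    (fun p => ![p.1, p.2.1, p.2.2.1, p.2.2.2.1, p.2.2.2.2.1, p.2.2.2.2.2]) ?_ ?_ ?_ ?_ ?_
  · intro v hv
    rw [Fintype.mem_piFinset] at hv
    simpa [Fin.forall_fin_succ, and_assoc] using hv
  · rintro ⟨x, y, z, x', y', z'⟩ hp
    rw [Fintype.mem_piFinset]
    simpa [Fin.forall_fin_succ, and_assoc] using hp
  · intro v _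
    ext i; fin_cases i <;> rfl
  · rintro ⟨x, y, z, x', y', z'⟩ _; rfl
  · intro v _
    congr 1
    ext i; fin_cases i <;> rfl

lemma sum_triangles_le (hd0 : 0 ≤ d) (hd1 : d ≤ 1)
    (hXY : ∀ x y, |kXY x y| ≤ 1) (hXZ : ∀ x z, |kXZ x z| ≤ 1) (hYZ : ∀ y z, |kYZ y z| ≤ 1)
    (cXY : CutBound X Y (fun x y => kXY x y - d) (τ * (#X * #Y)))
    (cXZ : CutBound X Z (fun x z => kXZ x z - d) (τ * (#X * #Z)))
    (cYZ : CutBound Y Z (fun y z => kYZ y z - d) (τ * (#Y * #Z))) :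
    ∑ x ∈ X, ∑ y ∈ Y, ∑ z ∈ Z, kXY x y * kXZ x z * kYZ y z ≤
      (d ^ 3 + 3 * τ) * (#X * #Y * #Z) := by
  have key := abs_sum_prod_sub_le (Xs := ![X, Y, Z])
    (fun e => if e.2 = 1 then kXY else if e.1 = 0 then kXZ else kYZ) d τ hd0 hd1
    (by intro e x y; split_ifs <;> simp [hXY, hXZ, hYZ]) (fun _ => 1) (by simp)
    {(0, 1), (0, 2), (1, 2)} (by decide) (by decide)
    (by
      intro e he
      simp only [mem_insert, mem_singleton] at he
      rcases he with rfl | rfl | rfl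
      · exact cXY
      · exact cXZ
      · exact cYZ) (by simp)
  rw [show #({(0, 1), (0, 2), (1, 2)} : Finset (Fin 3 × Fin 3)) = 3 by decide] at key
  have hcard : (#(Fintype.piFinset ![X, Y, Z]) : ℝ) = #X * #Y * #Z := by
    rw [Fintype.card_piFinset]; simp [Fin.prod_univ_succ]; ring
  have hP : ∑ v ∈ Fintype.piFinset ![X, Y, Z], (1 : ℝ) = #X * #Y * #Z := by
    rw [sum_const, nsmul_eq_mul, hcard, mul_one]
  have hprod : ∀ v : Fin 3 → ℕ, ∏ e ∈ ({(0, 1), (0, 2), (1, 2)} : Finset (Fin 3 × Fin 3)),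
      (if e.2 = 1 then kXY else if e.1 = 0 then kXZ else kYZ) (v e.1) (v e.2) =
      kXY (v 0) (v 1) * kXZ (v 0) (v 2) * kYZ (v 1) (v 2) := by
    intro v
    rw [prod_insert (by decide), prod_insert (by decide), prod_singleton]
    simp [mul_assoc]
  simp only [hprod, one_mul] at key
  rw [hP, hcard, sum_piFinset_three] at key
  have h2 := (abs_le.1 key).2
  simp only [Matrix.cons_val] at h2
  push_cast at h2
  linarith

lemma sum_octahedra_le (hd0 : 0 ≤ d) (hd1 : d ≤ 1)
    (hXY : ∀ x y, |kXY x y| ≤ 1) (hXZ : ∀ x z, |kXZ x z| ≤ 1) (hYZ : ∀ y z, |kYZ y z| ≤ 1)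
    (cXY : CutBound X Y (fun x y => kXY x y - d) (τ * (#X * #Y)))
    (cXZ : CutBound X Z (fun x z => kXZ x z - d) (τ * (#X * #Z)))
    (cYZ : CutBound Y Z (fun y z => kYZ y z - d) (τ * (#Y * #Z)))
    (ψ : ℕ → ℕ → ℕ → ℝ) (hψ : ∀ x y z, |ψ x y z| ≤ 1) :
    ∑ u₀ ∈ X, ∑ u₁ ∈ X, ∑ w₀ ∈ Y, ∑ w₁ ∈ Y, ∑ z₀ ∈ Z, ∑ z₁ ∈ Z,
      ψ u₀ w₀ z₀ * (kXY u₀ w₁ * kXY u₁ w₀ * kXY u₁ w₁ * (kXZ u₀ z₁ * kXZ u₁ z₀ * kXZ u₁ z₁) *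
        (kYZ w₀ z₁ * kYZ w₁ z₀ * kYZ w₁ z₁)) ≤
      d ^ 9 * (#X * #Y * #Z * ∑ x ∈ X, ∑ y ∈ Y, ∑ z ∈ Z, ψ x y z) +
        9 * (τ * (#X * #Y * #Z) ^ 2) := by
  set E : Finset (Fin 6 × Fin 6) :=
    {(0, 3), (1, 2), (1, 3), (0, 5), (1, 4), (1, 5), (2, 5), (3, 4), (3, 5)} with hE
  have key := abs_sum_prod_sub_le (Xs := ![X, X, Y, Y, Z, Z])
    (fun e => if e.2 < 4 then kXY else if e.1 < 2 then kXZ else kYZ) d τ hd0 hd1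
    (by intro e x y; split_ifs <;> simp [hXY, hXZ, hYZ])
    (fun v => ψ (v 0) (v 2) (v 4)) (fun _ => hψ _ _ _) E (by decide) (by decide)
    (by
      intro e he
      simp only [hE, mem_insert, mem_singleton] at he
      rcases he with rfl | rfl | rfl | rfl | rfl | rfl | rfl | rfl | rfl
      · exact cXY
      · exact cXY
      · exact cXY
      · exact cXZ
      · exact cXZ
      · exact cXZ
      · exact cYZ
      · exact cYZ
      · exact cYZ)
    (by
      intro e he
      simp only [hE, mem_insert, mem_singleton] at he
      rcases he with rfl | rfl | rfl | rfl | rfl | rfl | rfl | rfl | rfl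
      · right; intro v a; simp [Function.update]
      · left; intro v a; simp [Function.update]
      · left; intro v a; simp [Function.update]
      · right; intro v a; simp [Function.update]
      · left; intro v a; simp [Function.update]
      · left; intro v a; simp [Function.update]
      · right; intro v a; simp [Function.update]
      · left; intro v a; simp [Function.update]
      · left; intro v a; simp [Function.update])
  rw [show #E = 9 by decide] at key
  have hcard : (#(Fintype.piFinset ![X, X, Y, Y, Z, Z]) : ℝ) = (#X * #Y * #Z) ^ 2 := by
    rw [Fintype.card_piFinset]; simp [Fin.prod_univ_succ]; ring
  have hprod : ∀ v : Fin 6 → ℕ, ∏ e ∈ E,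
      (if e.2 < 4 then kXY else if e.1 < 2 then kXZ else kYZ) (v e.1) (v e.2) =
      kXY (v 0) (v 3) * kXY (v 1) (v 2) * kXY (v 1) (v 3) *
        (kXZ (v 0) (v 5) * kXZ (v 1) (v 4) * kXZ (v 1) (v 5)) *
        (kYZ (v 2) (v 5) * kYZ (v 3) (v 4) * kYZ (v 3) (v 5)) := by
    intro v
    rw [hE, prod_insert (by decide), prod_insert (by decide), prod_insert (by decide),
      prod_insert (by decide), prod_insert (by decide), prod_insert (by decide),
      prod_insert (by decide), prod_insert (by decide), prod_singleton]
    simp only [show ((3 : Fin 6) < 4) = True by decide, show ((2 : Fin 6) < 4) = True by decide,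
      show ((5 : Fin 6) < 4) = False by decide, show ((4 : Fin 6) < 4) = False by decide,
      show ((0 : Fin 6) < 2) = True by decide, show ((1 : Fin 6) < 2) = True by decide,
      show ((2 : Fin 6) < 2) = False by decide, show ((3 : Fin 6) < 2) = False by decide,
      if_true, if_false]
    ring
  simp only [hprod] at key
  rw [hcard, sum_piFinset_six, sum_piFinset_six] at key
  have h2 := (abs_le.1 key).2
  simp only [Matrix.cons_val] at h2
  push_cast at h2
  have h3 : ∑ u₀ ∈ X, ∑ u₁ ∈ X, ∑ w₀ ∈ Y, ∑ w₁ ∈ Y, ∑ z₀ ∈ Z, ∑ z₁ ∈ Z, ψ u₀ w₀ z₀ =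
      #X * #Y * #Z * ∑ x ∈ X, ∑ y ∈ Y, ∑ z ∈ Z, ψ x y z := by
    simp only [sum_const, nsmul_eq_mul, mul_sum]
    refine sum_congr rfl fun _ _ => sum_congr rfl fun _ _ => sum_congr rfl fun _ _ => by ring
  rw [h3] at h2
  linarith

lemma sum_octahedra_box_le {g : ℕ → ℕ → ℕ → ℝ} {B : ℝ} (hg : BoxBound X Y Z g B)
    (hXY : ∀ x y, |kXY x y| ≤ 1) (hXZ : ∀ x z, |kXZ x z| ≤ 1) (hYZ : ∀ y z, |kYZ y z| ≤ 1)
    (h : ℕ → ℕ → ℕ → ℝ) (hh : ∀ x y z, |h x y z| ≤ 1) :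
    ∑ u₀ ∈ X, ∑ u₁ ∈ X, ∑ w₀ ∈ Y, ∑ w₁ ∈ Y, ∑ z₀ ∈ Z, ∑ z₁ ∈ Z,
      kXY u₀ w₀ * kXZ u₀ z₀ * kYZ w₀ z₀ * g u₀ w₀ z₀ *
        (h u₀ w₀ z₁ * h u₀ w₁ z₀ * h u₀ w₁ z₁ * h u₁ w₀ z₀ * h u₁ w₀ z₁ * h u₁ w₁ z₀ *
          h u₁ w₁ z₁) ≤ #X * #Y * #Z * B := by
  have hm : ∀ a b : ℝ, |a| ≤ 1 → |b| ≤ 1 → |a * b| ≤ 1 := fun a b ha hb => by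
    rw [abs_mul]; exact mul_le_one₀ ha (abs_nonneg _) hb
  have key : ∀ u₁ w₁ z₁, ∑ u₀ ∈ X, ∑ w₀ ∈ Y, ∑ z₀ ∈ Z,
      kXY u₀ w₀ * kXZ u₀ z₀ * kYZ w₀ z₀ * g u₀ w₀ z₀ *
        (h u₀ w₀ z₁ * h u₀ w₁ z₀ * h u₀ w₁ z₁ * h u₁ w₀ z₀ * h u₁ w₀ z₁ * h u₁ w₁ z₀ *
          h u₁ w₁ z₁) ≤ B := by
    intro u₁ w₁ z₁
    refine le_trans (le_of_eq ?_) ((le_abs_self _).trans (hg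
      (fun u₀ w₀ => kXY u₀ w₀ * (h u₀ w₀ z₁ * (h u₀ w₁ z₁ * (h u₁ w₀ z₁ * h u₁ w₁ z₁))))
      (fun u₀ z₀ => kXZ u₀ z₀ * (h u₀ w₁ z₀ * h u₁ w₁ z₀))
      (fun w₀ z₀ => kYZ w₀ z₀ * h u₁ w₀ z₀) ?_ ?_ ?_))
    · exact sum_congr rfl fun _ _ => sum_congr rfl fun _ _ => sum_congr rfl fun _ _ => by ring
    · exact fun x y => hm _ _ (hXY _ _) (hm _ _ (hh _ _ _) (hm _ _ (hh _ _ _)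
        (hm _ _ (hh _ _ _) (hh _ _ _))))
    · exact fun x y => hm _ _ (hXZ _ _) (hm _ _ (hh _ _ _) (hh _ _ _))
    · exact fun x y => hm _ _ (hYZ _ _) (hh _ _ _)
  calc _ = ∑ u₁ ∈ X, ∑ w₁ ∈ Y, ∑ z₁ ∈ Z, ∑ u₀ ∈ X, ∑ w₀ ∈ Y, ∑ z₀ ∈ Z,
      kXY u₀ w₀ * kXZ u₀ z₀ * kYZ w₀ z₀ * g u₀ w₀ z₀ *
        (h u₀ w₀ z₁ * h u₀ w₁ z₀ * h u₀ w₁ z₁ * h u₁ w₀ z₀ * h u₁ w₀ z₁ * h u₁ w₁ z₀ *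
          h u₁ w₁ z₁) := by
        rw [sum_comm]
        refine sum_congr rfl fun u₁ _ => ?_
        refine (sum_congr rfl fun u₀ _ => sum_comm).trans (sum_comm.trans ?_)
        refine sum_congr rfl fun w₁ _ => ?_
        refine (sum_congr rfl fun u₀ _ => ?_).trans sum_comm
        exact (sum_congr rfl fun w₀ _ => sum_comm).trans sum_comm
    _ ≤ ∑ u₁ ∈ X, ∑ w₁ ∈ Y, ∑ z₁ ∈ Z, B :=
        sum_le_sum fun _ _ => sum_le_sum fun _ _ => sum_le_sum fun _ _ => key _ _ _
    _ = _ := by simp only [sum_const, nsmul_eq_mul]; ring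

end Octahedra

/-! ### Criteria for `dev₂` and `dev₂,₃` -/

/-- The indicator function of a set of pairs. -/
noncomputable def edgeInd (E : Finset (ℕ × ℕ)) (x y : ℕ) : ℝ := if (x, y) ∈ E then 1 else 0

lemma edgeInd_nonneg (E : Finset (ℕ × ℕ)) (x y : ℕ) : 0 ≤ edgeInd E x y := by
  unfold edgeInd; split_ifs <;> simp

lemma edgeInd_le_one (E : Finset (ℕ × ℕ)) (x y : ℕ) : edgeInd E x y ≤ 1 := by
  unfold edgeInd; split_ifs <;> simp

lemma abs_edgeInd_le (E : Finset (ℕ × ℕ)) (x y : ℕ) : |edgeInd E x y| ≤ 1 := by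
  rw [abs_of_nonneg (edgeInd_nonneg _ _ _)]; exact edgeInd_le_one _ _ _

lemma sum_edgeInd {E : Finset (ℕ × ℕ)} {X Y : Finset ℕ} (h : E ⊆ X ×ˢ Y) :
    ∑ x ∈ X, ∑ y ∈ Y, edgeInd E x y = #E := by
  rw [← sum_product' (f := edgeInd E)]
  simp only [edgeInd, Prod.mk.eta, sum_boole]
  rw [filter_mem_eq_inter, inter_eq_right.2 h]

theorem Bigraph.dev2_of_cutBound {B : Bigraph} {d τ ε : ℝ} (hl : 0 < #B.left)
    (hr : 0 < #B.right) (hτ : 0 ≤ τ) (hε : 2 * τ ≤ ε)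
    (h : CutBound B.left B.right (fun x y => edgeInd B.edges x y - d)
      (τ * (#B.left * #B.right))) : B.dev2 ε d := by
  have hl' : (0 : ℝ) < #B.left := by exact_mod_cast hl
  have hr' : (0 : ℝ) < #B.right := by exact_mod_cast hr
  have hpos : (0 : ℝ) < #B.left * #B.right := mul_pos hl' hr'
  have hdens : |B.density - d| ≤ τ := by
    have h1 := h.abs_sum_le
    simp only [sum_sub_distrib] at h1
    rw [sum_edgeInd B.edges_sub] at h1
    have h2 : (#B.edges : ℝ) - ∑ x ∈ B.left, ∑ y ∈ B.right, d =
        (B.density - d) * (#B.left * #B.right) := by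
      simp only [sum_const, nsmul_eq_mul, Bigraph.density]
      rw [sub_mul, div_mul_cancel₀ _ hpos.ne']
      ring
    rw [h2, abs_mul, abs_of_pos hpos] at h1
    exact le_of_mul_le_mul_right h1 hpos
  have hd0 : 0 ≤ B.density := by unfold Bigraph.density; positivity
  have hd1 : B.density ≤ 1 := by
    unfold Bigraph.density
    rw [div_le_one hpos]
    have := card_le_card B.edges_sub
    rw [card_product] at this
    exact_mod_cast this
  have hg : CutBound B.left B.right B.gfun (2 * τ * (#B.left * #B.right)) := by
    refine ((h.add (cutBound_const (d - B.density))).mono ?_).congr fun x _ y _ => ?_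
    · rw [abs_sub_comm]
      nlinarith
    · unfold Bigraph.gfun edgeInd
      split_ifs <;> ring
  have hg1 : ∀ x y, |B.gfun x y| ≤ 1 := fun x y => by
    unfold Bigraph.gfun
    split_ifs <;> rw [abs_le] <;> constructor <;> linarith
  refine ⟨hdens.trans (by linarith), ?_⟩
  unfold Bigraph.devSum
  calc _ = ∑ u₁ ∈ B.left, ∑ w₁ ∈ B.right, ∑ u₀ ∈ B.left, ∑ w₀ ∈ B.right,
        B.gfun u₀ w₀ * B.gfun u₀ w₁ * B.gfun u₁ w₀ * B.gfun u₁ w₁ := by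
        rw [sum_comm]
        refine sum_congr rfl fun u₁ _ => ?_
        exact (sum_congr rfl fun u₀ _ => sum_comm).trans sum_comm
    _ ≤ ∑ u₁ ∈ B.left, ∑ w₁ ∈ B.right, 2 * τ * (#B.left * #B.right) := by
        refine sum_le_sum fun u₁ _ => sum_le_sum fun w₁ _ => ?_
        refine le_trans (le_of_eq ?_) ((le_abs_self _).trans (hg (fun u₀ => B.gfun u₀ w₁)
          (fun w₀ => B.gfun u₁ w₀ * B.gfun u₁ w₁) (fun _ => hg1 _ _) fun _ => ?_))
        · exact sum_congr rfl fun _ _ => sum_congr rfl fun _ _ => by ring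
        · rw [abs_mul]; exact mul_le_one₀ (hg1 _ _) (abs_nonneg _) (hg1 _ _)
    _ = 2 * τ * ((#B.left : ℝ) ^ 2 * (#B.right : ℝ) ^ 2) := by
        simp only [sum_const, nsmul_eq_mul]; ring
    _ ≤ ε * ((#B.left : ℝ) ^ 2 * (#B.right : ℝ) ^ 2) :=
        mul_le_mul_of_nonneg_right hε (by positivity)
    _ = _ := by ring

section Dev23

variable {R : Finset (ℕ × ℕ × ℕ)} {G : Triad}

/-- The indicator function of the triangles of a triad. -/
noncomputable def triadInd (G : Triad) (x y z : ℕ) : ℝ :=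
  edgeInd G.EXY x y * edgeInd G.EXZ x z * edgeInd G.EYZ y z

lemma triadInd_nonneg (x y z : ℕ) : 0 ≤ triadInd G x y z :=
  mul_nonneg (mul_nonneg (edgeInd_nonneg _ _ _) (edgeInd_nonneg _ _ _)) (edgeInd_nonneg _ _ _)

lemma triadInd_eq (x y z : ℕ) : triadInd G x y z = if (x, y, z) ∈ G.K3 then 1 else 0 := by
  have h : (x, y, z) ∈ G.K3 ↔ (x, y) ∈ G.EXY ∧ (x, z) ∈ G.EXZ ∧ (y, z) ∈ G.EYZ := by
    simp only [Triad.K3, mem_filter, mem_product]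
    constructor
    · tauto
    · intro h
      have h1 := mem_product.1 (G.hXY h.1)
      have h2 := mem_product.1 (G.hYZ h.2.2)
      tauto
  rw [if_congr h rfl rfl]
  simp only [triadInd, edgeInd]
  split_ifs <;> simp_all

lemma hFun_eq (x y z : ℕ) :
    hFun R G x y z = triadInd G x y z * (tripleInd R (x, y, z) - relDensity R G) := by
  rw [triadInd_eq, hFun, tripleInd]
  split_ifs <;> ring

lemma sum_K3 (F : ℕ × ℕ × ℕ → ℝ) :
    ∑ p ∈ G.K3, F p = ∑ x ∈ G.X, ∑ y ∈ G.Y, ∑ z ∈ G.Z, triadInd G x y z * F (x, y, z) := by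
  have h : G.K3 = {p ∈ G.X ×ˢ G.Y ×ˢ G.Z | p ∈ G.K3} := by
    ext p
    simp only [mem_filter]
    exact ⟨fun h => ⟨(mem_filter.1 h).1, h⟩, fun h => h.2⟩
  rw [h, sum_filter, sum_product]
  refine sum_congr rfl fun x _ => ?_
  rw [sum_product]
  refine sum_congr rfl fun y _ => sum_congr rfl fun z _ => ?_
  rw [triadInd_eq]
  split_ifs <;> simp

lemma relDensity_mem : 0 ≤ relDensity R G ∧ relDensity R G ≤ 1 := by
  refine ⟨by unfold relDensity; positivity, ?_⟩
  unfold relDensity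
  exact div_le_one_of_le₀ (by exact_mod_cast card_le_card inter_subset_right) (by positivity)

lemma relDensity_mul : relDensity R G * #G.K3 = ∑ p ∈ G.K3, tripleInd R p := by
  have h : ∑ p ∈ G.K3, tripleInd R p = #(R ∩ G.K3) := by
    simp only [tripleInd, sum_boole]
    rw [filter_mem_eq_inter, inter_comm]
  rw [h, relDensity]
  rcases eq_or_ne (#G.K3 : ℝ) 0 with h0 | h0
  · have : G.K3 = ∅ := by simpa using h0
    simp [this]
  · exact div_mul_cancel₀ _ h0

/-- If an approximation of `R` is nearly constant on the triangles of a triad, then it is there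
close to the relative density of `R`. -/
lemma sum_abs_sub_relDensity_le {A : ℕ × ℕ × ℕ → ℝ} {p θ B : ℝ}
    (hbox : BoxBound G.X G.Y G.Z (fun x y z => tripleInd R (x, y, z) - A (x, y, z)) B)
    (hA : ∑ w ∈ G.K3, |A w - p| ≤ θ * #G.K3) :
    ∑ w ∈ G.K3, |A w - relDensity R G| ≤ 2 * θ * #G.K3 + B := by
  have h1 : |∑ w ∈ G.K3, (tripleInd R w - A w)| ≤ B := by
    rw [sum_K3]
    refine le_trans (le_of_eq ?_) (hbox (edgeInd G.EXY) (edgeInd G.EXZ) (edgeInd G.EYZ)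
      (abs_edgeInd_le _) (abs_edgeInd_le _) (abs_edgeInd_le _))
    congr 1
    refine sum_congr rfl fun x _ => sum_congr rfl fun y _ => sum_congr rfl fun z _ => ?_
    rw [triadInd]
    ring
  have h2 : |p - relDensity R G| * #G.K3 ≤ θ * #G.K3 + B := by
    have h3 : (p - relDensity R G) * #G.K3 =
        -∑ w ∈ G.K3, (A w - p) - ∑ w ∈ G.K3, (tripleInd R w - A w) := by
      rw [sub_mul, relDensity_mul]
      simp only [sum_sub_distrib, sum_const, nsmul_eq_mul]
      ring
    rw [← abs_of_nonneg (Nat.cast_nonneg (α := ℝ) #G.K3), ← abs_mul, h3,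
      abs_of_nonneg (Nat.cast_nonneg (α := ℝ) #G.K3)]
    refine (abs_sub _ _).trans (add_le_add ?_ h1)
    rw [abs_neg]
    exact (abs_sum_le_sum_abs _ _).trans hA
  calc _ ≤ ∑ w ∈ G.K3, (|A w - p| + |p - relDensity R G|) :=
        sum_le_sum fun w _ => abs_sub_le _ _ _
    _ = ∑ w ∈ G.K3, |A w - p| + |p - relDensity R G| * #G.K3 := by
        rw [sum_add_distrib, sum_const, nsmul_eq_mul, mul_comm]
    _ ≤ _ := by linarith

theorem devSum3_le {A : ℕ × ℕ × ℕ → ℝ} {p θ B d τ : ℝ} (hd0 : 0 ≤ d) (hd1 : d ≤ 1) (hθ : 0 ≤ θ)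
    (hbox : BoxBound G.X G.Y G.Z (fun x y z => tripleInd R (x, y, z) - A (x, y, z)) B)
    (hA0 : ∀ w, 0 ≤ A w) (hA1 : ∀ w, A w ≤ 1)
    (hA : ∑ w ∈ G.K3, |A w - p| ≤ θ * #G.K3)
    (cXY : CutBound G.X G.Y (fun x y => edgeInd G.EXY x y - d) (τ * (#G.X * #G.Y)))
    (cXZ : CutBound G.X G.Z (fun x z => edgeInd G.EXZ x z - d) (τ * (#G.X * #G.Z)))
    (cYZ : CutBound G.Y G.Z (fun y z => edgeInd G.EYZ y z - d) (τ * (#G.Y * #G.Z))) :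
    devSum3 R G ≤ d ^ 9 * (#G.X * #G.Y * #G.Z *
      (2 * θ * ((d ^ 3 + 3 * τ) * (#G.X * #G.Y * #G.Z)) + B)) +
      9 * (τ * (#G.X * #G.Y * #G.Z) ^ 2) + #G.X * #G.Y * #G.Z * B := by
  have hk0 := fun E x y => edgeInd_nonneg E x y
  have hk1 := fun E x y => edgeInd_le_one E x y
  have hD := relDensity_mem (R := R) (G := G)
  have hR : ∀ w, 0 ≤ tripleInd R w ∧ tripleInd R w ≤ 1 := fun w => by
    unfold tripleInd; split_ifs <;> simp
  have habs : ∀ w, |A w - relDensity R G| ≤ 1 := fun w => by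
    have := hA0 w
    have := hA1 w
    rw [abs_le]; constructor <;> linarith [hD.1, hD.2]
  have hh : ∀ x y z, |hFun R G x y z| ≤ triadInd G x y z := fun x y z => by
    rw [hFun_eq, abs_mul, abs_of_nonneg (triadInd_nonneg x y z)]
    refine mul_le_of_le_one_right (triadInd_nonneg x y z) ?_
    rw [abs_le]; constructor <;> linarith [hD.1, hD.2, (hR (x, y, z)).1, (hR (x, y, z)).2]
  have hXYZ1 : ∀ x y z, triadInd G x y z ≤ edgeInd G.EXZ x z * edgeInd G.EYZ y z := fun x y z => by
    unfold triadInd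
    rw [mul_assoc]
    exact mul_le_of_le_one_left (mul_nonneg (hk0 _ _ _) (hk0 _ _ _)) (hk1 _ _ _)
  have hXYZ2 : ∀ x y z, triadInd G x y z ≤ edgeInd G.EXY x y * edgeInd G.EYZ y z := fun x y z => by
    unfold triadInd
    exact mul_le_mul_of_nonneg_right (mul_le_of_le_one_right (hk0 _ _ _) (hk1 _ _ _)) (hk0 _ _ _)
  have hXYZ3 : ∀ x y z, triadInd G x y z ≤ edgeInd G.EXY x y * edgeInd G.EXZ x z := fun x y z => by
    unfold triadInd
    exact mul_le_of_le_one_right (mul_nonneg (hk0 _ _ _) (hk0 _ _ _)) (hk1 _ _ _)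
  have hXYZ4 : ∀ x y z, triadInd G x y z ≤ 1 := fun x y z =>
    (hXYZ1 x y z).trans (mul_le_one₀ (hk1 _ _ _) (hk0 _ _ _) (hk1 _ _ _))
  set ψ : ℕ → ℕ → ℕ → ℝ := fun x y z => triadInd G x y z * |A (x, y, z) - relDensity R G| with hψ
  have hψ0 : ∀ x y z, 0 ≤ ψ x y z := fun x y z => mul_nonneg (triadInd_nonneg _ _ _) (abs_nonneg _)
  have hψ1 : ∀ x y z, |ψ x y z| ≤ 1 := fun x y z => by
    rw [abs_of_nonneg (hψ0 x y z)]
    exact mul_le_one₀ (hXYZ4 _ _ _) (abs_nonneg _) (habs _)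
  have hK3 : (#G.K3 : ℝ) ≤ (d ^ 3 + 3 * τ) * (#G.X * #G.Y * #G.Z) := by
    refine le_trans (le_of_eq ?_) (sum_triangles_le hd0 hd1 (abs_edgeInd_le _) (abs_edgeInd_le _)
      (abs_edgeInd_le _) cXY cXZ cYZ)
    have := sum_K3 (G := G) (fun _ => 1)
    simp only [sum_const, nsmul_eq_mul, mul_one] at this
    exact this
  have hψsum : ∑ x ∈ G.X, ∑ y ∈ G.Y, ∑ z ∈ G.Z, ψ x y z ≤
      2 * θ * ((d ^ 3 + 3 * τ) * (#G.X * #G.Y * #G.Z)) + B := by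
    have h1 := sum_abs_sub_relDensity_le hbox hA
    rw [sum_K3] at h1
    exact h1.trans (by gcongr)
  have hmain : devSum3 R G ≤
      ∑ u₀ ∈ G.X, ∑ u₁ ∈ G.X, ∑ w₀ ∈ G.Y, ∑ w₁ ∈ G.Y, ∑ z₀ ∈ G.Z, ∑ z₁ ∈ G.Z,
        ψ u₀ w₀ z₀ * (edgeInd G.EXY u₀ w₁ * edgeInd G.EXY u₁ w₀ * edgeInd G.EXY u₁ w₁ *
          (edgeInd G.EXZ u₀ z₁ * edgeInd G.EXZ u₁ z₀ * edgeInd G.EXZ u₁ z₁) *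
          (edgeInd G.EYZ w₀ z₁ * edgeInd G.EYZ w₁ z₀ * edgeInd G.EYZ w₁ z₁)) +
      ∑ u₀ ∈ G.X, ∑ u₁ ∈ G.X, ∑ w₀ ∈ G.Y, ∑ w₁ ∈ G.Y, ∑ z₀ ∈ G.Z, ∑ z₁ ∈ G.Z,
        edgeInd G.EXY u₀ w₀ * edgeInd G.EXZ u₀ z₀ * edgeInd G.EYZ w₀ z₀ *
          (tripleInd R (u₀, w₀, z₀) - A (u₀, w₀, z₀)) *
          (hFun R G u₀ w₀ z₁ * hFun R G u₀ w₁ z₀ * hFun R G u₀ w₁ z₁ * hFun R G u₁ w₀ z₀ *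
            hFun R G u₁ w₀ z₁ * hFun R G u₁ w₁ z₀ * hFun R G u₁ w₁ z₁) := by
    simp only [devSum3, ← sum_add_distrib]
    refine sum_le_sum fun u₀ _ => sum_le_sum fun u₁ _ => sum_le_sum fun w₀ _ =>
      sum_le_sum fun w₁ _ =>
      sum_le_sum fun z₀ _ => sum_le_sum fun z₁ _ => ?_
    set r := hFun R G u₀ w₀ z₁ * hFun R G u₀ w₁ z₀ * hFun R G u₀ w₁ z₁ * hFun R G u₁ w₀ z₀ *
      hFun R G u₁ w₀ z₁ * hFun R G u₁ w₁ z₀ * hFun R G u₁ w₁ z₁ with hr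
    have hr1 : |r| ≤ (edgeInd G.EXZ u₀ z₁ * edgeInd G.EYZ w₀ z₁) *
        (edgeInd G.EXY u₀ w₁ * edgeInd G.EYZ w₁ z₀) * 1 *
        (edgeInd G.EXY u₁ w₀ * edgeInd G.EXZ u₁ z₀) * 1 * 1 * triadInd G u₁ w₁ z₁ := by
      have hm : ∀ {a b a' b' : ℝ}, |a| ≤ a' → |b| ≤ b' → |a * b| ≤ a' * b' := fun ha hb => by
        rw [abs_mul]
        exact mul_le_mul ha hb (abs_nonneg _) ((abs_nonneg _).trans ha)
      exact hm (hm (hm (hm (hm (hm ((hh _ _ _).trans (hXYZ1 _ _ _)) ((hh _ _ _).trans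
        (hXYZ2 _ _ _))) ((hh _ _ _).trans (hXYZ4 _ _ _))) ((hh _ _ _).trans (hXYZ3 _ _ _)))
        ((hh _ _ _).trans (hXYZ4 _ _ _))) ((hh _ _ _).trans (hXYZ4 _ _ _))) (hh _ _ _)
    calc _ = hFun R G u₀ w₀ z₀ * r := by rw [hr]; ring
      _ = triadInd G u₀ w₀ z₀ * (A (u₀, w₀, z₀) - relDensity R G) * r +
          triadInd G u₀ w₀ z₀ * (tripleInd R (u₀, w₀, z₀) - A (u₀, w₀, z₀)) * r := by
          rw [hFun_eq]; ring
      _ ≤ ψ u₀ w₀ z₀ * |r| +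
          triadInd G u₀ w₀ z₀ * (tripleInd R (u₀, w₀, z₀) - A (u₀, w₀, z₀)) * r := by
          gcongr ?_ + _
          refine (le_abs_self _).trans (le_of_eq ?_)
          rw [abs_mul, abs_mul, abs_of_nonneg (triadInd_nonneg _ _ _)]
      _ ≤ _ := by
          refine add_le_add (mul_le_mul_of_nonneg_left (hr1.trans (le_of_eq ?_)) (hψ0 _ _ _))
            (le_of_eq ?_)
          · rw [triadInd]; ring
          · rw [triadInd]
  refine hmain.trans (add_le_add ((sum_octahedra_le hd0 hd1 (abs_edgeInd_le _) (abs_edgeInd_le _)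
    (abs_edgeInd_le _) cXY cXZ cYZ ψ hψ1).trans ?_)
    (sum_octahedra_box_le (g := fun x y z => tripleInd R (x, y, z) - A (x, y, z)) hbox
      (abs_edgeInd_le _) (abs_edgeInd_le _) (abs_edgeInd_le _) (hFun R G)
      fun x y z => (hh x y z).trans (hXYZ4 x y z)))
  gcongr

/-- The criterion for `dev₂,₃` used in the regularity lemma. -/
theorem dev23_of_bounds {A : ℕ × ℕ × ℕ → ℝ} {p θ B d τ ε₁ ε₂ : ℝ} (hd0 : 0 < d) (hd1 : d ≤ 1)
    (hX : 0 < #G.X) (hY : 0 < #G.Y) (hZ : 0 < #G.Z)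
    (hbox : BoxBound G.X G.Y G.Z (fun x y z => tripleInd R (x, y, z) - A (x, y, z)) B)
    (hA0 : ∀ w, 0 ≤ A w) (hA1 : ∀ w, A w ≤ 1)
    (hA : ∑ w ∈ G.K3, |A w - p| ≤ θ * #G.K3)
    (cXY : CutBound G.X G.Y (fun x y => edgeInd G.EXY x y - d) (τ * (#G.X * #G.Y)))
    (cXZ : CutBound G.X G.Z (fun x z => edgeInd G.EXZ x z - d) (τ * (#G.X * #G.Z)))
    (cYZ : CutBound G.Y G.Z (fun y z => edgeInd G.EYZ y z - d) (τ * (#G.Y * #G.Z)))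
    (hθ0 : 0 ≤ θ) (hθ1 : θ ≤ 1) (hθ : 8 * θ ≤ ε₁) (hτ0 : 0 ≤ τ) (hτ : 60 * τ ≤ ε₁ * d ^ 12)
    (hτ' : 2 * τ ≤ ε₂) (hB0 : 0 ≤ B) (hB : 8 * B ≤ ε₁ * d ^ 12 * (#G.X * #G.Y * #G.Z)) :
    dev23 R G ε₁ ε₂ := by
  refine ⟨d, d, d, hd0, hd0, hd0, Bigraph.dev2_of_cutBound hX hY hτ0 hτ' cXY,
    Bigraph.dev2_of_cutBound hX hZ hτ0 hτ' cXZ, Bigraph.dev2_of_cutBound hY hZ hτ0 hτ' cYZ, ?_⟩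
  refine (devSum3_le hd0.le hd1 hθ0 hbox hA0 hA1 hA cXY cXZ cYZ).trans ?_
  have h0 : (0 : ℝ) ≤ #G.X * #G.Y * #G.Z := by positivity
  rw [show ε₁ * d ^ 4 * d ^ 4 * d ^ 4 * (#G.X : ℝ) ^ 2 * (#G.Y : ℝ) ^ 2 * (#G.Z : ℝ) ^ 2 =
    ε₁ * d ^ 12 * (#G.X * #G.Y * #G.Z) ^ 2 by ring]
  generalize (#G.X : ℝ) * #G.Y * #G.Z = N at *
  have hd9 : d ^ 9 ≤ 1 := pow_le_one₀ hd0.le hd1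
  have hd12 : 0 ≤ d ^ 12 := by positivity
  have h1 : d ^ 9 * B ≤ B := mul_le_of_le_one_left hB0 hd9
  have h2 : d ^ 9 * (θ * τ) ≤ τ :=
    (mul_le_of_le_one_left (by positivity) hd9).trans (mul_le_of_le_one_left hτ0 hθ1)
  have h3 : 8 * θ * d ^ 12 ≤ ε₁ * d ^ 12 := mul_le_mul_of_nonneg_right hθ hd12
  calc d ^ 9 * (N * (2 * θ * ((d ^ 3 + 3 * τ) * N) + B)) + 9 * (τ * N ^ 2) + N * B
      = (2 * (θ * d ^ 12) + 6 * (d ^ 9 * (θ * τ)) + 9 * τ) * N ^ 2 + N * (d ^ 9 * B + B) := by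
        ring
    _ ≤ (2 * (θ * d ^ 12) + 6 * τ + 9 * τ) * N ^ 2 + N * (B + B) := by gcongr
    _ ≤ (ε₁ * d ^ 12 / 2) * N ^ 2 + N * (ε₁ * d ^ 12 * N / 4) := by
        gcongr <;> linarith
    _ ≤ _ := by
        have : 0 ≤ ε₁ * d ^ 12 := le_trans (by positivity) hτ
        nlinarith [mul_nonneg this (sq_nonneg N)]

end Dev23

/-! ### Grouping colours into classes of nearly equal weight -/

/-- The index of the interval `[i/ℓ, (i+1)/ℓ)` containing the total weight of the colours
preceding `k`. -/
noncomputable def tile (p : ℕ → ℝ) (ℓ k : ℕ) : ℕ := ⌊(ℓ : ℝ) * ∑ j ∈ range k, p j⌋₊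

section Tile

variable {p : ℕ → ℝ} {ℓ : ℕ}

lemma tile_mono (h0 : ∀ k, 0 ≤ p k) : Monotone (tile p ℓ) := fun a b hab => by
  refine Nat.floor_le_floor (mul_le_mul_of_nonneg_left ?_ (Nat.cast_nonneg ℓ))
  exact sum_le_sum_of_subset_of_nonneg (range_mono hab) fun k _ _ => h0 k

lemma sum_initial_mem (h0 : ∀ k, 0 ≤ p k) {r : ℝ} (hr : ∀ k, p k ≤ r) (N : ℕ) (u : ℝ) :
    min u (∑ k ∈ range N, p k) ≤
        ∑ k ∈ range N, (if ∑ j ∈ range k, p j < u then p k else 0) ∧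
      ∑ k ∈ range N, (if ∑ j ∈ range k, p j < u then p k else 0) ≤ max 0 (u + r) ∧
      ∑ k ∈ range N, (if ∑ j ∈ range k, p j < u then p k else 0) ≤ ∑ k ∈ range N, p k := by
  induction N with
  | zero => simp
  | succ N ih =>
    obtain ⟨h1, h2, h3⟩ := ih
    simp only [sum_range_succ]
    have h4 := h0 N
    have h5 := hr N
    split_ifs with h
    · rw [min_eq_right h.le] at h1
      exact ⟨(min_le_right _ _).trans (by linarith), le_max_of_le_right (by linarith), by linarith⟩
    · rw [min_eq_left (not_lt.1 h)] at h1
      exact ⟨(min_le_left _ _).trans (by linarith), by linarith, by linarith⟩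

lemma abs_sum_tile_sub_le (h0 : ∀ k, 0 ≤ p k) {r : ℝ} (hr : ∀ k, p k ≤ r) {M : ℕ}
    (hM : ∑ k ∈ range M, p k = 1) (hℓ : 0 < ℓ) {i : ℕ} (hi : i < ℓ) :
    |∑ k ∈ range M with tile p ℓ k = i, p k - 1 / ℓ| ≤ r := by
  have hℓ' : (0 : ℝ) < ℓ := by exact_mod_cast hℓ
  have hi' : (i : ℝ) + 1 ≤ ℓ := by exact_mod_cast hi
  have hr0 : 0 ≤ r := (h0 0).trans (hr 0)
  have hS : ∀ k, 0 ≤ ∑ j ∈ range k, p j := fun k => sum_nonneg fun j _ => h0 j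
  have hsplit : ∑ k ∈ range M with tile p ℓ k = i, p k =
      ∑ k ∈ range M, (if ∑ j ∈ range k, p j < ((i : ℝ) + 1) / ℓ then p k else 0) -
      ∑ k ∈ range M, (if ∑ j ∈ range k, p j < (i : ℝ) / ℓ then p k else 0) := by
    rw [sum_filter, ← sum_sub_distrib]
    refine sum_congr rfl fun k _ => ?_
    have hiff : tile p ℓ k = i ↔
        ¬ ∑ j ∈ range k, p j < (i : ℝ) / ℓ ∧ ∑ j ∈ range k, p j < ((i : ℝ) + 1) / ℓ := by
      rw [tile, Nat.floor_eq_iff (mul_nonneg hℓ'.le (hS k)), lt_div_iff₀ hℓ', lt_div_iff₀ hℓ',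
        mul_comm (ℓ : ℝ), not_lt]
    have himp : ∑ j ∈ range k, p j < (i : ℝ) / ℓ → ∑ j ∈ range k, p j < ((i : ℝ) + 1) / ℓ :=
      fun h => h.trans (by gcongr; linarith)
    rw [if_congr hiff rfl rfl]
    split_ifs <;> simp_all
  obtain ⟨h1, h2, h3⟩ := sum_initial_mem h0 hr M (((i : ℝ) + 1) / ℓ)
  obtain ⟨h4, h5, h6⟩ := sum_initial_mem h0 hr M ((i : ℝ) / ℓ)
  have hu : ((i : ℝ) + 1) / ℓ = i / ℓ + 1 / ℓ := add_div _ _ _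
  have hu1 : ((i : ℝ) + 1) / ℓ ≤ 1 := (div_le_one hℓ').2 hi'
  have hl0 : 0 < 1 / (ℓ : ℝ) := by positivity
  have hi0 : 0 ≤ (i : ℝ) / ℓ := by positivity
  rw [hM] at h1 h4
  rw [max_eq_right (by linarith)] at h2 h5
  rw [min_eq_left (by linarith)] at h1 h4
  rw [hsplit, abs_le]
  constructor <;> linarith

lemma tile_lt (h0 : ∀ k, 0 ≤ p k) {M k : ℕ} (hM : ∑ k ∈ range M, p k = 1) (hℓ : 0 < ℓ)
    (hk : k < M) (hpk : 0 < p k) : tile p ℓ k < ℓ := by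
  have hℓ' : (0 : ℝ) < ℓ := by exact_mod_cast hℓ
  have h1 : ∑ j ∈ range (k + 1), p j ≤ 1 := by
    rw [← hM]
    exact sum_le_sum_of_subset_of_nonneg (range_mono hk) fun k _ _ => h0 k
  rw [sum_range_succ] at h1
  rw [tile, Nat.floor_lt (mul_nonneg hℓ'.le (sum_nonneg fun j _ => h0 j))]
  nlinarith

end Tile

/-- The weights of the refined colours `f * q + ρ` on `X × Y`. -/
noncomputable def refinedWeight (f : ℕ → ℕ → ℕ) (q : ℕ) (X Y : Finset ℕ) (k : ℕ) : ℝ :=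
  colorDens f (k / q) X Y / q

/-- The class of a pair, for the grouping of the refined colours on `X × Y`. -/
noncomputable def pairClass (f ρ : ℕ → ℕ → ℕ) (q ℓ : ℕ) (X Y : Finset ℕ) (x y : ℕ) : ℕ :=
  tile (refinedWeight f q X Y) ℓ (f x y * q + ρ x y)

section PairClass

variable {f ρ : ℕ → ℕ → ℕ} {m q ℓ : ℕ} {X Y : Finset ℕ}

lemma colorDens_nonneg (α : ℕ) : 0 ≤ colorDens f α X Y := by
  unfold colorDens; positivity

lemma refinedWeight_nonneg (k : ℕ) : 0 ≤ refinedWeight f q X Y k :=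
  div_nonneg (colorDens_nonneg _) (Nat.cast_nonneg _)

lemma colorDens_le_one (α : ℕ) : colorDens f α X Y ≤ 1 := by
  refine div_le_one_of_le₀ ?_ (by positivity)
  calc _ ≤ ∑ x ∈ X, ∑ y ∈ Y, (1 : ℝ) :=
        sum_le_sum fun x _ => sum_le_sum fun y _ => by split_ifs <;> simp
    _ = _ := by simp

lemma refinedWeight_le (k : ℕ) : refinedWeight f q X Y k ≤ 1 / q :=
  div_le_div_of_nonneg_right (colorDens_le_one _) (Nat.cast_nonneg _)

lemma sum_colorDens (hf : ∀ x y, f x y < m) (hX : X.Nonempty) (hY : Y.Nonempty) :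
    ∑ α ∈ range m, colorDens f α X Y = 1 := by
  have hX' : (0 : ℝ) < #X := by exact_mod_cast hX.card_pos
  have hY' : (0 : ℝ) < #Y := by exact_mod_cast hY.card_pos
  unfold colorDens
  rw [← sum_div, sum_comm, div_eq_one_iff_eq (mul_pos hX' hY').ne']
  calc _ = ∑ x ∈ X, ∑ y ∈ Y, (1 : ℝ) := by
        refine sum_congr rfl fun x _ => ?_
        rw [sum_comm]
        refine sum_congr rfl fun y _ => ?_
        rw [sum_ite_eq, if_pos (mem_range.2 (hf x y))]
    _ = _ := by simp

lemma sum_range_mul (F : ℕ → ℝ) (hq : 0 < q) :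
    ∑ k ∈ range (m * q), F (k / q) = q * ∑ α ∈ range m, F α := by
  induction m with
  | zero => simp
  | succ m ih =>
    rw [add_mul, one_mul, sum_range_add, ih, sum_range_succ, mul_add]
    congr 1
    rw [sum_congr rfl (g := fun _ => F m)]
    · simp
    · intro c hc
      rw [mul_comm m q, Nat.mul_add_div hq, Nat.div_eq_of_lt (mem_range.1 hc), add_zero]

lemma sum_refinedWeight (hf : ∀ x y, f x y < m) (hq : 0 < q) (hX : X.Nonempty)
    (hY : Y.Nonempty) : ∑ k ∈ range (m * q), refinedWeight f q X Y k = 1 := by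
  have hq' : (q : ℝ) ≠ 0 := by positivity
  unfold refinedWeight
  rw [sum_range_mul (fun α => colorDens f α X Y / q) hq, ← sum_div, sum_colorDens hf hX hY]
  field_simp

lemma mul_add_eq_iff (hρ : ∀ x y, ρ x y < q) (x y k : ℕ) :
    f x y * q + ρ x y = k ↔ f x y = k / q ∧ ρ x y = k % q := by
  have hq : 0 < q := (Nat.zero_le _).trans_lt (hρ x y)
  constructor
  · rintro rfl
    rw [mul_comm, Nat.mul_add_div hq, Nat.div_eq_of_lt (hρ x y), Nat.mul_add_mod,
      Nat.mod_eq_of_lt (hρ x y)]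
    simp
  · rintro ⟨h1, h2⟩
    rw [h1, h2, mul_comm]
    exact Nat.div_add_mod k q

lemma mul_add_lt (hf : ∀ x y, f x y < m) (hρ : ∀ x y, ρ x y < q) (x y : ℕ) :
    f x y * q + ρ x y < m * q :=
  calc _ < f x y * q + q := Nat.add_lt_add_left (hρ x y) _
    _ = (f x y + 1) * q := by ring
    _ ≤ _ := Nat.mul_le_mul_right q (hf x y)

lemma cutBound_refined {τ B : ℝ} (hρ : ∀ x y, ρ x y < q) (hq : 0 < q)
    (hreg : RegPair f m τ X Y)
    (hcut : ∀ α < m, ∀ c < q, CutBound X Y (fun x y => (if f x y = α then 1 else 0) *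
      ((if ρ x y = c then 1 else 0) - 1 / (q : ℝ))) B) {k : ℕ} (hk : k < m * q) :
    CutBound X Y (fun x y => (if f x y * q + ρ x y = k then 1 else 0) - refinedWeight f q X Y k)
      (B + τ * (#X * #Y)) := by
  have hα : k / q < m := (Nat.div_lt_iff_lt_mul hq).2 hk
  have hq1 : |1 / (q : ℝ)| ≤ 1 := by
    rw [abs_of_nonneg (by positivity)]
    exact div_le_one_of_le₀ (by exact_mod_cast hq) (by positivity)
  refine (((hcut _ hα _ (Nat.mod_lt k hq)).add ((hreg _ hα).const_mul (1 / q))).mono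
    (add_le_add le_rfl (mul_le_of_le_one_left (hreg _ hα).nonneg hq1))).congr fun x _ y _ => ?_
  rw [if_congr (mul_add_eq_iff hρ x y k) rfl rfl, refinedWeight, ite_and]
  split_ifs <;> ring

/-- The classes are quasirandom of density close to `1 / ℓ`. -/
theorem cutBound_pairClass {τ B : ℝ} (hf : ∀ x y, f x y < m) (hρ : ∀ x y, ρ x y < q)
    (hq : 0 < q) (hX : X.Nonempty) (hY : Y.Nonempty) (hreg : RegPair f m τ X Y)
    (hcut : ∀ α < m, ∀ c < q, CutBound X Y (fun x y => (if f x y = α then 1 else 0) *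
      ((if ρ x y = c then 1 else 0) - 1 / (q : ℝ))) B) {i : ℕ} (hi : i < ℓ) :
    CutBound X Y (fun x y => (if pairClass f ρ q ℓ X Y x y = i then 1 else 0) - 1 / (ℓ : ℝ))
      (m * q * (B + τ * (#X * #Y)) + 1 / q * (#X * #Y)) := by
  have hw := abs_sum_tile_sub_le (refinedWeight_nonneg (f := f) (q := q) (X := X) (Y := Y))
    (refinedWeight_le (f := f) (q := q) (X := X) (Y := Y)) (sum_refinedWeight hf hq hX hY)
    ((Nat.zero_le i).trans_lt hi) hi
  set S := (range (m * q)).filter fun k => tile (refinedWeight f q X Y) ℓ k = i with hS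
  have h1 := CutBound.sum (X := X) (Y := Y) (s := S)
    (G := fun k x y => (if f x y * q + ρ x y = k then 1 else 0) - refinedWeight f q X Y k)
    (B := B + τ * (#X * #Y)) fun k hk =>
      cutBound_refined hρ hq hreg hcut (mem_range.1 (mem_filter.1 hk).1)
  have hSc : (#S : ℝ) ≤ m * q := by
    have := card_filter_le (range (m * q)) fun k => tile (refinedWeight f q X Y) ℓ k = i
    rw [card_range] at this
    exact_mod_cast this
  have hB0 : 0 ≤ B + τ * (#X * #Y) := by
    have hm : 0 < m := (Nat.zero_le _).trans_lt (hf 0 0)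
    exact (cutBound_refined hρ hq hreg hcut (k := 0) (Nat.mul_pos hm hq)).nonneg
  refine ((h1.add (cutBound_const (∑ k ∈ S, refinedWeight f q X Y k - 1 / ℓ))).mono
    (add_le_add (mul_le_mul_of_nonneg_right hSc hB0)
      (mul_le_mul_of_nonneg_right hw (by positivity)))).congr fun x _ y _ => ?_
  rw [sum_sub_distrib, sum_ite_eq]
  have hmem : f x y * q + ρ x y ∈ S ↔ pairClass f ρ q ℓ X Y x y = i := by
    rw [hS, mem_filter, mem_range, pairClass]
    exact and_iff_right (mul_add_lt hf hρ x y)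
  rw [if_congr hmem rfl rfl]
  ring

lemma pairClass_lt (hf : ∀ x y, f x y < m) (hρ : ∀ x y, ρ x y < q) (hq : 0 < q) (hℓ : 0 < ℓ)
    {x y : ℕ} (hx : x ∈ X) (hy : y ∈ Y) : pairClass f ρ q ℓ X Y x y < ℓ := by
  refine tile_lt refinedWeight_nonneg (sum_refinedWeight hf hq ⟨x, hx⟩ ⟨y, hy⟩) hℓ
    (mul_add_lt hf hρ x y) ?_
  have hX' : (0 : ℝ) < #X := by exact_mod_cast card_pos.2 ⟨x, hx⟩
  have hY' : (0 : ℝ) < #Y := by exact_mod_cast card_pos.2 ⟨y, hy⟩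
  rw [refinedWeight, ← ((mul_add_eq_iff hρ x y _).1 rfl).1, colorDens]
  refine div_pos (div_pos ?_ (mul_pos hX' hY')) (by exact_mod_cast hq)
  have h0 : ∀ x' ∈ X, (0 : ℝ) ≤ ∑ y' ∈ Y, if f x' y' = f x y then 1 else 0 :=
    fun x' _ => sum_nonneg fun y' _ => by split_ifs <;> simp
  refine lt_of_lt_of_le ?_ (single_le_sum h0 hx)
  refine lt_of_lt_of_le ?_ (single_le_sum (fun y' _ => by split_ifs <;> simp) hy)
  simp

/-- A class which may contain pairs of several colours. -/
def MixedClass (f : ℕ → ℕ → ℕ) (m q ℓ : ℕ) (X Y : Finset ℕ) (i : ℕ) : Prop :=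
  ∃ α < m, tile (refinedWeight f q X Y) ℓ (α * q) = i

lemma color_eq_of_not_mixedClass (hf : ∀ x y, f x y < m) (hρ : ∀ x y, ρ x y < q)
    {x y x' y' : ℕ} (h : pairClass f ρ q ℓ X Y x y = pairClass f ρ q ℓ X Y x' y')
    (hi : ¬ MixedClass f m q ℓ X Y (pairClass f ρ q ℓ X Y x y)) : f x y = f x' y' := by
  have key : ∀ x y x' y', pairClass f ρ q ℓ X Y x y = pairClass f ρ q ℓ X Y x' y' →
      f x y < f x' y' → MixedClass f m q ℓ X Y (pairClass f ρ q ℓ X Y x y) := by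
    intro x y x' y' h hlt
    have hmono := tile_mono (ℓ := ℓ) (refinedWeight_nonneg (f := f) (q := q) (X := X) (Y := Y))
    refine ⟨f x' y', hf _ _, le_antisymm ?_ ?_⟩
    · rw [h]
      exact hmono (Nat.le_add_right _ _)
    · refine hmono ?_
      calc f x y * q + ρ x y ≤ f x y * q + q := Nat.add_le_add_left (hρ x y).le _
        _ = (f x y + 1) * q := by ring
        _ ≤ _ := Nat.mul_le_mul_right q hlt
  rcases lt_trichotomy (f x y) (f x' y') with h1 | h1 | h1
  · exact absurd (key x y x' y' h h1) hi
  · exact h1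
  · exact absurd (h ▸ key x' y' x y h.symm h1) hi

lemma card_mixedClass_le {τ : ℝ} (hf : ∀ x y, f x y < m) (hρ : ∀ x y, ρ x y < q) (hq : 0 < q)
    (hℓ : 0 < ℓ) (hτ : 0 ≤ τ) (hcut : ∀ i < ℓ, CutBound X Y
      (fun x y => (if pairClass f ρ q ℓ X Y x y = i then 1 else 0) - 1 / (ℓ : ℝ))
      (τ * (#X * #Y))) :
    (#{p ∈ X ×ˢ Y | MixedClass f m q ℓ X Y (pairClass f ρ q ℓ X Y p.1 p.2)} : ℝ) ≤
      m * ((1 / ℓ + τ) * (#X * #Y)) := by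
  have hclass : ∀ i, (#{p ∈ X ×ˢ Y | pairClass f ρ q ℓ X Y p.1 p.2 = i} : ℝ) ≤
      (1 / ℓ + τ) * (#X * #Y) := by
    intro i
    rcases lt_or_ge i ℓ with hi | hi
    · have h1 := (abs_le.1 (hcut i hi).abs_sum_le).2
      simp only [sum_sub_distrib, sum_const, nsmul_eq_mul] at h1
      have h2 : (#{p ∈ X ×ˢ Y | pairClass f ρ q ℓ X Y p.1 p.2 = i} : ℝ) =
          ∑ x ∈ X, ∑ y ∈ Y, if pairClass f ρ q ℓ X Y x y = i then 1 else 0 := by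
        rw [← sum_boole, sum_product]
      rw [h2]
      linarith
    · rw [filter_false_of_mem]
      · simpa using by positivity
      · intro p hp h
        rw [mem_product] at hp
        exact absurd (pairClass_lt hf hρ hq hℓ hp.1 hp.2) (by omega)
  have hsub : {p ∈ X ×ˢ Y | MixedClass f m q ℓ X Y (pairClass f ρ q ℓ X Y p.1 p.2)} ⊆
      (range m).biUnion fun α => {p ∈ X ×ˢ Y | pairClass f ρ q ℓ X Y p.1 p.2 =
        tile (refinedWeight f q X Y) ℓ (α * q)} := by
    intro p hp
    rw [mem_filter] at hp
    obtain ⟨hp, α, hα, h⟩ := hp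
    exact mem_biUnion.2 ⟨α, mem_range.2 hα, mem_filter.2 ⟨hp, h.symm⟩⟩
  calc _ ≤ ((∑ α ∈ range m, #{p ∈ X ×ˢ Y | pairClass f ρ q ℓ X Y p.1 p.2 =
        tile (refinedWeight f q X Y) ℓ (α * q)} : ℕ) : ℝ) := by
        exact_mod_cast (card_le_card hsub).trans card_biUnion_le
    _ ≤ ∑ α ∈ range m, (1 / ℓ + τ) * (#X * #Y) := by
        push_cast
        exact sum_le_sum fun α _ => hclass _
    _ = _ := by rw [sum_const, card_range, nsmul_eq_mul]

end PairClass

/-! ### Decompositions from colourings of vertices and pairs -/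

/-- The decomposition whose parts are the classes of `c` and whose bigraphs are the classes
of `g`. -/
noncomputable def Decomp.ofColoring {V : Finset ℕ} {t ℓ : ℕ} (c : ℕ → Fin t) (g : ℕ → ℕ → ℕ)
    (hg : ∀ x ∈ V, ∀ y ∈ V, g x y < ℓ) : Decomp V (Fin t) (Fin ℓ) where
  part i := {x ∈ V | c x = i}
  part_sub i := filter_subset _ _
  part_disj i j hij := disjoint_filter.2 fun x _ h h' => hij (h.symm.trans h')
  part_cover x hx := ⟨c x, mem_filter.2 ⟨hx, rfl⟩⟩
  pairs i j α := {p ∈ {x ∈ V | c x = i} ×ˢ {x ∈ V | c x = j} | g p.1 p.2 = α}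
  pairs_sub i j α := filter_subset _ _
  pairs_disj i j α β hαβ := disjoint_filter.2 fun x _ h h' => hαβ (Fin.ext (h.symm.trans h'))
  pairs_cover i j p hp := by
    have h := mem_product.1 hp
    exact ⟨⟨g p.1 p.2, hg _ (mem_filter.1 h.1).1 _ (mem_filter.1 h.2).1⟩,
      mem_filter.2 ⟨hp, rfl⟩⟩

/-- All the first `ℓ` colours of `g` are quasirandom of density `1 / ℓ` between `X` and `Y`. -/
def UniformPair (g : ℕ → ℕ → ℕ) (ℓ : ℕ) (τ : ℝ) (X Y : Finset ℕ) : Prop :=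
  ∀ α < ℓ, CutBound X Y (fun x y => (if g x y = α then 1 else 0) - 1 / (ℓ : ℝ)) (τ * (#X * #Y))

lemma Decomp.isReg_of_isEquitable {V : Finset ℕ} {ι κ : Type} [Fintype κ] {P : Decomp V ι κ}
    {ε₁ ε₂ : ℝ} (hε₂ : 0 ≤ ε₂) (h : P.isEquitable ε₁ ε₂) : P.isReg ε₁ ε₂ := by
  refine h.2.trans (Nat.cast_le.2 (card_le_card ?_))
  refine monotone_filter_right _ fun p _ => ?_
  rintro ⟨i, j, α, hp, hd⟩
  exact ⟨i, j, α, hp, by simpa using hε₂, hd.2⟩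

lemma one_sub_mul_le_card_filter {β : Type*} {Ω : Finset β} {P Q : β → Prop} {ε N : ℝ}
    (hN : #Ω = N) (hbad : #{w ∈ Ω | ¬ Q w} ≤ ε * N) (hQ : ∀ w ∈ Ω, Q w → P w) :
    (1 - ε) * N ≤ #{w ∈ Ω | P w} := by
  have h1 : (#{w ∈ Ω | Q w} : ℝ) + #{w ∈ Ω | ¬ Q w} = N := by
    rw [← hN]; exact_mod_cast card_filter_add_card_filter_not (s := Ω) Q
  have h2 : (#{w ∈ Ω | Q w} : ℝ) ≤ #{w ∈ Ω | P w} :=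
    Nat.cast_le.2 (card_le_card (monotone_filter_right _ hQ))
  linarith

section OfColoring

variable {V : Finset ℕ} {t ℓ : ℕ} {c : ℕ → Fin t} {g : ℕ → ℕ → ℕ}
  {hg : ∀ x ∈ V, ∀ y ∈ V, g x y < ℓ} {τ ε₁ ε₂ : ℝ}

lemma UniformPair.cutBound {i j : Fin t} (h : UniformPair g ℓ τ {x ∈ V | c x = i} {x ∈ V | c x = j})
    (hg : ∀ x ∈ V, ∀ y ∈ V, g x y < ℓ) (α : Fin ℓ) : CutBound {x ∈ V | c x = i} {x ∈ V | c x = j}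
      (fun x y => edgeInd ((Decomp.ofColoring c g hg).pairs i j α) x y - 1 / (ℓ : ℝ))
      (τ * (#{x ∈ V | c x = i} * #{x ∈ V | c x = j})) := by
  refine (h α α.2).congr fun x hx y hy => ?_
  rw [edgeInd]
  congr 1
  refine if_congr ?_ rfl rfl
  rw [Decomp.ofColoring, mem_filter, mem_product]
  exact ⟨fun h => ⟨⟨hx, hy⟩, h⟩, fun h => h.2⟩

lemma Decomp.isEquitable_ofColoring
    (hc : ∀ i j, #{x ∈ V | c x = i} ≤ #{x ∈ V | c x = j} + 1) (hτ0 : 0 ≤ τ) (hτ : 2 * τ ≤ ε₂)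
    (hbad : #{p ∈ V ×ˢ V | ¬ UniformPair g ℓ τ {x ∈ V | c x = c p.1} {x ∈ V | c x = c p.2}}
      ≤ ε₁ * #V ^ 2) : (Decomp.ofColoring c g hg).isEquitable ε₁ ε₂ := by
  refine ⟨hc, one_sub_mul_le_card_filter (by rw [card_product]; push_cast; ring) hbad
    fun p hp h => ?_⟩
  obtain ⟨hx, hy⟩ := mem_product.1 hp
  have hx' : p.1 ∈ {x ∈ V | c x = c p.1} := mem_filter.2 ⟨hx, rfl⟩
  have hy' : p.2 ∈ {x ∈ V | c x = c p.2} := mem_filter.2 ⟨hy, rfl⟩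
  refine ⟨c p.1, c p.2, ⟨g p.1 p.2, hg _ hx _ hy⟩,
    mem_filter.2 ⟨mem_product.2 ⟨hx', hy'⟩, rfl⟩, ?_⟩
  rw [Fintype.card_fin]
  exact Bigraph.dev2_of_cutBound (card_pos.2 ⟨_, hx'⟩) (card_pos.2 ⟨_, hy'⟩) hτ0 hτ
    (h.cutBound hg _)

lemma card_filter_triple_le (S : ℕ → ℕ → Prop) {b : ℝ} (hb : #{p ∈ V ×ˢ V | S p.1 p.2} ≤ b) :
    (#{w ∈ V ×ˢ V ×ˢ V | S w.1 w.2.1 ∨ S w.1 w.2.2 ∨ S w.2.1 w.2.2} : ℝ) ≤ 3 * (b * #V) := by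
  have key : ∀ (A : Finset (ℕ × ℕ × ℕ)) (φ : ℕ × ℕ × ℕ → (ℕ × ℕ) × ℕ),
      (∀ w ∈ A, φ w ∈ {p ∈ V ×ˢ V | S p.1 p.2} ×ˢ V) → Function.Injective φ →
      (#A : ℝ) ≤ b * #V := fun A φ h1 h2 => by
    have h3 := card_le_card_of_injOn φ h1 h2.injOn
    rw [card_product] at h3
    have h4 : (#A : ℝ) ≤ #{p ∈ V ×ˢ V | S p.1 p.2} * #V := by exact_mod_cast h3
    exact h4.trans (mul_le_mul_of_nonneg_right hb (Nat.cast_nonneg _))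
  have h1 := key {w ∈ V ×ˢ V ×ˢ V | S w.1 w.2.1} (fun w => ((w.1, w.2.1), w.2.2))
    (fun w hw => by simp only [mem_filter, mem_product] at hw ⊢; tauto)
    (fun v w h => by simp only [Prod.mk.injEq] at h; ext <;> tauto)
  have h2 := key {w ∈ V ×ˢ V ×ˢ V | S w.1 w.2.2} (fun w => ((w.1, w.2.2), w.2.1))
    (fun w hw => by simp only [mem_filter, mem_product] at hw ⊢; tauto)
    (fun v w h => by simp only [Prod.mk.injEq] at h; ext <;> tauto)
  have h3 := key {w ∈ V ×ˢ V ×ˢ V | S w.2.1 w.2.2} (fun w => ((w.2.1, w.2.2), w.1))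
    (fun w hw => by simp only [mem_filter, mem_product] at hw ⊢; tauto)
    (fun v w h => by simp only [Prod.mk.injEq] at h; ext <;> tauto)
  rw [filter_or, filter_or]
  have h4 := card_union_le {w ∈ V ×ˢ V ×ˢ V | S w.1 w.2.1}
    ({w ∈ V ×ˢ V ×ˢ V | S w.1 w.2.2} ∪ {w ∈ V ×ˢ V ×ˢ V | S w.2.1 w.2.2})
  have h5 := card_union_le {w ∈ V ×ˢ V ×ˢ V | S w.1 w.2.2} {w ∈ V ×ˢ V ×ˢ V | S w.2.1 w.2.2}
  have h6 := (Nat.cast_le (α := ℝ)).2 (h4.trans (Nat.add_le_add_left h5 _))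
  push_cast at h6
  linarith

theorem Decomp.regWrt_ofColoring {R : Finset (ℕ × ℕ × ℕ)} {A A' : ℕ × ℕ × ℕ → ℝ}
    {f : ℕ → ℕ → ℕ} {mixed : ℕ → ℕ → Prop} {β γ θ B : ℝ}
    (hbox : BoxBound V V V (fun x y z => tripleInd R (x, y, z) - A' (x, y, z)) B)
    (hA0 : ∀ w, 0 ≤ A' w) (hA1 : ∀ w, A' w ≤ 1)
    (hA : ∀ v w, tripleColor f v = tripleColor f w → A v = A w)
    (hAA : ∑ w ∈ V ×ˢ V ×ˢ V, |A' w - A w| ≤ θ * γ * #V ^ 3)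
    (hmixed : ∀ x y x' y', c x = c x' → c y = c y' → g x y = g x' y' → ¬ mixed x y →
      f x y = f x' y')
    (hbad : #{p ∈ V ×ˢ V |
      ¬ UniformPair g ℓ τ {x ∈ V | c x = c p.1} {x ∈ V | c x = c p.2} ∨ mixed p.1 p.2}
      ≤ β * #V ^ 2)
    (hβγ : 3 * β + γ ≤ ε₁) (hℓ : 0 < ℓ) (hθ0 : 0 < θ) (hθ1 : θ ≤ 1) (hθ : 8 * θ ≤ ε₁)
    (hτ0 : 0 ≤ τ) (hτ : 60 * τ ≤ ε₁ * (1 / ℓ) ^ 12) (hτ' : 2 * τ ≤ ε₂) (hB0 : 0 ≤ B)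
    (hB : ∀ i j k, 8 * B ≤ ε₁ * (1 / ℓ) ^ 12 *
      (#{x ∈ V | c x = i} * #{x ∈ V | c x = j} * #{x ∈ V | c x = k})) :
    (Decomp.ofColoring c g hg).regWrt R ε₁ ε₂ := by
  set S : ℕ → ℕ → Prop := fun x y =>
    ¬ UniformPair g ℓ τ {v ∈ V | c v = c x} {v ∈ V | c v = c y} ∨ mixed x y with hS
  set Φ : ℕ × ℕ × ℕ → (Fin t × Fin t × Fin t) × ℕ × ℕ × ℕ := fun w =>
    ((c w.1, c w.2.1, c w.2.2), g w.1 w.2.1, g w.1 w.2.2, g w.2.1 w.2.2) with hΦ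
  set F : ℕ × ℕ × ℕ → ℝ := fun w => |A' w - A w| with hF
  have hm := card_lt_cellAvg_le (Ω := V ×ˢ V ×ˢ V) (Φ := Φ) (F := F) (fun w => abs_nonneg _) θ
  have hm' : (#{w ∈ V ×ˢ V ×ˢ V | θ < cellAvg (V ×ˢ V ×ˢ V) Φ F w} : ℝ) ≤ γ * #V ^ 3 := by
    refine le_of_mul_le_mul_left ?_ hθ0
    calc _ ≤ _ := hm
      _ ≤ _ := hAA
      _ = _ := by ring
  have hs := card_filter_triple_le (V := V) S (b := β * #V ^ 2) (by convert hbad)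
  refine one_sub_mul_le_card_filter (Q := fun w => ¬ ((S w.1 w.2.1 ∨ S w.1 w.2.2 ∨ S w.2.1 w.2.2) ∨
    θ < cellAvg (V ×ˢ V ×ˢ V) Φ F w)) (by rw [card_product, card_product]; push_cast; ring) ?_ ?_
  · simp only [not_not]
    rw [filter_or]
    calc _ ≤ ((#{w ∈ V ×ˢ V ×ˢ V | S w.1 w.2.1 ∨ S w.1 w.2.2 ∨ S w.2.1 w.2.2} : ℝ) +
          #{w ∈ V ×ˢ V ×ˢ V | θ < cellAvg (V ×ˢ V ×ˢ V) Φ F w}) := by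
            exact_mod_cast card_union_le _ _
      _ ≤ 3 * (β * #V ^ 2 * #V) + γ * #V ^ 3 :=
          add_le_add (le_of_eq_of_le (by congr) hs) hm'
      _ = (3 * β + γ) * #V ^ 3 := by ring
      _ ≤ ε₁ * #V ^ 3 := by gcongr
  rintro ⟨x, y, z⟩ hw hgood
  simp only [not_or, hS, not_not, not_lt] at hgood
  obtain ⟨⟨⟨uxy, mxy⟩, ⟨uxz, mxz⟩, ⟨uyz, myz⟩⟩, hθA⟩ := hgood
  simp only [mem_product] at hw
  obtain ⟨hx, hy, hz⟩ := hw
  set α : Fin ℓ := ⟨g x y, hg x hx y hy⟩ with hα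
  set β' : Fin ℓ := ⟨g x z, hg x hx z hz⟩ with hβ'
  set γ' : Fin ℓ := ⟨g y z, hg y hy z hz⟩ with hγ'
  have hK : ∀ v, v ∈ ((Decomp.ofColoring c g hg).triadOf (c x) (c y) (c z) α β' γ').K3 ↔
      v ∈ V ×ˢ V ×ˢ V ∧ Φ v = Φ (x, y, z) := by
    rintro ⟨x', y', z'⟩
    simp only [Triad.K3, Decomp.triadOf, Decomp.ofColoring, mem_filter, mem_product, hΦ,
      Prod.mk.injEq, hα, hβ', hγ']
    tauto
  refine ⟨c x, c y, c z, α, β', γ', (hK _).2 ⟨by simp [hx, hy, hz], rfl⟩, ?_⟩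
  have hX : x ∈ {v ∈ V | c v = c x} := mem_filter.2 ⟨hx, rfl⟩
  have hY : y ∈ {v ∈ V | c v = c y} := mem_filter.2 ⟨hy, rfl⟩
  have hZ : z ∈ {v ∈ V | c v = c z} := mem_filter.2 ⟨hz, rfl⟩
  have hℓ1 : (1 : ℝ) ≤ ℓ := by exact_mod_cast hℓ
  refine dev23_of_bounds (A := A') (p := A (x, y, z)) (θ := θ) (B := B) (d := 1 / ℓ) (τ := τ)
    (by positivity) ((div_le_one (by positivity)).2 hℓ1) (card_pos.2 ⟨x, hX⟩) (card_pos.2 ⟨y, hY⟩)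
    (card_pos.2 ⟨z, hZ⟩)
    (hbox.subset (filter_subset _ _) (filter_subset _ _) (filter_subset _ _)) hA0 hA1 ?_
    (uxy.cutBound hg α) (uxz.cutBound hg β') (uyz.cutBound hg γ') hθ0.le hθ1 hθ hτ0 hτ hτ' hB0
    (hB _ _ _)
  rw [cellAvg_eq_of_mem_iff hK] at hθA
  have hpos : (0 : ℝ) < #((Decomp.ofColoring c g hg).triadOf (c x) (c y) (c z) α β' γ').K3 :=
    Nat.cast_pos.2 (card_pos.2 ⟨(x, y, z), (hK _).2 ⟨by simp [hx, hy, hz], rfl⟩⟩)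
  rw [div_le_iff₀ hpos] at hθA
  refine le_trans (le_of_eq (sum_congr rfl fun v hv => ?_)) hθA
  obtain ⟨_, hv⟩ := (hK v).1 hv
  simp only [hΦ, Prod.mk.injEq] at hv
  obtain ⟨⟨h1, h2, h3⟩, h4, h5, h6⟩ := hv
  simp only [hF]
  rw [hA v (x, y, z)]
  simp only [tripleColor, Prod.mk.injEq]
  exact ⟨(hmixed _ _ _ _ h1.symm h2.symm h4.symm mxy).symm,
    (hmixed _ _ _ _ h1.symm h3.symm h5.symm mxz).symm,
    (hmixed _ _ _ _ h2.symm h3.symm h6.symm myz).symm⟩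

end OfColoring

/-! ### The classes of a colouring of pairs, over a partition of the vertices -/

/-- The class of a pair, relative to the parts of its vertices. -/
noncomputable def partClass {t : ℕ} (f ρ : ℕ → ℕ → ℕ) (q ℓ : ℕ) (V : Finset ℕ) (c : ℕ → Fin t)
    (x y : ℕ) : ℕ :=
  pairClass f ρ q ℓ {v ∈ V | c v = c x} {v ∈ V | c v = c y} x y

/-- The pairs of vertices whose class may contain pairs of several colours. -/
def MixedPair {t : ℕ} (f ρ : ℕ → ℕ → ℕ) (m q ℓ : ℕ) (V : Finset ℕ) (c : ℕ → Fin t)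
    (x y : ℕ) : Prop :=
  MixedClass f m q ℓ {v ∈ V | c v = c x} {v ∈ V | c v = c y} (partClass f ρ q ℓ V c x y)

section PartClass

variable {V : Finset ℕ} {t m q ℓ : ℕ} {c : ℕ → Fin t} {f ρ : ℕ → ℕ → ℕ} {τ τ' δ : ℝ}

lemma partClass_lt (hf : ∀ x y, f x y < m) (hρ : ∀ x y, ρ x y < q) (hq : 0 < q) (hℓ : 0 < ℓ) :
    ∀ x ∈ V, ∀ y ∈ V, partClass f ρ q ℓ V c x y < ℓ := fun _ hx _ hy =>
  pairClass_lt hf hρ hq hℓ (mem_filter.2 ⟨hx, rfl⟩) (mem_filter.2 ⟨hy, rfl⟩)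

lemma color_eq_of_not_mixedPair (hf : ∀ x y, f x y < m) (hρ : ∀ x y, ρ x y < q)
    {x y x' y' : ℕ} (hx : c x = c x') (hy : c y = c y')
    (h : partClass f ρ q ℓ V c x y = partClass f ρ q ℓ V c x' y')
    (hn : ¬ MixedPair f ρ m q ℓ V c x y) : f x y = f x' y' := by
  refine color_eq_of_not_mixedClass hf hρ ?_ hn
  rw [partClass, partClass, ← hx, ← hy] at h
  exact h

lemma uniformPair_partClass (hf : ∀ x y, f x y < m) (hρ : ∀ x y, ρ x y < q) (hq : 0 < q)
    (hc : ∀ i, #V ≤ 2 * t * #{x ∈ V | c x = i}) (hδ : 0 ≤ δ)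
    (hcut : ∀ α < m, ∀ k < q, CutBound V V (fun x y => (if f x y = α then 1 else 0) *
      ((if ρ x y = k then 1 else 0) - 1 / (q : ℝ))) (δ * #V ^ 2))
    (hτ : m * q * (4 * t ^ 2 * δ + τ') + 1 / q ≤ τ) (hV : 0 < #V) {i j : Fin t}
    (hreg : RegPair f m τ' {x ∈ V | c x = i} {x ∈ V | c x = j}) :
    UniformPair (partClass f ρ q ℓ V c) ℓ τ {x ∈ V | c x = i} {x ∈ V | c x = j} := by
  intro α hα
  have hcard : ∀ i, 0 < #{x ∈ V | c x = i} := fun i =>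
    Nat.pos_of_ne_zero fun h => by have := hc i; rw [h] at this; omega
  have hci : ∀ i, (#V : ℝ) ≤ 2 * t * #{x ∈ V | c x = i} := fun i => by exact_mod_cast hc i
  have h1 := cutBound_pairClass (ℓ := ℓ) hf hρ hq (card_pos.1 (hcard i)) (card_pos.1 (hcard j)) hreg
    (fun α hα k hk => (hcut α hα k hk).subset (filter_subset _ _) (filter_subset _ _)) hα
  refine (h1.mono ?_).congr fun x hx y hy => ?_
  · have hsq : (#V : ℝ) ^ 2 ≤ 4 * t ^ 2 * (#{x ∈ V | c x = i} * #{x ∈ V | c x = j}) :=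
      calc (#V : ℝ) ^ 2 = #V * #V := sq _
        _ ≤ (2 * t * #{x ∈ V | c x = i}) * (2 * t * #{x ∈ V | c x = j}) :=
          mul_le_mul (hci i) (hci j) (Nat.cast_nonneg _) (by positivity)
        _ = _ := by ring
    generalize (#{x ∈ V | c x = i} : ℝ) * #{x ∈ V | c x = j} = N at hsq ⊢
    have hN : 0 ≤ N := by
      have := mul_le_mul_of_nonneg_left hsq hδ
      have h2 : 0 < (#V : ℝ) ^ 2 := by positivity
      have h3 : (0 : ℝ) ≤ 4 * t ^ 2 := by positivity
      nlinarith
    calc m * q * (δ * #V ^ 2 + τ' * N) + 1 / q * N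
        ≤ m * q * (δ * (4 * t ^ 2 * N) + τ' * N) + 1 / q * N := by gcongr
      _ = (m * q * (4 * t ^ 2 * δ + τ') + 1 / q) * N := by ring
      _ ≤ τ * N := by gcongr
  · rw [mem_filter] at hx hy
    simp only [partClass, hx.2, hy.2]

lemma sum_card_mul_card : ∑ e : Fin t × Fin t, (#{x ∈ V | c x = e.1} : ℝ) * #{x ∈ V | c x = e.2} =
    #V ^ 2 := by
  have h : ∑ i : Fin t, (#{x ∈ V | c x = i} : ℝ) = #V := by
    exact_mod_cast (card_eq_sum_card_fiberwise (f := c) (t := univ) fun x _ => by simp).symm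
  rw [Fintype.sum_prod_type, sq, ← h, sum_mul_sum]

lemma card_not_uniformPair_or_mixedPair_le (hf : ∀ x y, f x y < m) (hρ : ∀ x y, ρ x y < q)
    (hq : 0 < q) (hℓ : 0 < ℓ) (hτ0 : 0 ≤ τ) (hτℓ : τ ≤ 1 / ℓ)
    (huniform : ∀ i j, RegPair f m τ' {x ∈ V | c x = i} {x ∈ V | c x = j} →
      UniformPair (partClass f ρ q ℓ V c) ℓ τ {x ∈ V | c x = i} {x ∈ V | c x = j})
    (hreg : #{p ∈ V ×ˢ V | ¬ RegPair f m τ' {x ∈ V | c x = c p.1} {x ∈ V | c x = c p.2}}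
      ≤ τ' * #V ^ 2) :
    #{p ∈ V ×ˢ V | ¬ UniformPair (partClass f ρ q ℓ V c) ℓ τ {x ∈ V | c x = c p.1}
      {x ∈ V | c x = c p.2} ∨ MixedPair f ρ m q ℓ V c p.1 p.2} ≤ (τ' + 2 * m / ℓ) * #V ^ 2 := by
  set W : Finset (ℕ × ℕ) := {p ∈ V ×ˢ V | UniformPair (partClass f ρ q ℓ V c) ℓ τ
    {x ∈ V | c x = c p.1} {x ∈ V | c x = c p.2} ∧ MixedPair f ρ m q ℓ V c p.1 p.2} with hW
  have hfib : ∀ e : Fin t × Fin t, (#{p ∈ W | (c p.1, c p.2) = e} : ℝ) ≤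
      2 * m / ℓ * (#{x ∈ V | c x = e.1} * #{x ∈ V | c x = e.2}) := by
    rintro ⟨i, j⟩
    by_cases hu : UniformPair (partClass f ρ q ℓ V c) ℓ τ {x ∈ V | c x = i} {x ∈ V | c x = j}
    · have h1 := card_mixedClass_le (m := m) (q := q) (τ := τ) (X := {x ∈ V | c x = i})
        (Y := {x ∈ V | c x = j}) hf hρ hq hℓ hτ0 (fun α hα => (hu α hα).congr fun x hx y hy => by
          rw [mem_filter] at hx hy
          simp only [partClass, hx.2, hy.2])
      have h2 : #{p ∈ W | (c p.1, c p.2) = (i, j)} ≤ #{p ∈ {x ∈ V | c x = i} ×ˢ {x ∈ V | c x = j} |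
          MixedClass f m q ℓ {x ∈ V | c x = i} {x ∈ V | c x = j}
            (pairClass f ρ q ℓ {x ∈ V | c x = i} {x ∈ V | c x = j} p.1 p.2)} := by
        refine card_le_card fun p hp => ?_
        simp only [hW, mem_filter, mem_product, Prod.mk.injEq] at hp ⊢
        obtain ⟨⟨⟨hx, hy⟩, _, hm⟩, hi, hj⟩ := hp
        simp only [MixedPair, partClass, hi, hj] at hm
        exact ⟨⟨⟨hx, hi⟩, hy, hj⟩, hm⟩
      refine ((Nat.cast_le (α := ℝ)).2 h2).trans (h1.trans ?_)
      have h3 : (0 : ℝ) ≤ #{x ∈ V | c x = i} * #{x ∈ V | c x = j} := by positivity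
      calc (m : ℝ) * ((1 / ℓ + τ) * (#{x ∈ V | c x = i} * #{x ∈ V | c x = j}))
          ≤ m * ((1 / ℓ + 1 / ℓ) * (#{x ∈ V | c x = i} * #{x ∈ V | c x = j})) := by gcongr
        _ = _ := by ring
    · have : {p ∈ W | (c p.1, c p.2) = (i, j)} = ∅ := by
        refine filter_eq_empty_iff.2 fun p hp he => hu ?_
        obtain ⟨hi, hj⟩ := Prod.mk.inj he
        rw [← hi, ← hj]
        exact (mem_filter.1 hp).2.1
      rw [this, card_empty, Nat.cast_zero]
      positivity
  have hWcard : (#W : ℝ) ≤ 2 * m / ℓ * #V ^ 2 := by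
    rw [card_eq_sum_card_fiberwise (f := fun p => (c p.1, c p.2)) (t := univ) fun x _ => by simp]
    push_cast
    refine (sum_le_sum fun e _ => hfib e).trans (le_of_eq ?_)
    rw [← mul_sum, sum_card_mul_card]
  have hsub : {p ∈ V ×ˢ V | ¬ UniformPair (partClass f ρ q ℓ V c) ℓ τ {x ∈ V | c x = c p.1}
      {x ∈ V | c x = c p.2} ∨ MixedPair f ρ m q ℓ V c p.1 p.2} ⊆
      {p ∈ V ×ˢ V | ¬ RegPair f m τ' {x ∈ V | c x = c p.1} {x ∈ V | c x = c p.2}} ∪ W := by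
    intro p hp
    rw [mem_filter] at hp
    rw [mem_union, mem_filter, hW, mem_filter]
    have := huniform (c p.1) (c p.2)
    tauto
  have h1 := (Nat.cast_le (α := ℝ)).2 ((card_le_card hsub).trans (card_union_le _ _))
  push_cast at h1
  linarith

end PartClass

/-! ### The regularity lemma -/

lemma exists_decomp_of_pos (ε₁ : ℝ) (hε₁ : 0 < ε₁) (ε₂ : ℕ → ℝ) (hε₂ : ∀ x, 0 < ε₂ x)
    (t₀ ℓ₀ : ℕ) (ht₀ : 0 < t₀) (hℓ₀ : 0 < ℓ₀) (θ γ : ℝ) (hθ0 : 0 < θ) (hθ1 : θ ≤ 1)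
    (hθ : 8 * θ ≤ ε₁) (hγ : 3 * γ ≤ ε₁) (m : ℕ) (hm : 0 < m) :
    ∃ (ℓ T n₀ : ℕ) (δ : ℝ), 0 < δ ∧ ℓ₀ ≤ ℓ ∧ ∀ (V : Finset ℕ) (R : Finset (ℕ × ℕ × ℕ))
      (f : ℕ → ℕ → ℕ) (A A' : ℕ × ℕ × ℕ → ℝ), n₀ ≤ #V → (∀ x y, f x y < m) →
      BoxBound V V V (fun x y z => tripleInd R (x, y, z) - A' (x, y, z)) (δ * #V ^ 3) →
      (∀ w, 0 ≤ A' w) → (∀ w, A' w ≤ 1) →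
      (∀ v w, tripleColor f v = tripleColor f w → A v = A w) →
      ∑ w ∈ V ×ˢ V ×ˢ V, |A' w - A w| ≤ θ * γ * #V ^ 3 →
      ∃ t, t₀ ≤ t ∧ t ≤ T ∧ ∃ P : Decomp V (Fin t) (Fin ℓ),
        P.isEquitable ε₁ (ε₂ ℓ) ∧ P.regWrt R ε₁ (ε₂ ℓ) := by
  obtain ⟨ℓ, hℓℓ₀, hℓm⟩ : ∃ ℓ : ℕ, ℓ₀ ≤ ℓ ∧ 18 * m / ε₁ ≤ ℓ :=
    ⟨max ℓ₀ ⌈18 * m / ε₁⌉₊, le_max_left _ _,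
      (Nat.le_ceil _).trans (Nat.cast_le.2 (le_max_right _ _))⟩
  have hℓ : 0 < ℓ := hℓ₀.trans_le hℓℓ₀
  have hℓ' : (0 : ℝ) < ℓ := Nat.cast_pos.2 hℓ
  have hm' : (0 : ℝ) < m := Nat.cast_pos.2 hm
  have hd : 0 < ε₁ * (1 / (ℓ : ℝ)) ^ 12 := by positivity
  obtain ⟨τ, hτ0, hτε₂, hτd, hτℓ⟩ : ∃ τ : ℝ, 0 < τ ∧ 2 * τ ≤ ε₂ ℓ ∧
      60 * τ ≤ ε₁ * (1 / (ℓ : ℝ)) ^ 12 ∧ τ ≤ 1 / ℓ := by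
    refine ⟨min (min (ε₂ ℓ / 2) (ε₁ * (1 / (ℓ : ℝ)) ^ 12 / 60)) (1 / ℓ), ?_, ?_, ?_,
      min_le_right _ _⟩
    · have := hε₂ ℓ
      positivity
    · have := (min_le_left (min (ε₂ ℓ / 2) (ε₁ * (1 / (ℓ : ℝ)) ^ 12 / 60)) (1 / (ℓ : ℝ))).trans
        (min_le_left _ _)
      linarith
    · have := (min_le_left (min (ε₂ ℓ / 2) (ε₁ * (1 / (ℓ : ℝ)) ^ 12 / 60)) (1 / (ℓ : ℝ))).trans
        (min_le_right _ _)
      linarith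
  obtain ⟨q, hq, hqτ⟩ : ∃ q : ℕ, 0 < q ∧ 1 / (q : ℝ) ≤ τ / 2 := by
    obtain ⟨n, hn⟩ := exists_nat_one_div_lt (half_pos hτ0)
    exact ⟨n + 1, n.succ_pos, by exact_mod_cast hn.le⟩
  have hq' : (0 : ℝ) < q := Nat.cast_pos.2 hq
  obtain ⟨τ', hτ'0, hτ'τ, hτ'ε⟩ : ∃ τ' : ℝ, 0 < τ' ∧ m * q * τ' ≤ τ / 4 ∧ 9 * τ' ≤ ε₁ := by
    refine ⟨min (τ / 4 / (m * q)) (ε₁ / 9), by positivity, ?_, ?_⟩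
    · calc m * q * min (τ / 4 / (m * q)) (ε₁ / 9) ≤ m * q * (τ / 4 / (m * q)) :=
            mul_le_mul_of_nonneg_left (min_le_left _ _) (by positivity)
        _ = τ / 4 := mul_div_cancel₀ _ (by positivity)
    · linarith [min_le_right (τ / 4 / (m * q)) (ε₁ / 9)]
  obtain ⟨T, hT⟩ := exists_regular_partition m t₀ hm ht₀ τ' hτ'0
  set K : ℝ := (T : ℝ) + 1 with hK
  have hK0 : 0 < K := by positivity
  set δ' : ℝ := τ / 4 / (m * q * (4 * K ^ 2)) with hδ'
  have hδ'0 : 0 < δ' := by positivity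
  refine ⟨ℓ, T, max (max T ⌈2 * m * q / δ' ^ 4⌉₊) 1, ε₁ * (1 / ℓ) ^ 12 / (64 * K ^ 3),
    by positivity, hℓℓ₀, fun V R f A A' hV hf hbox hA0 hA1 hA hAA => ?_⟩
  have hV0 : 0 < #V := (le_max_right _ _).trans hV
  obtain ⟨t, ht₀t, htT, c, hc1, hc2, hreg⟩ :=
    hT V ((le_max_left _ _).trans ((le_max_left _ _).trans hV)) f
  obtain ⟨ρ, hρ, hcut⟩ := exists_quasirandom_splitting m q hq.ne' δ' hδ'0 V
    ((Nat.le_ceil _).trans (Nat.cast_le.2 ((le_max_right _ _).trans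
      ((le_max_left _ _).trans hV)))) f
  have htK : (t : ℝ) ≤ K := by
    have : (t : ℝ) ≤ T := Nat.cast_le.2 htT
    linarith
  have hτsum : m * q * (4 * t ^ 2 * δ' + τ') + 1 / q ≤ τ := by
    have h1 : m * q * (4 * (t : ℝ) ^ 2 * δ') ≤ τ / 4 := by
      calc m * q * (4 * (t : ℝ) ^ 2 * δ') ≤ m * q * (4 * K ^ 2 * δ') := by gcongr
        _ = τ / 4 := by rw [hδ']; field_simp
    rw [mul_add]
    linarith
  have huniform : ∀ i j, RegPair f m τ' {x ∈ V | c x = i} {x ∈ V | c x = j} →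
      UniformPair (partClass f ρ q ℓ V c) ℓ τ {x ∈ V | c x = i} {x ∈ V | c x = j} :=
    fun i j h => uniformPair_partClass hf hρ hq hc2 hδ'0.le hcut hτsum hV0 h
  have hbad := card_not_uniformPair_or_mixedPair_le hf hρ hq hℓ hτ0.le hτℓ huniform hreg
  refine ⟨t, ht₀t, htT, Decomp.ofColoring c (partClass f ρ q ℓ V c) (partClass_lt hf hρ hq hℓ),
    Decomp.isEquitable_ofColoring hc1 hτ0.le hτε₂ ?_,
    Decomp.regWrt_ofColoring hbox hA0 hA1 hA hAA
      (fun x y x' y' hx hy => color_eq_of_not_mixedPair hf hρ hx hy) hbad ?_ hℓ hθ0 hθ1 hθ hτ0.le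
      hτd hτε₂ (by positivity) fun i j k => ?_⟩
  · have h1 : #{p ∈ V ×ˢ V | ¬ UniformPair (partClass f ρ q ℓ V c) ℓ τ {x ∈ V | c x = c p.1}
        {x ∈ V | c x = c p.2}} ≤
        #{p ∈ V ×ˢ V | ¬ RegPair f m τ' {x ∈ V | c x = c p.1} {x ∈ V | c x = c p.2}} :=
      card_le_card (monotone_filter_right _ fun p _ => mt (huniform _ _))
    refine ((Nat.cast_le (α := ℝ)).2 h1).trans (hreg.trans ?_)
    gcongr
    linarith
  · have h1 : 2 * (m : ℝ) / ℓ ≤ ε₁ / 9 := by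
      rw [div_le_iff₀ hε₁] at hℓm
      rw [div_le_div_iff₀ hℓ' (by norm_num)]
      linarith
    linarith
  · have hci : ∀ i, (#V : ℝ) ≤ 2 * K * #{x ∈ V | c x = i} := fun i => by
      calc (#V : ℝ) ≤ 2 * t * #{x ∈ V | c x = i} := by exact_mod_cast hc2 i
        _ ≤ _ := by gcongr
    have h3 : (#V : ℝ) ^ 3 ≤ 8 * K ^ 3 *
        (#{x ∈ V | c x = i} * #{x ∈ V | c x = j} * #{x ∈ V | c x = k}) :=
      calc (#V : ℝ) ^ 3 = #V * #V * #V := by ring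
        _ ≤ (2 * K * #{x ∈ V | c x = i}) * (2 * K * #{x ∈ V | c x = j}) *
            (2 * K * #{x ∈ V | c x = k}) :=
          mul_le_mul (mul_le_mul (hci i) (hci j) (Nat.cast_nonneg _) (by positivity)) (hci k)
            (Nat.cast_nonneg _) (by positivity)
        _ = _ := by ring
    generalize (#{x ∈ V | c x = i} : ℝ) * #{x ∈ V | c x = j} * #{x ∈ V | c x = k} = N at h3 ⊢
    calc 8 * (ε₁ * (1 / ℓ) ^ 12 / (64 * K ^ 3) * #V ^ 3)
        ≤ 8 * (ε₁ * (1 / ℓ) ^ 12 / (64 * K ^ 3) * (8 * K ^ 3 * N)) := by gcongr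
      _ = ε₁ * (1 / ℓ) ^ 12 * N := by
          generalize ε₁ * (1 / (ℓ : ℝ)) ^ 12 = a
          field_simp
          ring

/-- The regularity lemma for `dev_{2,3}`-quasirandomness. -/
theorem stmt_1 (ε₁ : ℝ) (hε₁ : 0 < ε₁) (ε₂ : ℕ → ℝ) (hε₂ : InZeroOne ε₂)
    (t₀ ℓ₀ : ℕ) (ht₀ : 1 ≤ t₀) (hℓ₀ : 1 ≤ ℓ₀) :
    ∃ T₀ L₀ : ℕ, 0 < T₀ ∧ 0 < L₀ ∧ ∃ n₀ : ℕ, ∀ H : ThreeGraph, n₀ ≤ H.verts.card →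
      ∃ t ℓ : ℕ, t₀ ≤ t ∧ t ≤ T₀ ∧ ℓ₀ ≤ ℓ ∧ ℓ ≤ L₀ ∧
        ∃ P : Decomp H.verts (Fin t) (Fin ℓ),
          P.isEquitable ε₁ (ε₂ ℓ) ∧ P.isReg ε₁ (ε₂ ℓ) ∧ P.regWrt H.obar ε₁ (ε₂ ℓ) := by
  set θ : ℝ := min 1 (ε₁ / 8) with hθ
  have hθ0 : 0 < θ := by positivity
  have hθε : 8 * θ ≤ ε₁ := by linarith [min_le_right 1 (ε₁ / 8)]
  set κ : ℝ := θ * (ε₁ / 3) with hκ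
  have hκ0 : 0 < κ := by positivity
  have key : ∀ m, ∃ (ℓ T n₀ : ℕ) (δ : ℝ), 0 < δ ∧ (0 < m → ℓ₀ ≤ ℓ ∧ ∀ (V : Finset ℕ)
      (R : Finset (ℕ × ℕ × ℕ)) (f : ℕ → ℕ → ℕ) (A A' : ℕ × ℕ × ℕ → ℝ), n₀ ≤ #V →
      (∀ x y, f x y < m) →
      BoxBound V V V (fun x y z => tripleInd R (x, y, z) - A' (x, y, z)) (δ * #V ^ 3) →
      (∀ w, 0 ≤ A' w) → (∀ w, A' w ≤ 1) →
      (∀ v w, tripleColor f v = tripleColor f w → A v = A w) →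
      ∑ w ∈ V ×ˢ V ×ˢ V, |A' w - A w| ≤ κ * #V ^ 3 →
      ∃ t, t₀ ≤ t ∧ t ≤ T ∧ ∃ P : Decomp V (Fin t) (Fin ℓ),
        P.isEquitable ε₁ (ε₂ ℓ) ∧ P.regWrt R ε₁ (ε₂ ℓ)) := by
    intro m
    rcases m.eq_zero_or_pos with rfl | hm
    · exact ⟨0, 0, 0, 1, one_pos, fun h => absurd h (lt_irrefl _)⟩
    · obtain ⟨ℓ, T, n₀, δ, hδ, h⟩ := exists_decomp_of_pos ε₁ hε₁ ε₂ (fun x => (hε₂ x).1) t₀ ℓ₀ ht₀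
        hℓ₀ θ (ε₁ / 3) hθ0 (min_le_left _ _) hθε (by linarith) m hm
      exact ⟨ℓ, T, n₀, δ, hδ, fun _ => h⟩
  choose ℓ T n₀ δ hδ hmain using key
  set sizes : Finset ℕ := (range (⌊(κ ^ 2)⁻¹⌋₊ + 1)).image (chainSize (8 * ·) δ 1) with hsizes
  refine ⟨sizes.sup T + 1, sizes.sup ℓ + 1, Nat.succ_pos _, Nat.succ_pos _, sizes.sup n₀,
    fun H hH => ?_⟩
  obtain ⟨s, hs, f, f', hf, hbox, hsum⟩ :=
    exists_tripleColor_pair (κ ^ 2) (by positivity) δ hδ H.verts H.obar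
  have hmem : chainSize (8 * ·) δ 1 s ∈ sizes :=
    mem_image_of_mem _ (mem_range.2 (Nat.lt_succ_of_le hs))
  generalize chainSize (8 * ·) δ 1 s = m at hf hbox hmem
  obtain ⟨hℓ, h⟩ := hmain m ((Nat.zero_le _).trans_lt (hf 0 0))
  have hind : ∀ w, 0 ≤ tripleInd H.obar w ∧ tripleInd H.obar w ≤ 1 := fun w => by
    unfold tripleInd; split_ifs <;> simp
  obtain ⟨t, ht₀t, htT, P, hP, hP'⟩ := h H.verts H.obar f _ _ ((le_sup hmem).trans hH) hf hbox
    (cellAvg_nonneg fun w => (hind w).1) (cellAvg_le_one fun w => (hind w).2)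
    (fun v w h => cellAvg_congr h)
    (sum_abs_le_of_sum_sq_le hκ0.le (by rw [card_product, card_product]; push_cast; ring) hsum)
  exact ⟨t, ℓ m, ht₀t, (htT.trans (le_sup hmem)).trans (Nat.le_succ _), hℓ,
    (le_sup hmem).trans (Nat.le_succ _), P, hP, P.isReg_of_isEquitable (hε₂ _).1.le hP, hP'⟩
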